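/- Let B be an open ball in ℝ^m with 1 ≤ m ≤ n, let f : B → ℝⁿ be an analytic nondegenerate immersion, and let 𝓜 = f(B) be the immersed manifold. Let W be a finite or countable subset of R_n with inf{τ(r) : r ∈ W} > 0. Then dim(⋂_{r ∈ W} Bad(r) ∩ 𝓜) = dim 𝓜 = m. In particular, for any finite collection r₁,…,r_N ∈ R_n, dim(⋂_{k=1}^N Bad(r_k) ∩ 𝓜) = dim 𝓜. -/

import Mathlib

open MeasureTheory ENNReal

/-- Distance from a real number to the nearest integer. -/
noncomputable def distNearestInt (x : ℝ) : ℝ := ⨅ p : ℤ, |x - (p : ℝ)|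

/-- `badPow ρ x = x ^ (1/ρ)`, with the convention `x ^ (1/0) = 0`. -/
noncomputable def badPow (ρ x : ℝ) : ℝ := if ρ = 0 then 0 else x ^ (1 / ρ)

/-- The set `R_n` of weight vectors: nonnegative components summing to `1`. -/
def Weights (n : ℕ) : Set (Fin n → ℝ) := {r | (∑ i, r i) = 1 ∧ ∀ i, 0 ≤ r i}

/-- `τ(r)`: the smallest strictly positive component of `r`. -/
noncomputable def tauW {n : ℕ} (r : Fin n → ℝ) : ℝ := sInf {t | 0 < t ∧ ∃ i, r i = t}

/-- The set `Bad(r)` of `r`-badly approximable points of `ℝⁿ`. -/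
def BadSet {n : ℕ} (r : Fin n → ℝ) : Set (EuclideanSpace ℝ (Fin n)) :=
  {y | ∃ c > 0, ∀ q : ℕ, 1 ≤ q →
    ∃ i, c * (q : ℝ)⁻¹ ≤ badPow (r i) (distNearestInt (q * y i))}

/-- A map `f : B → ℝⁿ` is nondegenerate if `1, f₁, …, fₙ` are linearly
independent over `ℝ` (as functions on `B`). -/
def NondegOn {m n : ℕ} (f : EuclideanSpace ℝ (Fin m) → EuclideanSpace ℝ (Fin n))
    (B : Set (EuclideanSpace ℝ (Fin m))) : Prop :=
  ∀ (c : ℝ) (a : Fin n → ℝ), (∀ x ∈ B, c + ∑ i, a i * f x i = 0) → c = 0 ∧ (∀ i, a i = 0)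


namespace BM
open Polynomial

/-- greedy separated points -/
lemma sep_points (Z : Set ℝ) (l : ℝ) (hl : 0 < l) (k : ℕ) :
    volume Z ≤ ENNReal.ofReal (2 * k * l) ∨
    ∃ x : Fin (k + 1) → ℝ, (∀ i, x i ∈ Z) ∧ ∀ i j, i ≠ j → l ≤ |x i - x j| := by
  induction k with
  | zero =>
    rcases Set.eq_empty_or_nonempty Z with h | ⟨z, hz⟩
    · left; simp [h]
    · right
      refine ⟨fun _ => z, fun _ => hz, fun i j hij => ?_⟩
      exact absurd (Subsingleton.elim (α := Fin 1) i j) hij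
  | succ k ih =>
    rcases ih with h | ⟨x, hx, hs⟩
    · left
      refine h.trans (ENNReal.ofReal_le_ofReal ?_)
      push_cast; nlinarith
    · by_cases hc : Z ⊆ ⋃ i, Metric.ball (x i) l
      · left
        calc volume Z ≤ volume (⋃ i, Metric.ball (x i) l) := measure_mono hc
          _ ≤ ∑ i : Fin (k + 1), volume (Metric.ball (x i) l) := measure_iUnion_fintype_le _ _
          _ = ENNReal.ofReal (2 * ((k + 1 : ℕ) : ℝ) * l) := by
            simp only [Real.volume_ball, Finset.sum_const, Finset.card_univ, Fintype.card_fin]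
            rw [nsmul_eq_mul, ← ENNReal.ofReal_natCast, ← ENNReal.ofReal_mul (by positivity)]
            congr 1; ring
      · right
        obtain ⟨z, hz, hzn⟩ := Set.not_subset.1 hc
        simp only [Set.mem_iUnion, Metric.mem_ball, not_exists, not_lt, Real.dist_eq] at hzn
        refine ⟨Fin.cons z x, ?_, ?_⟩
        · intro i; refine Fin.cases ?_ ?_ i
          · simpa using hz
          · intro i; simpa using hx i
        · intro i j
          refine Fin.cases ?_ ?_ i
          · refine Fin.cases ?_ ?_ j
            · intro h; exact absurd rfl h
            · intro j _; simpa using hzn j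
          · intro i
            refine Fin.cases ?_ ?_ j
            · intro _; simpa [abs_sub_comm] using hzn i
            · intro j hij
              simpa using hs i j (fun h => hij (by rw [h]))

/-- Remez-type inequality. -/
lemma poly_small (d : ℕ) (hd : 1 ≤ d) (p : ℝ[X]) (hp : p.natDegree ≤ d) (a b : ℝ) (hab : a < b)
    (S : ℝ) (hS : 0 < S) (x0 : ℝ) (hx0 : x0 ∈ Set.Icc a b) (hpx : S ≤ |p.eval x0|)
    (ε : ℝ) (hε : 0 < ε) :
    volume {x | x ∈ Set.Icc a b ∧ |p.eval x| < ε * S} ≤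
      ENNReal.ofReal (2 * d * (d + 1) * ε ^ (1 / d : ℝ) * (b - a)) := by
  set l : ℝ := (b - a) * ((d + 1) * ε) ^ (1 / d : ℝ) with hl
  have hd0 : (0 : ℝ) < d := by exact_mod_cast hd
  have hl0 : 0 < l := by have := sub_pos.2 hab; positivity
  rcases sep_points {x | x ∈ Set.Icc a b ∧ |p.eval x| < ε * S} l hl0 d with h | ⟨x, hx, hs⟩
  · refine h.trans (ENNReal.ofReal_le_ofReal ?_)
    rw [hl, Real.mul_rpow (by positivity) hε.le]
    have h1 : ((d : ℝ) + 1) ^ (1 / d : ℝ) ≤ (d + 1) := by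
      conv_rhs => rw [← Real.rpow_one ((d : ℝ) + 1)]
      apply Real.rpow_le_rpow_of_exponent_le (by linarith)
      rw [div_le_one hd0]; exact_mod_cast hd
    have h2 : 0 ≤ ε ^ (1 / d : ℝ) := by positivity
    have h3 := sub_pos.2 hab
    calc 2 * (d : ℝ) * ((b - a) * (((d : ℝ) + 1) ^ (1 / d : ℝ) * ε ^ (1 / d : ℝ)))
        ≤ 2 * (d : ℝ) * ((b - a) * ((d + 1) * ε ^ (1 / d : ℝ))) := by gcongr
      _ = _ := by ring
  · exfalso
    have hinj : Set.InjOn x (Finset.univ : Finset (Fin (d + 1))) := by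
      intro i _ j _ hij
      by_contra hne
      have := hs i j hne
      rw [hij, sub_self, abs_zero] at this
      linarith
    have hdeg : p.degree < (Finset.univ : Finset (Fin (d + 1))).card := by
      simp only [Finset.card_univ, Fintype.card_fin]
      refine lt_of_le_of_lt (Polynomial.degree_le_natDegree) ?_
      exact_mod_cast Nat.lt_succ_of_le hp
    have heq := Lagrange.eq_interpolate hinj hdeg
    have hev : p.eval x0 = ∑ i : Fin (d + 1), p.eval (x i) *
        (Lagrange.basis Finset.univ x i).eval x0 := by
      conv_lhs => rw [heq, Lagrange.interpolate_apply]
      simp [Polynomial.eval_finset_sum]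
    have hb : ∀ i : Fin (d + 1), |(Lagrange.basis Finset.univ x i).eval x0| ≤ ((b - a) / l) ^ d := by
      intro i
      rw [Lagrange.basis, Polynomial.eval_prod, Finset.abs_prod]
      have hcard : (Finset.univ.erase i).card = d := by simp
      conv_rhs => rw [← hcard, ← Finset.prod_const]
      apply Finset.prod_le_prod
      · intros; positivity
      · intro j hj
        have hne : i ≠ j := (Finset.ne_of_mem_erase hj).symm
        simp only [Lagrange.basisDivisor, eval_mul, eval_C, eval_sub, eval_X, abs_mul, abs_inv]
        rw [inv_mul_eq_div]
        have := hs i j hne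
        have h4 := (hx j).1
        apply div_le_div₀ (by linarith) _ hl0 this
        rw [abs_le]; constructor <;> linarith [hx0.1, hx0.2, h4.1, h4.2]
    have hlt : |p.eval x0| < S := by
      calc |p.eval x0| ≤ ∑ i : Fin (d + 1), |p.eval (x i)| * ((b - a) / l) ^ d := by
            rw [hev]
            refine (Finset.abs_sum_le_sum_abs _ _).trans (Finset.sum_le_sum fun i _ => ?_)
            rw [abs_mul]
            exact mul_le_mul_of_nonneg_left (hb i) (abs_nonneg _)
        _ < ∑ i : Fin (d + 1), (ε * S) * ((b - a) / l) ^ d := by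
            apply Finset.sum_lt_sum_of_nonempty Finset.univ_nonempty
            intro i _
            have : 0 < (b - a) / l := div_pos (sub_pos.2 hab) hl0
            exact mul_lt_mul_of_pos_right (hx i).2 (by positivity)
        _ = S := by
            have h5 : ((b - a) / l) ^ d = 1 / ((d + 1) * ε) := by
              have h3 := (sub_pos.2 hab).ne'
              rw [hl, div_mul_eq_div_div, div_self h3, div_pow, one_pow, ← Real.rpow_natCast,
                ← Real.rpow_mul (by positivity), one_div_mul_cancel hd0.ne', Real.rpow_one]
            rw [h5]; simp only [Finset.sum_const, Finset.card_univ, Fintype.card_fin, nsmul_eq_mul]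
            push_cast; field_simp
    linarith

/-- Doubling for polynomials on a large subinterval. -/
lemma poly_double (d : ℕ) (hd : 1 ≤ d) : ∃ c : ℝ, 0 < c ∧ c ≤ 1 ∧ ∀ (p : ℝ[X]), p.natDegree ≤ d →
    ∀ (a b a' b' : ℝ), a < b → a ≤ a' → b' ≤ b → b' - a' = (b - a) / 2 → 
    ∀ S : ℝ, 0 < S → (∃ x ∈ Set.Icc a b, S ≤ |p.eval x|) → ∃ x ∈ Set.Icc a' b', c * S ≤ |p.eval x| := by
  have hd0 : (0 : ℝ) < d := by exact_mod_cast hd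
  refine ⟨(1 / (8 * d * (d + 1))) ^ d, by positivity, ?_, ?_⟩
  · apply pow_le_one₀ (by positivity)
    rw [div_le_one (by positivity)]
    have : (1 : ℝ) ≤ d := by exact_mod_cast hd
    nlinarith
  intro p hp a b a' b' hab ha hb hlen S hS ⟨x0, hx0, hpx⟩
  by_contra hcon
  push Not at hcon
  have h := poly_small d hd p hp a b hab S hS x0 hx0 hpx ((1 / (8 * d * (d + 1))) ^ d) (by positivity)
  have hsub : Set.Icc a' b' ⊆ {x | x ∈ Set.Icc a b ∧ |p.eval x| < (1 / (8 * d * (d + 1))) ^ d * S} := by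
    intro x hx
    exact ⟨⟨ha.trans hx.1, hx.2.trans hb⟩, hcon x hx⟩
  have h2 := (measure_mono hsub).trans h
  have hpow : ((1 / (8 * (d : ℝ) * (d + 1))) ^ d) ^ (1 / d : ℝ) = 1 / (8 * d * (d + 1)) := by
    rw [← Real.rpow_natCast, ← Real.rpow_mul (by positivity), mul_one_div_cancel hd0.ne', Real.rpow_one]
  rw [Real.volume_Icc, hpow, hlen] at h2
  have h3 := sub_pos.2 hab
  have h4 : 2 * (d : ℝ) * (d + 1) * (1 / (8 * d * (d + 1))) * (b - a) = (b - a) / 4 := by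
    field_simp; ring
  rw [h4, ENNReal.ofReal_le_ofReal_iff (by linarith)] at h2
  linarith

end BM


namespace BM
open Matrix

variable {C : Type*}

/-- the minor of the columns `u` with rows `σ` -/
noncomputable def minor {k : ℕ} (u : Fin k → C → ℝ) (σ : Fin k → C) : ℝ :=
  (Matrix.of fun i j => u j (σ i)).det

lemma minor_change {k : ℕ} (u u' : Fin k → C → ℝ) (K : Matrix (Fin k) (Fin k) ℝ)
    (h : ∀ j, u' j = ∑ l, K l j • u l) (σ : Fin k → C) :
    minor u' σ = minor u σ * K.det := by
  unfold minor
  rw [← Matrix.det_mul]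
  congr 1
  ext i j
  simp [h, Matrix.mul_apply, Finset.sum_apply, mul_comm]

lemma updateRow_of {k : ℕ} (u : Fin k → C → ℝ) (σ : Fin k → C) (i : Fin k) (c : C) :
    (Matrix.of fun i j => u j (σ i)).updateRow i (fun j => u j c)
      = Matrix.of fun i' j => u j (Function.update σ i c i') := by
  ext i' j
  by_cases h : i' = i
  · subst h; simp
  · simp [Matrix.updateRow_ne h, Function.update_of_ne h]

lemma minor_update {k : ℕ} (u : Fin k → C → ℝ) (σ : Fin k → C) (i : Fin k) (c : C) :
    minor u (Function.update σ i c)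
      = (Matrix.of fun i j => u j (σ i))ᵀ.cramer (fun j => u j c) i := by
  rw [Matrix.cramer_transpose_apply, updateRow_of]; rfl

/-- Cramer: expressing a row through the rows of `τ`. -/
lemma minor_cramer {k : ℕ} (u : Fin k → C → ℝ) (τ : Fin k → C) (c : C) (l : Fin k) :
    minor u τ * u l c = ∑ j, minor u (Function.update τ j c) * u l (τ j) := by
  have h := Matrix.mulVec_cramer (Matrix.of fun i j => u j (τ i))ᵀ (fun j => u j c)
  have h2 := congrFun h l
  rw [Matrix.det_transpose] at h2
  simp only [Matrix.mulVec, dotProduct, Pi.smul_apply, smul_eq_mul] at h2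
  unfold minor at *
  rw [← h2]
  refine Finset.sum_congr rfl fun j _ => ?_
  have := minor_update u τ j c
  unfold minor at this
  rw [this, mul_comm]
  simp [Matrix.transpose_apply]

/-- Pluecker exchange. -/
lemma plucker {k : ℕ} (u : Fin k → C → ℝ) (σ τ : Fin k → C) (i : Fin k) :
    minor u σ * minor u τ
      = ∑ j, minor u (Function.update σ i (τ j)) * minor u (Function.update τ j (σ i)) := by
  have h1 : (minor u τ) • (fun l => u l (σ i))
      = ∑ j, minor u (Function.update τ j (σ i)) • (fun l => u l (τ j)) := by
    ext l
    simp only [Pi.smul_apply, smul_eq_mul, Finset.sum_apply]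
    exact minor_cramer u τ (σ i) l
  have h2 := congrArg (fun v => (Matrix.of fun i j => u j (σ i))ᵀ.cramer v i) h1
  simp only [map_smul, map_sum, Finset.sum_apply, Pi.smul_apply, smul_eq_mul] at h2
  simp only [← minor_update] at h2
  rw [Function.update_eq_self] at h2
  rw [mul_comm, h2]
  exact Finset.sum_congr rfl fun j _ => mul_comm _ _

lemma minor_cons {k : ℕ} (u : Fin k → C → ℝ) (v : C → ℝ) (σ : Fin (k+1) → C) :
    minor (Fin.cons v u : Fin (k+1) → C → ℝ) σ
      = ∑ i : Fin (k+1), (-1) ^ (i:ℕ) * v (σ i) * minor u (σ ∘ i.succAbove) := by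
  unfold minor
  rw [Matrix.det_succ_column_zero]
  rfl

section norm
variable [Fintype C]

noncomputable def psi {k : ℕ} (u : Fin k → C → ℝ) : ℝ := ‖fun σ => minor u σ‖

lemma psi_nonneg {k : ℕ} (u : Fin k → C → ℝ) : 0 ≤ psi u := norm_nonneg _

lemma le_psi {k : ℕ} (u : Fin k → C → ℝ) (σ) : |minor u σ| ≤ psi u :=
  norm_le_pi_norm (fun σ => minor u σ) σ

lemma psi_le {k : ℕ} (u : Fin k → C → ℝ) {r : ℝ} (hr : 0 ≤ r) (h : ∀ σ, |minor u σ| ≤ r) :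
    psi u ≤ r := (pi_norm_le_iff_of_nonneg hr).2 h

lemma psi_lt_iff {k : ℕ} (u : Fin k → C → ℝ) {r : ℝ} (hr : 0 < r) :
    psi u < r ↔ ∀ σ, |minor u σ| < r := pi_norm_lt_iff hr

lemma le_psi_iff {k : ℕ} (u : Fin k → C → ℝ) {r : ℝ} (hr : 0 < r) :
    r ≤ psi u ↔ ∃ σ, r ≤ |minor u σ| := by
  rw [← not_lt, psi_lt_iff u hr]; push Not; rfl

lemma psi_change {k : ℕ} (u u' : Fin k → C → ℝ) (K : Matrix (Fin k) (Fin k) ℝ)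
    (h : ∀ j, u' j = ∑ l, K l j • u l) : psi u' = |K.det| * psi u := by
  unfold psi
  have : (fun σ => minor u' σ) = K.det • (fun σ => minor u σ) := by
    ext σ; rw [minor_change u u' K h]; simp [mul_comm]
  rw [this, norm_smul]; rfl

lemma psi_cons_le {k : ℕ} (u : Fin k → C → ℝ) (v : C → ℝ) :
    psi (Fin.cons v u : Fin (k+1) → C → ℝ) ≤ (k+1) * psi u * ‖v‖ := by
  refine psi_le _ (by have := psi_nonneg u; positivity) fun σ => ?_
  rw [minor_cons]
  refine (Finset.abs_sum_le_sum_abs _ _).trans ?_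
  calc ∑ i : Fin (k+1), |(-1) ^ (i:ℕ) * v (σ i) * minor u (σ ∘ i.succAbove)|
      ≤ ∑ i : Fin (k+1), ‖v‖ * psi u := by
        refine Finset.sum_le_sum fun i _ => ?_
        rw [abs_mul, abs_mul, abs_pow, abs_neg, abs_one, one_pow, one_mul]
        exact mul_le_mul (norm_le_pi_norm v _) (le_psi _ _) (abs_nonneg _) (norm_nonneg _)
    _ = (k+1) * psi u * ‖v‖ := by simp; ring

lemma psi_zero (u : Fin 0 → C → ℝ) : psi u = 1 := by
  apply le_antisymm
  · exact psi_le _ zero_le_one fun σ => by simp [minor]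
  · refine le_trans ?_ (le_psi u Fin.elim0); simp [minor]

/-- linear independence gives a nonzero minor -/
lemma exists_minor_ne {k : ℕ} (u : Fin k → C → ℝ) (h : LinearIndependent ℝ u) :
    ∃ σ, minor u σ ≠ 0 := by
  set A : Matrix (Fin k) C ℝ := Matrix.of u with hA
  have hr : A.rank = k := by
    have := LinearIndependent.rank_matrix (M := A) h
    simpa using this
  rw [Matrix.rank_eq_finrank_span_cols] at hr
  obtain ⟨f, hf, -, hli⟩ := Submodule.exists_fun_fin_finrank_span_eq ℝ (Set.range A.col)
  choose σ hσ using hf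
  refine ⟨fun i => σ (Fin.cast hr.symm i), ?_⟩
  have h2 : LinearIndependent ℝ (fun i : Fin k => f (Fin.cast hr.symm i)) :=
    hli.comp _ (Fin.cast_injective _)
  unfold minor
  have h3 : IsUnit (Matrix.of fun i j => u j (σ (Fin.cast hr.symm i))) := by
    rw [← Matrix.linearIndependent_rows_iff_isUnit]
    have e : (Matrix.of fun i j => u j (σ (Fin.cast hr.symm i))).row
        = fun i : Fin k => f (Fin.cast hr.symm i) := by
      ext i j
      rw [← hσ]; rfl
    rw [e]; exact h2
  exact ((Matrix.isUnit_iff_isUnit_det _).1 h3).ne_zero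
end norm

/-- Minkowski's linear forms theorem with slack -/
lemma minkowski_forms {k : ℕ} (hk : 1 ≤ k) (A : Matrix (Fin k) (Fin k) ℝ) (hA : A.det ≠ 0) :
    ∃ c : Fin k → ℤ, c ≠ 0 ∧ ∀ i, |∑ j, A i j * c j| ≤ 2 * |A.det| ^ (1 / (k:ℝ)) := by
  set R : ℝ := 2 * |A.det| ^ (1 / (k:ℝ)) with hR
  have hD : 0 < |A.det| := abs_pos.2 hA
  have hRpos : 0 < R := by positivity
  set S : Set (Fin k → ℝ) := (Matrix.toLin' A) ⁻¹' Metric.ball 0 R with hS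
  have hdet : LinearMap.det (Matrix.toLin' A) ≠ 0 := by rwa [LinearMap.det_toLin']
  have hvol : volume S = ENNReal.ofReal (4 ^ k) := by
    rw [hS, Measure.addHaar_preimage_linearMap _ hdet, Real.volume_pi_ball _ hRpos,
      ← ENNReal.ofReal_mul (abs_nonneg _), LinearMap.det_toLin']
    congr 1
    rw [hR, ← mul_assoc, mul_pow, Fintype.card_fin, ← Real.rpow_natCast (|A.det| ^ _) k,
      ← Real.rpow_mul hD.le, one_div, inv_mul_cancel₀ (by positivity), Real.rpow_one, abs_inv]
    norm_num
    field_simp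
  have fund := ZSpan.isAddFundamentalDomain (Pi.basisFun ℝ (Fin k)) (volume : Measure (Fin k → ℝ))
  have hF : volume (ZSpan.fundamentalDomain (Pi.basisFun ℝ (Fin k))) = 1 := by
    rw [ZSpan.fundamentalDomain_pi_basisFun, volume_pi, Measure.pi_pi]; simp
  have : Countable (Submodule.span ℤ (Set.range (Pi.basisFun ℝ (Fin k)))).toAddSubgroup := by
    change Countable (Submodule.span ℤ (Set.range (Pi.basisFun ℝ (Fin k))))
    infer_instance
  obtain ⟨x, hx0, hxS⟩ := exists_ne_zero_mem_lattice_of_measure_mul_two_pow_lt_measure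
    (L := (Submodule.span ℤ (Set.range (Pi.basisFun ℝ (Fin k)))).toAddSubgroup) (s := S) fund
    (by
      intro x hx
      simp only [hS, Set.mem_preimage, map_neg, Metric.mem_ball, dist_zero_right, norm_neg] at hx ⊢
      exact hx)
    ((convex_ball _ _).linear_preimage _)
    (by
      rw [hF, hvol, one_mul]
      simp only [Module.finrank_fin_fun]
      have h2 : (2:ENNReal) ^ k = ENNReal.ofReal (2 ^ k) := by
        rw [ENNReal.ofReal_pow (by norm_num)]; norm_num
      rw [h2]
      refine (ENNReal.ofReal_lt_ofReal_iff (by positivity)).2 ?_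
      exact pow_lt_pow_left₀ (by norm_num) (by norm_num) (by omega))
  have hmem : ∀ i, ∃ z : ℤ, (z:ℝ) = (x : Fin k → ℝ) i := by
    have := ((Pi.basisFun ℝ (Fin k)).mem_span_iff_repr_mem ℤ (x : Fin k → ℝ)).1 x.2
    intro i
    obtain ⟨z, hz⟩ := this i
    exact ⟨z, by simpa using hz⟩
  choose c hc using hmem
  refine ⟨c, ?_, fun i => ?_⟩
  · rintro rfl
    apply hx0
    ext i
    rw [← hc]; simp
  · have h1 : ‖Matrix.toLin' A (x : Fin k → ℝ)‖ < R := by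
      simpa [hS] using hxS
    have h2 := (norm_le_pi_norm _ i).trans h1.le
    rw [Real.norm_eq_abs] at h2
    have e : ∑ j, A i j * (c j : ℝ) = (Matrix.toLin' A) (x : Fin k → ℝ) i := by
      simp [Matrix.toLin'_apply, Matrix.mulVec, dotProduct, hc]
    rw [e]; exact h2

lemma minkowski_minors [Fintype C] {k : ℕ} (hk : 1 ≤ k) (u : Fin k → C → ℝ)
    (hne : ∃ σ, minor u σ ≠ 0) (μ : ℝ) (hμ : ∀ σ, |minor u σ| ≤ μ) :
    ∃ c : Fin k → ℤ, c ≠ 0 ∧ ∀ r, |∑ j, c j * u j r| ≤ 2 * k * μ ^ (1 / (k:ℝ)) := by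
  classical
  obtain ⟨σ₀, hσ₀⟩ := hne
  obtain ⟨J, -, hJ⟩ := Finset.exists_max_image (Finset.univ : Finset (Fin k → C))
    (fun σ => |minor u σ|) ⟨σ₀, Finset.mem_univ _⟩
  have hJ' : ∀ σ, |minor u σ| ≤ |minor u J| := fun σ => hJ σ (Finset.mem_univ _)
  have hJ0 : 0 < |minor u J| := (abs_pos.2 hσ₀).trans_le (hJ' σ₀)
  obtain ⟨c, hc0, hc⟩ := minkowski_forms hk (Matrix.of fun i j => u j (J i))
    (abs_pos.1 hJ0)
  refine ⟨c, hc0, fun r => ?_⟩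
  have hR : (2 * |minor u J| ^ (1 / (k:ℝ))) ≤ 2 * μ ^ (1 / (k:ℝ)) := by
    have := hμ J
    gcongr
  have key : minor u J * ∑ j, c j * u j r
      = ∑ i, minor u (Function.update J i r) * ∑ j, u j (J i) * c j := by
    rw [Finset.mul_sum]
    simp_rw [Finset.mul_sum]
    rw [Finset.sum_comm]
    refine Finset.sum_congr rfl fun j _ => ?_
    rw [mul_left_comm, minor_cramer, Finset.mul_sum]
    exact Finset.sum_congr rfl fun i _ => by ring
  have h1 : |minor u J| * |∑ j, c j * u j r| ≤ |minor u J| * (2 * k * μ ^ (1 / (k:ℝ))) := by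
    rw [← abs_mul, key]
    refine (Finset.abs_sum_le_sum_abs _ _).trans ?_
    calc _ ≤ ∑ i : Fin k, |minor u J| * (2 * μ ^ (1 / (k:ℝ))) := by
          refine Finset.sum_le_sum fun i _ => ?_
          rw [abs_mul]
          refine mul_le_mul (hJ' _) ((hc i).trans hR) (abs_nonneg _) (abs_nonneg _)
      _ = _ := by simp; ring
  exact le_of_mul_le_mul_left h1 hJ0

end BM


set_option linter.unusedSectionVars false
set_option linter.unusedVariables false
namespace BM

/-- constants in the quantitative nondivergence estimate -/
noncomputable def Kc (K0 α c1 : ℝ) : ℕ → ℝ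
  | 0 => 1
  | d+1 => K0 * (1/c1^2)^α + 2 * (Kc K0 α c1 d * (1/c1)^α) + 1

lemma Kc_ge_one (K0 α c1 : ℝ) (hK0 : 0 ≤ K0) (hc1 : 0 < c1) (d : ℕ) : 1 ≤ Kc K0 α c1 d := by
  induction d with
  | zero => simp [Kc]
  | succ d ih =>
    simp only [Kc]
    have : 0 ≤ K0 * (1/c1^2)^α := by positivity
    have : 0 ≤ Kc K0 α c1 d * (1/c1)^α := mul_nonneg (by linarith) (by positivity)
    linarith

section abs
variable {T E : Type*} [AddCommGroup E] [Module ℝ E] [FiniteDimensional ℝ E]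

/-- the conclusion for a point -/
def Good (sp : T → Submodule ℝ E) (Ψ : T → ℝ → ℝ) (ext : T → E → T) (Zs : Set E)
    (u : T) (V : Submodule ℝ E) (ε x : ℝ) : Prop :=
  Ψ u x ≤ 1 → (∀ t, sp t = V → ε ≤ Ψ t x) → ∀ v ∈ Zs, v ∈ V → v ∉ sp u →
    ∃ s, v ∉ sp s ∧ Ψ s x ≤ 1 ∧ ε ≤ Ψ (ext s v) x

theorem qn_abs (sp : T → Submodule ℝ E) (Ψ : T → ℝ → ℝ) (ext : T → E → T) (Zs : Set E)
    (α K0 c1 : ℝ) (hα : 0 < α) (hK0 : 0 ≤ K0) (hc1 : 0 < c1) (hc1' : c1 ≤ 1)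
    (hcont : ∀ t, Continuous (Ψ t)) (hnn : ∀ t x, 0 ≤ Ψ t x)
    (hsmall : ∀ t a b S x0 ε, a < b → 0 < S → x0 ∈ Set.Icc a b → S ≤ Ψ t x0 → 0 < ε →
      volume {x | x ∈ Set.Icc a b ∧ Ψ t x < ε * S} ≤ ENNReal.ofReal (K0 * ε ^ α * (b - a)))
    (hdouble : ∀ t a b a' b' S, a < b → a ≤ a' → b' ≤ b → b' - a' = (b - a)/2 → 0 < S →
      (∃ x ∈ Set.Icc a b, S ≤ Ψ t x) → ∃ x ∈ Set.Icc a' b', c1 * S ≤ Ψ t x)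
    (hprop : ∀ s t, sp s = sp t → ∃ κ : ℝ, 0 ≤ κ ∧ ∀ x, Ψ t x = κ * Ψ s x)
    (hext : ∀ s, ∀ v ∈ Zs, v ∉ sp s → sp (ext s v) = sp s ⊔ Submodule.span ℝ {v}) :
    ∀ (d : ℕ) (u : T) (V : Submodule ℝ E) (ρ ε a b : ℝ), sp u ≤ V →
      Module.finrank ℝ V ≤ Module.finrank ℝ (sp u) + d → 0 < ρ → ρ ≤ 1 → 0 < ε → a < b →
      (∀ t, sp u < sp t → sp t < V → ∃ x ∈ Set.Icc a b, ρ ≤ Ψ t x) →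
      volume {x | x ∈ Set.Icc a b ∧ ¬ Good sp Ψ ext Zs u V ε x}
        ≤ ENNReal.ofReal (Kc K0 α c1 d * (ε/ρ)^α * (b-a)) := by
  intro d
  induction d with
  | zero =>
    intro u V ρ ε a b huV hfin _ _ _ _ _
    have : V = sp u := (Submodule.eq_of_le_of_finrank_le huV (by simpa using hfin)).symm
    have h0 : {x | x ∈ Set.Icc a b ∧ ¬ Good sp Ψ ext Zs u V ε x} = ∅ := by
      ext x
      simp only [Set.mem_ofPred_eq, Set.mem_empty_iff_false, iff_false, not_and, not_not]
      intro _ _ _ v _ hv hv'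
      exact absurd (this ▸ hv) hv'
    rw [h0]; simp
  | succ d ih =>
    intro u V ρ ε a b huV hfin hρ hρ1 hε hab hP
    have hKd := Kc_ge_one K0 α c1 hK0 hc1 d
    have hKd1 := Kc_ge_one K0 α c1 hK0 hc1 (d+1)
    set G := Good sp Ψ ext Zs u V ε with hG
    by_cases hερ : ρ < ε
    · calc volume {x | x ∈ Set.Icc a b ∧ ¬ G x} ≤ volume (Set.Icc a b) :=
            measure_mono fun x hx => hx.1
        _ = ENNReal.ofReal (b-a) := Real.volume_Icc
        _ ≤ _ := by
          apply ENNReal.ofReal_le_ofReal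
          have h1 : 1 ≤ (ε/ρ)^α := Real.one_le_rpow (by rw [le_div_iff₀ hρ]; linarith) hα.le
          have : 1 ≤ Kc K0 α c1 (d+1) * (ε/ρ)^α := one_le_mul_of_one_le_of_one_le hKd1 h1
          nlinarith
    push Not at hερ
    set K' : ℝ := Kc K0 α c1 (d+1) * (ε/ρ)^α with hK'
    have hK'0 : 0 ≤ K' := by positivity
    let NB : ℝ → ℝ → Prop := fun a' b' =>
      ∀ t, sp u < sp t → sp t < V → ∃ x ∈ Set.Icc a' b', ρ ≤ Ψ t x
    -- stopped intervals
    have hcease : ∀ a'' b'' a' b', a'' < b'' → a'' ≤ a' → b' ≤ b'' → b' - a' = (b''-a'')/2 →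
        NB a'' b'' → ¬ NB a' b' →
        volume {x | x ∈ Set.Icc a' b' ∧ ¬ G x} ≤ ENNReal.ofReal (K' * (b'-a')) := by
      intro a'' b'' a' b' h1 h2 h3 h4 hnb hb
      have hab' : a' < b' := by linarith
      have hb2 : ∃ s, sp u < sp s ∧ sp s < V ∧ ∀ x ∈ Set.Icc a' b', Ψ s x < ρ := by
        by_contra hcon
        push Not at hcon
        exact hb fun t ht1 ht2 => hcon t ht1 ht2
      obtain ⟨s, hs1, hs2, hs3⟩ := hb2
      have hsup : ∀ t, sp u < sp t → sp t < V → ∃ x ∈ Set.Icc a' b', c1 * ρ ≤ Ψ t x :=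
        fun t ht1 ht2 => hdouble t a'' b'' a' b' ρ h1 h2 h3 h4 hρ (hnb t ht1 ht2)
      have hc1ρ : 0 < c1 * ρ := by positivity
      have hc1ρ1 : c1 * ρ ≤ 1 := by nlinarith
      have hf1 := Submodule.finrank_lt_finrank_of_lt hs1
      have hf2 := Submodule.finrank_lt_finrank_of_lt hs2
      have e1 := ih u (sp s) (c1*ρ) ε a' b' hs1.le (by omega) hc1ρ hc1ρ1 hε hab'
        fun t ht1 ht2 => hsup t ht1 (ht2.trans hs2)
      have e2 := ih s V (c1*ρ) ε a' b' hs2.le (by omega) hc1ρ hc1ρ1 hε hab'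
        fun t ht1 ht2 => hsup t (hs1.trans ht1) ht2
      obtain ⟨x0, hx0, hx0'⟩ := hsup s hs1 hs2
      have e3 := hsmall s a' b' (c1*ρ) x0 (ε/(c1^2*ρ)) hab' hc1ρ hx0 hx0' (by positivity)
      have e4 : ε/(c1^2*ρ) * (c1*ρ) = ε/c1 := by field_simp
      rw [e4] at e3
      have hsub : {x | x ∈ Set.Icc a' b' ∧ ¬ G x} ⊆
          ({x | x ∈ Set.Icc a' b' ∧ Ψ s x < ε/c1} ∪
            {x | x ∈ Set.Icc a' b' ∧ ¬ Good sp Ψ ext Zs u (sp s) ε x}) ∪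
            {x | x ∈ Set.Icc a' b' ∧ ¬ Good sp Ψ ext Zs s V ε x} := by
        rintro x ⟨hx, hxG⟩
        by_contra hcon
        simp only [Set.mem_union, Set.mem_ofPred_eq, not_or, not_and, not_not, not_lt] at hcon
        obtain ⟨⟨q1, q2⟩, q3⟩ := hcon
        specialize q1 hx; specialize q2 hx; specialize q3 hx
        apply hxG
        intro hu1 htop v hv hvV hvu
        by_cases hvs : v ∈ sp s
        · refine q2 hu1 ?_ v hv hvs hvu
          intro t ht
          obtain ⟨κ, hκ0, hκ⟩ := hprop s t ht.symm
          obtain ⟨y, hy, hy'⟩ := hsup t (ht ▸ hs1) (ht ▸ hs2)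
          have hκc : c1 ≤ κ := by
            rw [hκ] at hy'
            have := hs3 y hy
            have h6 : κ * Ψ s y ≤ κ * ρ := mul_le_mul_of_nonneg_left this.le hκ0
            exact le_of_mul_le_mul_right (hy'.trans h6) hρ
          rw [hκ]
          calc ε = c1 * (ε/c1) := by field_simp
            _ ≤ κ * Ψ s x := mul_le_mul hκc q1 (by positivity) hκ0
        · exact q3 ((hs3 x hx).le.trans hρ1) htop v hv hvV hvs
      refine (measure_mono hsub).trans ((measure_union_le _ _).trans
        ((add_le_add ((measure_union_le _ _).trans (add_le_add e3 e1)) e2).trans ?_))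
      have p1 : 0 ≤ K0 * (ε/(c1^2*ρ))^α * (b'-a') :=
        mul_nonneg (by positivity) (by linarith)
      have p2 : 0 ≤ Kc K0 α c1 d * (ε/(c1*ρ))^α * (b'-a') :=
        mul_nonneg (by positivity) (by linarith)
      rw [← ENNReal.ofReal_add p1 p2, ← ENNReal.ofReal_add (add_nonneg p1 p2) p2]
      apply ENNReal.ofReal_le_ofReal
      have r1 : (ε/(c1^2*ρ))^α = (1/c1^2)^α * (ε/ρ)^α := by
        rw [← Real.mul_rpow (by positivity) (by positivity)]; congr 1; field_simp
      have r2 : (ε/(c1*ρ))^α = (1/c1)^α * (ε/ρ)^α := by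
        rw [← Real.mul_rpow (by positivity) (by positivity)]; congr 1; field_simp
      rw [r1, r2, hK']
      simp only [Kc]
      have : 0 ≤ (ε/ρ)^α * (b'-a') := mul_nonneg (by positivity) (by linarith)
      nlinarith
    -- iterate
    have hiter : ∀ m : ℕ, ∀ a' b', a' < b' → NB a' b' →
        volume {x | x ∈ Set.Icc a' b' ∧ ¬ G x ∧ ¬ ∃ a'' b'', x ∈ Set.Icc a'' b'' ∧
          b'' - a'' = (b'-a')/2^m ∧ NB a'' b''} ≤ ENNReal.ofReal (K' * (b'-a')) := by
      intro m
      induction m with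
      | zero =>
        intro a' b' hab' hnb
        have h0 : {x | x ∈ Set.Icc a' b' ∧ ¬ G x ∧ ¬ ∃ a'' b'', x ∈ Set.Icc a'' b'' ∧
          b'' - a'' = (b'-a')/2^0 ∧ NB a'' b''} = ∅ := by
          ext x
          simp only [Set.mem_ofPred_eq, Set.mem_empty_iff_false, iff_false]
          rintro ⟨hx, -, h⟩
          exact h ⟨a', b', hx, by simp, hnb⟩
        rw [h0]; simp
      | succ m ihm =>
        intro a' b' hab' hnb
        set c := (a'+b')/2 with hc
        set bad : ℝ → Prop := fun x => ¬ G x ∧ ¬ ∃ a'' b'', x ∈ Set.Icc a'' b'' ∧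
          b'' - a'' = (b'-a')/2^(m+1) ∧ NB a'' b'' with hbad
        have half : ∀ p q, a' ≤ p → q ≤ b' → q - p = (b'-a')/2 →
            volume {x | x ∈ Set.Icc p q ∧ bad x} ≤ ENNReal.ofReal (K' * ((b'-a')/2)) := by
          intro p q hp hq hpq
          by_cases hn : NB p q
          · have := ihm p q (by linarith) hn
            rw [hpq] at this
            refine le_trans (measure_mono ?_) this
            rintro x ⟨hx, hx1, hx2⟩
            refine ⟨hx, hx1, ?_⟩
            rintro ⟨a'', b'', h1, h2, h3⟩
            refine hx2 ⟨a'', b'', h1, ?_, h3⟩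
            rw [h2, pow_succ]; field_simp
          · have := hcease a' b' p q hab' hp hq hpq hnb hn
            rw [hpq] at this
            refine le_trans (measure_mono ?_) this
            rintro x ⟨hx, hx1, hx2⟩
            exact ⟨hx, hx1⟩
        have hsub : {x | x ∈ Set.Icc a' b' ∧ bad x} ⊆
            {x | x ∈ Set.Icc a' c ∧ bad x} ∪ {x | x ∈ Set.Icc c b' ∧ bad x} := by
          rintro x ⟨hx, hx2⟩
          rcases le_total x c with h | h
          · exact Or.inl ⟨⟨hx.1, h⟩, hx2⟩
          · exact Or.inr ⟨⟨h, hx.2⟩, hx2⟩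
        refine (measure_mono hsub).trans ((measure_union_le _ _).trans
          ((add_le_add (half a' c le_rfl (by linarith) (by linarith))
            (half c b' (by linarith) le_rfl (by linarith))).trans ?_))
        have : 0 ≤ K' * ((b'-a')/2) := mul_nonneg hK'0 (by linarith)
        rw [← ENNReal.ofReal_add this this]
        apply ENNReal.ofReal_le_ofReal; linarith
    -- conclude
    set S : ℕ → Set ℝ := fun m => {x | x ∈ Set.Icc a b ∧ ¬ G x ∧ ¬ ∃ a'' b'', x ∈ Set.Icc a'' b'' ∧
          b'' - a'' = (b-a)/2^m ∧ NB a'' b''} with hS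
    have hmono : Monotone fun m => ⋂ l ≥ m, S l := by
      intro m m' hmm x hx
      simp only [Set.mem_iInter] at hx ⊢
      exact fun l hl => hx l (le_trans hmm hl)
    have hfinal : {x | x ∈ Set.Icc a b ∧ ¬ G x} ⊆ ⋃ m, ⋂ l ≥ m, S l := by
      rintro x ⟨hx, hxG⟩
      by_contra hcon
      simp only [Set.mem_iUnion, Set.mem_iInter, not_exists, not_forall] at hcon
      apply hxG
      -- x lies in nonbad intervals of arbitrarily small scale
      have hbig : ∀ t, sp u < sp t → sp t < V → ρ ≤ Ψ t x := by
        intro t ht1 ht2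
        by_contra hlt
        push Not at hlt
        have := (hcont t).continuousAt.eventually (gt_mem_nhds hlt)
        obtain ⟨δ, hδ, hδ'⟩ := Metric.eventually_nhds_iff.1 this
        obtain ⟨m, hm⟩ := exists_nat_gt ((b-a)/δ)
        obtain ⟨l, hl, hlS⟩ := hcon m
        have : ∃ a'' b'', x ∈ Set.Icc a'' b'' ∧ b'' - a'' = (b-a)/2^l ∧ NB a'' b'' := by
          by_contra hno
          exact hlS ⟨hx, hxG, hno⟩
        obtain ⟨a'', b'', hx'', hlen, hnb⟩ := this
        obtain ⟨y, hy, hy'⟩ := hnb t ht1 ht2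
        have hlen2 : (b-a)/2^l < δ := by
          rw [div_lt_iff₀ (by positivity)]
          rw [div_lt_iff₀ hδ] at hm
          have : (m:ℝ) ≤ 2^l := by
            have h1 : m < 2^l := lt_of_le_of_lt hl Nat.lt_two_pow_self
            exact_mod_cast h1.le
          nlinarith
        have hd : dist y x < δ := by
          rw [Real.dist_eq, abs_lt]
          constructor <;> linarith [hy.1, hy.2, hx''.1, hx''.2]
        have := hδ' hd
        linarith
      intro hu1 htop v hv hvV hvu
      refine ⟨u, hvu, hu1, ?_⟩
      have hsp := hext u v hv hvu
      by_cases hV : sp (ext u v) = V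
      · exact htop _ hV
      · refine hερ.trans (hbig _ ?_ ?_)
        · rw [hsp]
          refine lt_of_le_of_ne le_sup_left fun h => hvu ?_
          rw [h]
          exact Submodule.mem_sup_right (Submodule.mem_span_singleton_self v)
        · refine lt_of_le_of_ne ?_ hV
          rw [hsp]
          exact sup_le huV ((Submodule.span_singleton_le_iff_mem _ _).2 hvV)
    refine (measure_mono hfinal).trans ?_
    rw [hmono.measure_iUnion]
    refine iSup_le fun m => (measure_mono ?_).trans (hiter m a b hab hP)
    intro x hx
    simp only [Set.mem_iInter] at hx
    exact hx m le_rfl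

end abs
end BM


set_option linter.unusedSectionVars false
set_option linter.unusedVariables false
namespace BM
open Polynomial

section conc
variable {A C : Type*} [Fintype A] [Fintype C]

/-- real version of an integer tuple -/
def cst {k : ℕ} (s : Fin k → A → ℤ) : Fin k → A → ℝ := fun j a => (s j a : ℝ)

/-- the image of an integer tuple under a real matrix -/
noncomputable def cols (h : C → A → ℝ) {k : ℕ} (s : Fin k → A → ℤ) : Fin k → C → ℝ :=
  fun j c => ∑ a, h c a * (s j a : ℝ)

lemma natDegree_det_le' {k : ℕ} (B : Matrix (Fin k) (Fin k) ℝ[X]) (M : ℕ)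
    (h : ∀ i j, (B i j).natDegree ≤ M) : B.det.natDegree ≤ k * M := by
  rw [Matrix.det_apply]
  refine Polynomial.natDegree_sum_le_of_forall_le _ _ fun σ _ => ?_
  refine (Polynomial.natDegree_smul_le _ _).trans ?_
  refine (Polynomial.natDegree_prod_le _ _).trans ?_
  refine (Finset.sum_le_sum fun i _ => h _ _).trans ?_
  simp

lemma minor_poly (H : C → A → ℝ[X]) (M : ℕ) (hH : ∀ c a, (H c a).natDegree ≤ M) {k : ℕ}
    (s : Fin k → A → ℤ) (σ : Fin k → C) : ∃ p : ℝ[X], p.natDegree ≤ k * M ∧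
      ∀ x, minor (cols (fun c a => (H c a).eval x) s) σ = p.eval x := by
  refine ⟨(Matrix.of fun i j => ∑ a, H (σ i) a * Polynomial.C (s j a : ℝ)).det,
    natDegree_det_le' _ M ?_, fun x => ?_⟩
  · intro i j
    refine Polynomial.natDegree_sum_le_of_forall_le _ _ fun a _ => ?_
    exact (Polynomial.natDegree_mul_C_le _ _).trans (hH _ _)
  · have := (Polynomial.evalRingHom x).map_det
      (Matrix.of fun i j => ∑ a, H (σ i) a * Polynomial.C (s j a : ℝ))
    rw [Polynomial.coe_evalRingHom] at this
    rw [this]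
    unfold minor cols
    congr 1
    ext i j
    simp [Polynomial.eval_finsetSum]

lemma cols_comb (h : C → A → ℝ) {k k' : ℕ} (s : Fin k → A → ℤ) (t : Fin k' → A → ℤ)
    (K : Fin k → Fin k' → ℝ) (hK : ∀ j, cst t j = ∑ l, K l j • cst s l) (j : Fin k') :
    cols h t j = ∑ l, K l j • cols h s l := by
  ext c
  have h1 : ∀ a, (t j a : ℝ) = ∑ l, K l j * (s l a : ℝ) := by
    intro a
    have := congrFun (hK j) a
    simpa [cst, Finset.sum_apply] using this
  simp only [cols, Finset.sum_apply, Pi.smul_apply, smul_eq_mul, Finset.mul_sum, h1]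
  rw [Finset.sum_comm]
  refine Finset.sum_congr rfl fun l _ => Finset.sum_congr rfl fun a _ => by ring

lemma psi_span (s t : Σ k, {s : Fin k → A → ℤ // LinearIndependent ℝ (cst s)})
    (hst : Submodule.span ℝ (Set.range (cst s.2.1)) = Submodule.span ℝ (Set.range (cst t.2.1))) :
    ∃ κ : ℝ, 0 ≤ κ ∧ ∀ h : C → A → ℝ, psi (cols h t.2.1) = κ * psi (cols h s.2.1) := by
  obtain ⟨k, s, hs⟩ := s
  obtain ⟨k', t, ht⟩ := t
  dsimp only at hst ⊢
  have e1 := finrank_span_eq_card hs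
  have e2 := finrank_span_eq_card ht
  rw [hst, e2] at e1
  simp only [Fintype.card_fin] at e1
  subst e1
  have hmem : ∀ j, ∃ c : Fin k' → ℝ, ∑ l, c l • cst s l = cst t j := by
    intro j
    rw [← Submodule.mem_span_range_iff_exists_fun, hst]
    exact Submodule.subset_span ⟨j, rfl⟩
  choose K hK using hmem
  refine ⟨|(Matrix.of fun l j => K j l).det|, abs_nonneg _, fun h => ?_⟩
  apply psi_change
  exact fun j => cols_comb h s t (fun l j => K j l) (fun j => (hK j).symm) j

open Classical in
noncomputable def tupExt (t : Σ k, {s : Fin k → A → ℤ // LinearIndependent ℝ (cst s)}) (v : A → ℝ) :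
    Σ k, {s : Fin k → A → ℤ // LinearIndependent ℝ (cst s)} :=
  if h : ∃ z : A → ℤ, (fun a => (z a : ℝ)) = v ∧ v ∉ Submodule.span ℝ (Set.range (cst t.2.1)) then
    ⟨t.1 + 1, Fin.cons h.choose t.2.1, by
      have e : cst (Fin.cons h.choose t.2.1 : Fin (t.1+1) → A → ℤ)
          = Fin.cons (fun a => (h.choose a : ℝ)) (cst t.2.1) := by
        ext j a
        refine Fin.cases ?_ (fun j => ?_) j <;> simp [cst]
      rw [e, linearIndependent_finCons]
      refine ⟨t.2.2, ?_⟩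
      rw [h.choose_spec.1]; exact h.choose_spec.2⟩
  else t

lemma tupExt_eq (t : Σ k, {s : Fin k → A → ℤ // LinearIndependent ℝ (cst s)}) (z : A → ℤ)
    (hz : (fun a => (z a : ℝ)) ∉ Submodule.span ℝ (Set.range (cst t.2.1))) :
    ∃ h, tupExt t (fun a => (z a : ℝ)) = ⟨t.1+1, Fin.cons z t.2.1, h⟩ := by
  have h : ∃ z' : A → ℤ, (fun a => (z' a : ℝ)) = (fun a => (z a : ℝ)) ∧
    (fun a => (z a : ℝ)) ∉ Submodule.span ℝ (Set.range (cst t.2.1)) := ⟨z, rfl, hz⟩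
  have hc : h.choose = z := by
    have := h.choose_spec.1
    ext a
    exact_mod_cast congrFun this a
  unfold tupExt
  rw [dif_pos h]
  have hli : LinearIndependent ℝ (cst (Fin.cons z t.2.1 : Fin (t.1+1) → A → ℤ)) := by
    have e : cst (Fin.cons z t.2.1 : Fin (t.1+1) → A → ℤ)
        = Fin.cons (fun a => (z a : ℝ)) (cst t.2.1) := by
      ext j a
      refine Fin.cases ?_ (fun j => ?_) j <;> simp [cst]
    rw [e, linearIndependent_finCons]
    exact ⟨t.2.2, hz⟩
  refine ⟨hli, ?_⟩
  simp only [hc]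

lemma cst_cons {k : ℕ} (z : A → ℤ) (s : Fin k → A → ℤ) :
    cst (Fin.cons z s : Fin (k+1) → A → ℤ) = Fin.cons (fun a => (z a : ℝ)) (cst s) := by
  ext j a
  refine Fin.cases ?_ (fun j => ?_) j <;> simp [cst]

lemma cols_cons (h : C → A → ℝ) {k : ℕ} (z : A → ℤ) (s : Fin k → A → ℤ) :
    cols h (Fin.cons z s : Fin (k+1) → A → ℤ)
      = Fin.cons (fun c => ∑ a, h c a * (z a : ℝ)) (cols h s) := by
  ext j c
  refine Fin.cases ?_ (fun j => ?_) j <;> simp [cols]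

lemma std_le (n : ℕ) (hn : n = Fintype.card A) : ∃ s0 : Fin n → A → ℤ,
    LinearIndependent ℝ (cst s0) ∧ ∀ t : Fin n → A → ℤ, LinearIndependent ℝ (cst t) →
      ∀ h : C → A → ℝ, psi (cols h s0) ≤ psi (cols h t) := by
  classical
  let e : Fin n ≃ A := (Fintype.equivFinOfCardEq hn.symm).symm
  refine ⟨fun j => Pi.single (e j) 1, ?_, ?_⟩
  · have h1 : cst (fun j => Pi.single (e j) (1:ℤ)) = fun j => Pi.basisFun ℝ A (e j) := by
      ext j a
      simp [cst, Pi.single_apply]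
    rw [h1]
    exact (Pi.basisFun ℝ A).linearIndependent.comp _ e.injective
  · intro t ht h
    have hK : psi (cols h t) = |(Matrix.of fun l j => (t j (e l) : ℝ)).det| *
        psi (cols h fun j => Pi.single (e j) (1:ℤ)) := by
      apply psi_change
      intro j
      refine cols_comb h _ t (fun l j => (t j (e l) : ℝ)) (fun j => ?_) j
      ext a
      simp only [cst, Finset.sum_apply, Pi.smul_apply, smul_eq_mul, Pi.single_apply]
      rw [Finset.sum_eq_single (e.symm a)]
      · simp
      · intro l _ hl
        rw [if_neg]
        · simp
        · rintro rfl; simp at hl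
      · simp
    rw [hK]
    have hdet : 1 ≤ |(Matrix.of fun l j => (t j (e l) : ℝ)).det| := by
      have hz : ((Matrix.of fun l j => t j (e l) : Matrix (Fin n) (Fin n) ℤ).det : ℝ)
          = (Matrix.of fun l j => (t j (e l) : ℝ)).det := by
        have := (Int.castRingHom ℝ).map_det (Matrix.of fun l j => t j (e l))
        rw [eq_intCast] at this
        rw [this]; rfl
      rw [← hz, ← Int.cast_abs]
      have hne : (Matrix.of fun l j => t j (e l) : Matrix (Fin n) (Fin n) ℤ).det ≠ 0 := by
        intro h0
        rw [h0] at hz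
        have hu : IsUnit (Matrix.of fun l j => (t j (e l) : ℝ)) := by
          rw [← Matrix.linearIndependent_cols_iff_isUnit]
          have : (Matrix.of fun l j => (t j (e l) : ℝ)).col
              = fun j => (LinearEquiv.funCongrLeft ℝ ℝ e) (cst t j) := by
            ext j l; rfl
          rw [this]
          exact ht.map' (LinearEquiv.funCongrLeft ℝ ℝ e).toLinearMap (LinearEquiv.ker _)
        have := ((Matrix.isUnit_iff_isUnit_det _).1 hu).ne_zero
        exact this (by rw [← hz]; simp)
      exact_mod_cast Int.one_le_abs hne
    have := psi_nonneg (cols h fun j => Pi.single (e j) (1:ℤ))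
    nlinarith

theorem qn_one (N M : ℕ) : ∃ K α : ℝ, 0 < K ∧ 0 < α ∧ α ≤ 1 ∧
    ∀ (A C : Type) [Fintype A] [Fintype C] [Nonempty A], Fintype.card A = N →
    ∀ H : C → A → ℝ[X], (∀ c a, (H c a).natDegree ≤ M) → ∀ a b : ℝ, a < b →
    (∀ k, 1 ≤ k → ∀ s : Fin k → A → ℤ, LinearIndependent ℝ (cst s) →
      ∃ x ∈ Set.Icc a b, 1 ≤ psi (cols (fun c a => (H c a).eval x) s)) →
    ∀ ε, 0 < ε → volume {x | x ∈ Set.Icc a b ∧ ∃ v : A → ℤ, v ≠ 0 ∧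
      ∀ c, |∑ a, (H c a).eval x * (v a : ℝ)| < ε} ≤ ENNReal.ofReal (K * ε^α * (b-a)) := by
  set d : ℕ := max (N * M) 1 with hd
  have hd1 : 1 ≤ d := le_max_right _ _
  obtain ⟨c1, hc1, hc1', hdbl⟩ := poly_double d hd1
  set α : ℝ := 1 / d with hα
  have hαpos : 0 < α := by positivity
  set K0 : ℝ := 2 * d * (d+1) with hK0
  have hK0pos : 0 < K0 := by positivity
  have hKN := Kc_ge_one K0 α c1 hK0pos.le hc1 N
  have hα1 : α ≤ 1 := by
    rw [hα, div_le_one (by positivity)]; exact_mod_cast hd1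
  refine ⟨(Kc K0 α c1 N + K0) * (N+1)^α, α, by positivity, hαpos, hα1, ?_⟩
  intro A C _ _ _ hcard H hH a b hab hsup ε hε
  let T := Σ k, {s : Fin k → A → ℤ // LinearIndependent ℝ (cst s)}
  let sp : T → Submodule ℝ (A → ℝ) := fun t => Submodule.span ℝ (Set.range (cst t.2.1))
  let Ψ : T → ℝ → ℝ := fun t x => psi (cols (fun c a => (H c a).eval x) t.2.1)
  have hk : ∀ t : T, t.1 ≤ N := by
    intro t
    have := t.2.2.fintype_card_le_finrank
    simpa [hcard] using this
  have hpoly : ∀ (t : T) σ, ∃ p : ℝ[X], p.natDegree ≤ d ∧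
      ∀ x, minor (cols (fun c a => (H c a).eval x) t.2.1) σ = p.eval x := by
    intro t σ
    obtain ⟨p, hp, hp'⟩ := minor_poly H M hH t.2.1 σ
    exact ⟨p, hp.trans ((Nat.mul_le_mul_right _ (hk t)).trans (le_max_left _ _)), hp'⟩
  have hcont : ∀ t, Continuous (Ψ t) := by
    intro t
    apply Continuous.norm
    apply continuous_pi
    intro σ
    obtain ⟨p, -, hp⟩ := hpoly t σ
    simp_rw [hp]
    exact p.continuous
  have hsmall : ∀ t a b S x0 ε, a < b → 0 < S → x0 ∈ Set.Icc a b → S ≤ Ψ t x0 → 0 < ε →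
      volume {x | x ∈ Set.Icc a b ∧ Ψ t x < ε * S} ≤ ENNReal.ofReal (K0 * ε ^ α * (b - a)) := by
    intro t a b S x0 ε hab hS hx0 hSx hε
    obtain ⟨σ, hσ⟩ := (le_psi_iff _ hS).1 hSx
    obtain ⟨p, hpd, hp⟩ := hpoly t σ
    rw [hp] at hσ
    refine le_trans (measure_mono ?_) (poly_small d hd1 p hpd a b hab S hS x0 hx0 hσ ε hε)
    rintro x ⟨hx, hx2⟩
    refine ⟨hx, ?_⟩
    rw [← hp]
    exact (le_psi _ _).trans_lt hx2
  have hdouble : ∀ t a b a' b' S, a < b → a ≤ a' → b' ≤ b → b' - a' = (b - a)/2 → 0 < S →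
      (∃ x ∈ Set.Icc a b, S ≤ Ψ t x) → ∃ x ∈ Set.Icc a' b', c1 * S ≤ Ψ t x := by
    rintro t a b a' b' S hab h1 h2 h3 hS ⟨x, hx, hSx⟩
    obtain ⟨σ, hσ⟩ := (le_psi_iff _ hS).1 hSx
    obtain ⟨p, hpd, hp⟩ := hpoly t σ
    rw [hp] at hσ
    obtain ⟨y, hy, hy'⟩ := hdbl p hpd a b a' b' hab h1 h2 h3 S hS ⟨x, hx, hσ⟩
    refine ⟨y, hy, hy'.trans ?_⟩
    rw [← hp]; exact le_psi _ _
  have hprop : ∀ s t, sp s = sp t → ∃ κ : ℝ, 0 ≤ κ ∧ ∀ x, Ψ t x = κ * Ψ s x := by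
    intro s t hst
    obtain ⟨κ, hκ, h⟩ := psi_span (C := C) s t hst
    exact ⟨κ, hκ, fun x => h _⟩
  let Zs : Set (A → ℝ) := {v | ∃ z : A → ℤ, (fun a => (z a : ℝ)) = v}
  have hext : ∀ s, ∀ v ∈ Zs, v ∉ sp s → sp (tupExt s v) = sp s ⊔ Submodule.span ℝ {v} := by
    rintro s v ⟨z, rfl⟩ hv
    obtain ⟨h, e⟩ := tupExt_eq s z hv
    rw [e]
    show Submodule.span ℝ (Set.range (cst (Fin.cons z s.2.1 : Fin (s.1+1) → A → ℤ))) = _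
    rw [cst_cons, Fin.range_cons, Submodule.span_insert, sup_comm]
  have main := qn_abs sp Ψ tupExt Zs α K0 c1 hαpos hK0pos.le hc1 hc1' hcont
    (fun t x => psi_nonneg _) hsmall hdouble hprop hext N
    (⟨0, Fin.elim0, linearIndependent_empty_type⟩ : T) ⊤ 1 ((N+1) * ε) a b le_top
    (by simp [hcard]) one_pos le_rfl (by positivity) hab
    (by
      intro t ht _
      refine hsup t.1 ?_ t.2.1 t.2.2
      by_contra h0
      have h0 : t.1 = 0 := by omega
      have : Set.range (cst t.2.1) = ∅ := by
        have : IsEmpty (Fin t.1) := by rw [h0]; infer_instance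
        exact Set.range_eq_empty _
      have e : sp t = ⊥ := by
        simp only [sp]; rw [this, Submodule.span_empty]
      rw [e] at ht
      exact not_lt_bot ht)
  obtain ⟨s0, hs0, hs0'⟩ := std_le (C := C) N hcard.symm
  obtain ⟨x0, hx0, hx0'⟩ := hsup N (hcard ▸ Fintype.card_pos) s0 hs0
  have sm := hsmall ⟨N, s0, hs0⟩ a b 1 x0 ((N+1)*ε) hab one_pos hx0 hx0' (by positivity)
  rw [mul_one] at sm
  have hsub : {x | x ∈ Set.Icc a b ∧ ∃ v : A → ℤ, v ≠ 0 ∧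
      ∀ c, |∑ a, (H c a).eval x * (v a : ℝ)| < ε} ⊆
      {x | x ∈ Set.Icc a b ∧ ¬ Good sp Ψ tupExt Zs
        (⟨0, Fin.elim0, linearIndependent_empty_type⟩ : T) ⊤ ((N+1) * ε) x} ∪
      {x | x ∈ Set.Icc a b ∧ Ψ ⟨N, s0, hs0⟩ x < (N+1) * ε} := by
    rintro x ⟨hx, v, hv0, hv⟩
    by_contra hcon
    simp only [Set.mem_union, Set.mem_ofPred_eq, not_or, not_and, not_not, not_lt] at hcon
    obtain ⟨q1, q2⟩ := hcon
    specialize q1 hx; specialize q2 hx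
    obtain ⟨s, hs1, hs2, hs3⟩ := q1 (psi_zero _).le (by
      intro t ht
      refine q2.trans ?_
      obtain ⟨k, t, hti⟩ := t
      have e2 := finrank_span_eq_card hti
      have e3 : Submodule.span ℝ (Set.range (cst t)) = ⊤ := ht
      rw [e3] at e2
      simp [hcard] at e2
      subst e2
      exact hs0' t hti _) (fun a => (v a : ℝ)) ⟨v, rfl⟩ Submodule.mem_top (by
        intro h
        have e : sp (⟨0, Fin.elim0, linearIndependent_empty_type⟩ : T) = ⊥ := by
          simp only [sp]; rw [Set.range_eq_empty, Submodule.span_empty]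
        rw [e, Submodule.mem_bot] at h
        apply hv0
        ext a
        have h9 : ((v a : ℤ) : ℝ) = 0 := congrFun h a
        exact_mod_cast h9)
    obtain ⟨h, e⟩ := tupExt_eq s v hs1
    rw [e] at hs3
    have hle : Ψ ⟨s.1+1, Fin.cons v s.2.1, h⟩ x < (N+1) * ε := by
      show psi (cols _ (Fin.cons v s.2.1 : Fin (s.1+1) → A → ℤ)) < _
      rw [cols_cons]
      refine (psi_cons_le _ _).trans_lt ?_
      have hn : ‖fun c => ∑ a, (H c a).eval x * (v a : ℝ)‖ < ε := (pi_norm_lt_iff hε).2 hv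
      have hsN : (s.1 : ℝ) ≤ N := by exact_mod_cast hk s
      have hp0 := psi_nonneg (cols (fun c a => (H c a).eval x) s.2.1)
      have hp1 : psi (cols (fun c a => (H c a).eval x) s.2.1) ≤ 1 := hs2
      have hn0 := norm_nonneg (fun c => ∑ a, (H c a).eval x * (v a : ℝ))
      calc _ ≤ ((N:ℝ)+1) * 1 * ‖fun c => ∑ a, (H c a).eval x * (v a : ℝ)‖ := by gcongr
        _ < _ := by rw [mul_one]; gcongr
    linarith
  refine (measure_mono hsub).trans ((measure_union_le _ _).trans ((add_le_add main sm).trans ?_))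
  have p : 0 ≤ ((N+1) * ε)^α * (b-a) := mul_nonneg (by positivity) (by linarith)
  rw [← ENNReal.ofReal_add (by rw [div_one, mul_assoc]; exact mul_nonneg (by linarith) p)
    (by rw [mul_assoc]; exact mul_nonneg hK0pos.le p)]
  apply ENNReal.ofReal_le_ofReal
  rw [div_one, Real.mul_rpow (by positivity) hε.le]
  apply le_of_eq; ring

/-- quantitative nondivergence -/
theorem qn (N M : ℕ) : ∃ K α : ℝ, 0 < K ∧ 0 < α ∧ α ≤ 1 ∧
    ∀ (A C : Type) [Fintype A] [Fintype C] [Nonempty A], Fintype.card A = N →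
    ∀ H : C → A → ℝ[X], (∀ c a, (H c a).natDegree ≤ M) → ∀ a b : ℝ, a < b → ∀ ρ : ℝ, 0 < ρ →
    (∀ k, 1 ≤ k → ∀ s : Fin k → A → ℤ, LinearIndependent ℝ (cst s) →
      ∃ x ∈ Set.Icc a b, ρ^k ≤ psi (cols (fun c a => (H c a).eval x) s)) →
    ∀ ε, 0 < ε → volume {x | x ∈ Set.Icc a b ∧ ∃ v : A → ℤ, v ≠ 0 ∧
      ∀ c, |∑ a, (H c a).eval x * (v a : ℝ)| < ε} ≤ ENNReal.ofReal (K * (ε/ρ)^α * (b-a)) := by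
  obtain ⟨K, α, hK, hα, hα1, h⟩ := qn_one N M
  refine ⟨K, α, hK, hα, hα1, ?_⟩
  intro A C _ _ _ hcard H hH a b hab ρ hρ hsup ε hε
  have key := h A C hcard (fun c a => Polynomial.C ρ⁻¹ * H c a)
    (fun c a => (Polynomial.natDegree_C_mul_le _ _).trans (hH c a)) a b hab ?_ (ε/ρ) (by positivity)
  · refine le_trans (measure_mono ?_) key
    rintro x ⟨hx, v, hv0, hv⟩
    refine ⟨hx, v, hv0, fun c => ?_⟩
    have : ∑ a, (Polynomial.C ρ⁻¹ * H c a).eval x * (v a : ℝ)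
        = ρ⁻¹ * ∑ a, (H c a).eval x * (v a : ℝ) := by
      rw [Finset.mul_sum]
      exact Finset.sum_congr rfl fun a _ => by simp; ring
    rw [this, abs_mul, abs_of_pos (inv_pos.2 hρ), div_eq_inv_mul]
    have := hv c
    gcongr
  · intro k hk s hs
    obtain ⟨x, hx, hx'⟩ := hsup k hk s hs
    refine ⟨x, hx, ?_⟩
    have e := psi_change (cols (fun c a => (H c a).eval x) s)
      (cols (fun c a => (Polynomial.C ρ⁻¹ * H c a).eval x) s) (ρ⁻¹ • 1) (by
        intro j
        ext c
        simp only [Finset.sum_apply, Pi.smul_apply, Matrix.smul_apply, smul_eq_mul]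
        rw [Finset.sum_eq_single j]
        · simp [cols, Finset.mul_sum, mul_assoc]
        · intro l _ hl; simp [Matrix.one_apply_ne hl]
        · simp)
    rw [e, Matrix.det_smul, Matrix.det_one, mul_one, Fintype.card_fin, abs_pow,
      abs_of_pos (inv_pos.2 hρ), inv_pow]
    rw [le_inv_mul_iff₀ (by positivity)]
    simpa using hx'

end conc
end BM


namespace BM

/-- dyadic interval of level `m` -/
def Dy (m i : ℕ) : Set ℝ := Set.Icc ((i:ℝ)/2^m) (((i:ℝ)+1)/2^m)

open Classical in
/-- number of level-`M` dyadic descendants of `Dy m i` meeting `E` -/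
noncomputable def cnt (E : Set ℝ) (M m i : ℕ) : ℕ :=
  ((Finset.range (2^(M-m))).filter fun j => (Dy M (i * 2^(M-m) + j) ∩ E).Nonempty).card

lemma cnt_split (E : Set ℝ) (M m i : ℕ) (h : m < M) :
    cnt E M (m+1) (2*i) + cnt E M (m+1) (2*i+1) = cnt E M m i := by
  classical
  unfold cnt
  obtain ⟨k, rfl⟩ : ∃ k, M = m + 1 + k := ⟨M - (m+1), by omega⟩
  have e1 : m + 1 + k - m = k + 1 := by omega
  have e2 : m + 1 + k - (m+1) = k := by omega
  rw [e1, e2]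
  simp only [Finset.card_filter]
  rw [show 2^(k+1) = 2^k + 2^k by ring, Finset.sum_range_add]
  congr 1
  · refine Finset.sum_congr rfl fun j _ => ?_
    rw [show 2 * i * 2^k + j = i * (2^k+2^k) + j by ring]
  · refine Finset.sum_congr rfl fun j _ => ?_
    rw [show (2 * i + 1) * 2^k + j = i * (2^k+2^k) + (2^k + j) by ring]

lemma cnt_self (E : Set ℝ) (M i : ℕ) (h : (Dy M i ∩ E).Nonempty) : cnt E M M i = 1 := by
  classical
  unfold cnt
  rw [Nat.sub_self, pow_zero, Finset.range_one, Finset.filter_singleton, if_pos (by simpa using h)]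
  simp

theorem dyadic_content {I : Type*} (E : I → Set ℝ) (b M : I → ℕ) (hbM : ∀ α, b α ≤ M α)
    (ω : I → ℝ≥0∞) (hcnt : ∀ α, ∀ i < 2^(b α), (cnt (E α) (M α) (b α) i : ℝ≥0∞) ≤ ω α * 2^(M α - b α))
    (q θ θ' ν : ℝ≥0∞) (hq0 : q ≠ 0) (hqt : q ≠ ⊤) (hθ1 : θ < 1) (h1 : θ' + ν ≤ θ) (h2 : θ ≤ 2 * q * θ')
    (hroot : ∑' α, (if b α = 0 then ω α * (2*q)^(M α) else 0) ≤ θ)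
    (hnew : ∀ β, ∑' α, (if b α = β then ω α * (2*q)^(M α - β) else 0) ≤ ν) :
    ∃ x ∈ Set.Icc (0:ℝ) 1, ∀ α, x ∉ E α := by
  classical
  set Φ : ℕ → ℕ → ℝ≥0∞ := fun m i =>
    ∑' α, if b α ≤ m ∧ m ≤ M α then (cnt (E α) (M α) m i : ℝ≥0∞) * q^(M α - m) else 0 with hΦ
  have hborn : ∀ α, ∀ i < 2^(b α), (cnt (E α) (M α) (b α) i : ℝ≥0∞) * q^(M α - b α)
      ≤ ω α * (2*q)^(M α - b α) := by
    intro α i hi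
    calc _ ≤ ω α * 2^(M α - b α) * q^(M α - b α) := by gcongr; exact hcnt α i hi
      _ = _ := by rw [mul_pow, mul_assoc]
  have hstep : ∀ m i, i < 2^m → Φ m i ≤ θ → ∃ i', (i' = 2*i ∨ i' = 2*i+1) ∧ Φ (m+1) i' ≤ θ := by
    intro m i hi hle
    set O : ℕ → ℝ≥0∞ := fun i' =>
      ∑' α, if b α ≤ m ∧ m + 1 ≤ M α then (cnt (E α) (M α) (m+1) i' : ℝ≥0∞) * q^(M α - (m+1)) else 0
      with hO
    have hOsum : q * (O (2*i) + O (2*i+1)) ≤ θ := by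
      refine le_trans ?_ hle
      rw [hO, hΦ]
      simp only
      rw [← ENNReal.tsum_add, ← ENNReal.tsum_mul_left]
      refine ENNReal.tsum_le_tsum fun α => ?_
      by_cases hc : b α ≤ m ∧ m + 1 ≤ M α
      · rw [if_pos hc, if_pos hc, if_pos ⟨hc.1, by omega⟩, ← add_mul, ← Nat.cast_add,
          cnt_split _ _ _ _ hc.2, mul_left_comm, ← pow_succ']
        rw [show M α - (m+1) + 1 = M α - m by omega]
      · rw [if_neg hc, if_neg hc]; simp
    have hchild : ∃ i', (i' = 2*i ∨ i' = 2*i+1) ∧ O i' ≤ θ' := by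
      by_contra hcon
      push Not at hcon
      have a1 := hcon (2*i) (Or.inl rfl)
      have a2 := hcon (2*i+1) (Or.inr rfl)
      have : 2 * q * θ' < q * (O (2*i) + O (2*i+1)) := by
        rw [show 2 * q * θ' = q * (θ' + θ') by ring]
        exact ENNReal.mul_lt_mul_right hq0 hqt (ENNReal.add_lt_add a1 a2)
      exact absurd (h2.trans_lt this) (not_lt.2 hOsum)
    obtain ⟨i', hi', hOi'⟩ := hchild
    refine ⟨i', hi', ?_⟩
    have hi'2 : i' < 2^(m+1) := by rw [pow_succ]; omega
    refine le_trans ?_ ((add_le_add hOi' (hnew (m+1))).trans h1)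
    rw [hO, hΦ]
    simp only
    rw [← ENNReal.tsum_add]
    refine ENNReal.tsum_le_tsum fun α => ?_
    by_cases hc : b α ≤ m + 1 ∧ m + 1 ≤ M α
    · rw [if_pos hc]
      by_cases hb : b α = m + 1
      · have := hborn α i' (by rw [hb]; exact hi'2)
        rw [if_pos hb, ← hb]
        exact this.trans le_add_self
      · rw [if_pos ⟨by omega, hc.2⟩]
        exact le_self_add
    · rw [if_neg hc]; exact bot_le
  have h0 : Φ 0 0 ≤ θ := by
    refine le_trans ?_ hroot
    rw [hΦ]
    refine ENNReal.tsum_le_tsum fun α => ?_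
    by_cases hc : b α = 0
    · have := hborn α 0 (by simp [hc])
      rw [if_pos hc, if_pos ⟨hc.le, Nat.zero_le _⟩]
      simpa [hc] using this
    · rw [if_neg hc, if_neg (by omega)]
  -- the path
  let S : ℕ → Type := fun m => {i : ℕ // i < 2^m ∧ Φ m i ≤ θ}
  have hnext : ∀ m (p : S m), ∃ p' : S (m+1), p'.1 = 2*p.1 ∨ p'.1 = 2*p.1+1 := by
    rintro m ⟨i, hi, hle⟩
    obtain ⟨i', hi', hle'⟩ := hstep m i hi hle
    exact ⟨⟨i', by rw [pow_succ]; omega, hle'⟩, hi'⟩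
  choose nx hnx using hnext
  let path : ∀ m, S m := fun m => Nat.rec ⟨0, by simp, h0⟩ (fun m p => nx m p) m
  have hpath : ∀ m, (path (m+1)).1 = 2 * (path m).1 ∨ (path (m+1)).1 = 2 * (path m).1 + 1 :=
    fun m => hnx m (path m)
  have hnest : ∀ m, Dy (m+1) (path (m+1)).1 ⊆ Dy m (path m).1 := by
    intro m
    apply Set.Icc_subset_Icc
    · rw [div_le_div_iff₀ (by positivity) (by positivity)]
      have h4 : (2:ℝ)^(m+1) = 2^m*2 := pow_succ _ _
      have : (2 * (path m).1 : ℝ) ≤ (path (m+1)).1 := by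
        rcases hpath m with h | h <;> rw [h] <;> push_cast <;> linarith
      have h3 : (0:ℝ) < 2^m := by positivity
      nlinarith
    · rw [div_le_div_iff₀ (by positivity) (by positivity)]
      have h4 : (2:ℝ)^(m+1) = 2^m*2 := pow_succ _ _
      have : ((path (m+1)).1 : ℝ) ≤ 2 * (path m).1 + 1 := by
        rcases hpath m with h | h <;> rw [h] <;> push_cast <;> linarith
      have h3 : (0:ℝ) < 2^m := by positivity
      nlinarith
  have hne := IsCompact.nonempty_iInter_of_sequence_nonempty_isCompact_isClosed
    (fun m => Dy m (path m).1) hnest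
    (fun m => Set.nonempty_Icc.2 (by gcongr; linarith)) isCompact_Icc (fun m => isClosed_Icc)
  obtain ⟨x, hx⟩ := hne
  rw [Set.mem_iInter] at hx
  refine ⟨x, ?_, fun α hxα => ?_⟩
  · have h4 := hx 0
    have : (path 0).1 = 0 := rfl
    rw [this] at h4
    simpa [Dy] using h4
  · have hle := (path (M α)).2.2
    have h5 : (1:ℝ≥0∞) ≤ Φ (M α) (path (M α)).1 := by
      refine le_trans ?_ (ENNReal.le_tsum α)
      rw [if_pos ⟨hbM α, le_rfl⟩, cnt_self _ _ _ ⟨x, hx _, hxα⟩]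
      simp
    exact absurd (h5.trans hle) (not_le.2 hθ1)

/-- a set of small diameter meets few dyadic intervals -/
lemma cnt_le_three (E : Set ℝ) (M : ℕ) (h : ∀ x ∈ E, ∀ y ∈ E, |x - y| < 1/2^M) :
    cnt E M 0 0 ≤ 4 := by
  classical
  unfold cnt
  simp only [Nat.sub_zero, zero_mul, zero_add]
  set F := (Finset.range (2^M)).filter fun j => (Dy M j ∩ E).Nonempty with hF
  by_cases hFe : F.Nonempty
  · obtain ⟨j0, hj0, hmin⟩ := Finset.exists_min_image F id hFe
    have : F ⊆ Finset.Icc j0 (j0+3) := by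
      intro j hj
      rw [Finset.mem_Icc]
      refine ⟨hmin j hj, ?_⟩
      obtain ⟨y, hy, hyE⟩ := (Finset.mem_filter.1 hj).2
      obtain ⟨x, hx, hxE⟩ := (Finset.mem_filter.1 hj0).2
      have h1 := h y hyE x hxE
      have h3 : (0:ℝ) < 2^M := by positivity
      have h2 := (abs_lt.1 h1).2
      have a1 : (j:ℝ) ≤ y * 2^M := (div_le_iff₀ h3).1 hy.1
      have a2 : x * 2^M ≤ (j0:ℝ) + 1 := (le_div_iff₀ h3).1 hx.2
      rw [lt_div_iff₀ h3] at h2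
      have : (j:ℝ) < j0 + 3 := by nlinarith
      have : j < j0 + 3 := by exact_mod_cast this
      omega
    refine (Finset.card_le_card this).trans ?_
    simp; omega
  · rw [Finset.not_nonempty_iff_eq_empty.1 hFe]; simp

end BM


set_option linter.unusedSectionVars false
set_option linter.unusedVariables false
namespace BM

lemma minor_row {C C' : Type*} {k : ℕ} (u : Fin k → C → ℝ) (u' : Fin k → C' → ℝ)
    (σ : Fin k → C) (σ' : Fin k → C') (i1 : Fin k)
    (hoff : ∀ l, l ≠ i1 → ∀ j, u' j (σ' l) = u j (σ l))
    {β : Type*} [Fintype β] (c : β → ℝ) (f : β → C)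
    (hi : ∀ j, u' j (σ' i1) = ∑ b, c b * u j (f b)) :
    minor u' σ' = ∑ b, c b * minor u (Function.update σ i1 (f b)) := by
  have h1 : (Matrix.of fun i j => u' j (σ' i))
      = (Matrix.of fun i j => u j (σ i)).updateRow i1 (∑ b, c b • (fun j => u j (f b))) := by
    ext i j
    by_cases h : i = i1
    · subst h
      simp [hi, Finset.sum_apply]
    · rw [Matrix.updateRow_ne h]; exact hoff i h j
  unfold minor at *
  rw [h1, ← Matrix.cramer_transpose_apply, map_sum, Finset.sum_apply]
  refine Finset.sum_congr rfl fun b _ => ?_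
  rw [map_smul, Pi.smul_apply, smul_eq_mul]
  congr 1
  exact (minor_update u σ i1 (f b)).symm

lemma minor_noninj {C : Type*} {k : ℕ} (u : Fin k → C → ℝ) (σ : Fin k → C)
    (h : ¬ Function.Injective σ) : minor u σ = 0 := by
  unfold Function.Injective at h
  push Not at h
  obtain ⟨a, b, hab, hne⟩ := h
  exact Matrix.det_zero_of_row_eq hne (by ext j; simp [hab])

lemma minor_weight {C A : Type*} [Fintype A] {k : ℕ} (w : C → ℝ) (h : C → A → ℝ)
    (s : Fin k → A → ℤ) (σ : Fin k → C) :
    minor (cols (fun c a => w c * h c a) s) σ = (∏ l, w (σ l)) * minor (cols h s) σ := by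
  unfold minor
  rw [← Matrix.det_mul_column]
  congr 1
  ext i j
  simp [cols, Finset.mul_sum, mul_assoc]

lemma int_minor {A : Type*} {k : ℕ} (s : Fin k → A → ℤ) (σ : Fin k → A) :
    ∃ z : ℤ, minor (cst s) σ = z := by
  refine ⟨(Matrix.of fun i j => s j (σ i)).det, ?_⟩
  have := (Int.castRingHom ℝ).map_det (Matrix.of fun i j => s j (σ i))
  rw [eq_intCast] at this
  rw [this]; rfl

section L
variable {ι : Type} [Fintype ι] [DecidableEq ι]

/-- the linear forms `F = a₀ + y·a`, `F' = z·a` (in place of `a_p`), `a_i`. -/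
def Lm (p : ι) (y z : ι → ℝ) : Option ι → Option ι → ℝ
  | none, none => 1
  | none, some i => y i
  | some _, none => 0
  | some c, some i => if c = p then z i else if i = c then 1 else 0

lemma Lm_none (p : ι) (y z : ι → ℝ) (a : Option ι → ℝ) :
    ∑ b, Lm p y z none b * a b = a none + ∑ i, y i * a (some i) := by
  rw [Fintype.sum_option]; simp [Lm]

lemma Lm_p (p : ι) (y z : ι → ℝ) (a : Option ι → ℝ) :
    ∑ b, Lm p y z (some p) b * a b = ∑ i, z i * a (some i) := by
  rw [Fintype.sum_option]; simp [Lm]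

lemma Lm_i (p : ι) (y z : ι → ℝ) (a : Option ι → ℝ) (c : ι) (hc : c ≠ p) :
    ∑ b, Lm p y z (some c) b * a b = a (some c) := by
  rw [Fintype.sum_option]; simp [Lm, hc]

lemma cols_none (p : ι) (y z : ι → ℝ) {k : ℕ} (s : Fin k → Option ι → ℤ) (j : Fin k) :
    cols (Lm p y z) s j none = cst s j none + ∑ i, y i * cst s j (some i) :=
  Lm_none p y z (fun b => (s j b : ℝ))

lemma cols_p (p : ι) (y z : ι → ℝ) {k : ℕ} (s : Fin k → Option ι → ℤ) (j : Fin k) :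
    cols (Lm p y z) s j (some p) = ∑ i, z i * cst s j (some i) :=
  Lm_p p y z (fun b => (s j b : ℝ))

lemma cols_i (p : ι) (y z : ι → ℝ) {k : ℕ} (s : Fin k → Option ι → ℤ) (j : Fin k) (c : ι)
    (hc : c ≠ p) : cols (Lm p y z) s j (some c) = cst s j (some c) :=
  Lm_i p y z (fun b => (s j b : ℝ)) c hc

/-- Case 2: all nonzero integer minors contain both special indices. -/
lemma case_two (p : ι) (y z : ι → ℝ) {k : ℕ} (s : Fin k → Option ι → ℤ)
    (hs : ∀ S : Fin k → Option ι, minor (cst s) S ≠ 0 → (∃ l, S l = none) ∧ ∃ l, S l = some p)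
    (S : Fin k → Option ι) (hS : minor (cst s) S ≠ 0) :
    minor (cols (Lm p y z) s) S = z p * minor (cst s) S := by
  have hinj : Function.Injective S := by
    by_contra h; exact hS (minor_noninj _ _ h)
  obtain ⟨⟨i0, hi0⟩, ⟨i1, hi1⟩⟩ := hs S hS
  have hne : i0 ≠ i1 := by rintro rfl; rw [hi0] at hi1; cases hi1
  -- half-way matrix
  set u2 : Fin k → Option ι → ℝ := fun j c =>
    match c with
    | none => cst s j none + ∑ i, y i * cst s j (some i)
    | some c => cst s j (some c) with hu2
  -- minors of u2 with none at i0
  have half : ∀ σ : Fin k → Option ι, Function.Injective σ → σ i0 = none →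
      minor u2 σ = minor (cst s) σ + ∑ i, y i * minor (cst s) (Function.update σ i0 (some i)) := by
    intro σ hσ h0
    have := minor_row (cst s) u2 σ σ i0 (by
      intro l hl j
      have hl' : σ l ≠ none := fun h => hl (hσ (h.trans h0.symm))
      obtain ⟨c, hc⟩ := Option.ne_none_iff_exists'.1 hl'
      rw [hc]) (β := Option ι) (fun b => b.elim 1 y) (fun b => b) (by
      intro j
      rw [h0, Fintype.sum_option]; simp [hu2])
    rw [this, Fintype.sum_option]
    simp only [Option.elim]
    rw [← h0, Function.update_eq_self, one_mul]
  have step := minor_row u2 (cols (Lm p y z) s) S S i1 (by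
      intro l hl j
      by_cases h0 : S l = none
      · rw [h0, cols_none]
      · obtain ⟨c, hc⟩ := Option.ne_none_iff_exists'.1 h0
        rw [hc, cols_i]
        rintro rfl
        exact hl (hinj (hc.trans hi1.symm))) z some (by
      intro j
      rw [hi1, cols_p])
  rw [step, Finset.sum_eq_single p]
  · congr 1
    rw [← hi1, Function.update_eq_self, half S hinj hi0]
    rw [Finset.sum_eq_zero, add_zero]
    intro i _
    rw [mul_eq_zero]; right
    by_contra hc
    obtain ⟨⟨l, hl⟩, -⟩ := hs _ hc
    by_cases h : l = i0
    · subst h; simp at hl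
    · rw [Function.update_of_ne h] at hl
      exact h (hinj (hl.trans hi0.symm))
  · intro i _ hip
    rw [mul_eq_zero]; right
    by_cases hin : Function.Injective (Function.update S i1 (some i))
    · rw [half _ hin (by rw [Function.update_of_ne hne, hi0])]
      have hz1 : minor (cst s) (Function.update S i1 (some i)) = 0 := by
        by_contra hc
        obtain ⟨-, ⟨l, hl⟩⟩ := hs _ hc
        by_cases h : l = i1
        · subst h; simp at hl; exact hip hl
        · rw [Function.update_of_ne h] at hl
          exact h (hinj (hl.trans hi1.symm))
      rw [hz1, zero_add]
      refine Finset.sum_eq_zero fun i' _ => ?_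
      rw [mul_eq_zero]; right
      by_contra hc
      obtain ⟨⟨l, hl⟩, -⟩ := hs _ hc
      by_cases h : l = i0
      · subst h; simp at hl
      · rw [Function.update_of_ne h] at hl
        by_cases h' : l = i1
        · subst h'; simp at hl
        · rw [Function.update_of_ne h'] at hl
          exact h (hinj (hl.trans hi0.symm))
    · exact minor_noninj _ _ hin
  · simp

/-- Case 1: some nonzero integer minor misses one of the special indices. -/
lemma case_one (p : ι) {k : ℕ} (hk : 1 ≤ k) (s : Fin k → Option ι → ℤ)
    (S : Fin k → Option ι) (hS : minor (cst s) S ≠ 0)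
    (hmiss : ¬ ((∃ l, S l = none) ∧ ∃ l, S l = some p)) :
    ∃ (σ : Fin k → Option ι) (i1 : Fin k) (w0 : ℤ) (w : ι → ℤ), Function.Injective σ ∧ σ i1 = none ∧
      (∀ l, l ≠ i1 → ∃ c, c ≠ p ∧ σ l = some c) ∧ (w0 ≠ 0 ∨ w ≠ 0) ∧
      ∀ y z, minor (cols (Lm p y z) s) σ = w0 + ∑ i, y i * w i := by
  have hinj : Function.Injective S := by
    by_contra h; exact hS (minor_noninj _ _ h)
  have hex : ∃ i1 : Fin k, ∀ l, l ≠ i1 → ∃ c, c ≠ p ∧ S l = some c := by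
    by_cases h0 : ∃ l, S l = none
    · obtain ⟨l0, hl0⟩ := h0
      refine ⟨l0, fun l hl => ?_⟩
      have hl' : S l ≠ none := fun h => hl (hinj (h.trans hl0.symm))
      obtain ⟨c, hc⟩ := Option.ne_none_iff_exists'.1 hl'
      refine ⟨c, ?_, hc⟩
      rintro rfl
      exact hmiss ⟨⟨l0, hl0⟩, ⟨l, hc⟩⟩
    · push Not at h0
      by_cases h1 : ∃ l, S l = some p
      · obtain ⟨l0, hl0⟩ := h1
        refine ⟨l0, fun l hl => ?_⟩
        obtain ⟨c, hc⟩ := Option.ne_none_iff_exists'.1 (h0 l)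
        refine ⟨c, ?_, hc⟩
        rintro rfl
        exact hl (hinj (hc.trans hl0.symm))
      · push Not at h1
        refine ⟨⟨0, hk⟩, fun l hl => ?_⟩
        obtain ⟨c, hc⟩ := Option.ne_none_iff_exists'.1 (h0 l)
        refine ⟨c, ?_, hc⟩
        rintro rfl
        exact h1 l hc
  obtain ⟨i1, hi1⟩ := hex
  choose W hW using fun b => int_minor s (Function.update S i1 b)
  refine ⟨Function.update S i1 none, i1, W none, fun i => W (some i), ?_, by simp, ?_, ?_, ?_⟩
  · intro a b hab
    by_cases ha : a = i1
    · by_cases hb : b = i1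
      · rw [ha, hb]
      · subst ha
        rw [Function.update_self, Function.update_of_ne hb] at hab
        obtain ⟨c, -, hc⟩ := hi1 b hb
        rw [hc] at hab; cases hab
    · by_cases hb : b = i1
      · subst hb
        rw [Function.update_self, Function.update_of_ne ha] at hab
        obtain ⟨c, -, hc⟩ := hi1 a ha
        rw [hc] at hab; cases hab
      · rw [Function.update_of_ne ha, Function.update_of_ne hb] at hab
        exact hinj hab
  · intro l hl
    rw [Function.update_of_ne hl]; exact hi1 l hl
  · by_contra hcon
    push Not at hcon
    have hSW : minor (cst s) S = W (S i1) := by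
      rw [← hW, Function.update_eq_self]
    apply hS
    rw [hSW]
    rcases hb : S i1 with _ | c
    · rw [hcon.1]; simp
    · have := congrFun hcon.2 c
      simp only [Pi.zero_apply] at this
      rw [this]; simp
  · intro y z
    have := minor_row (cst s) (cols (Lm p y z) s) S (Function.update S i1 none) i1 (by
      intro l hl j
      rw [Function.update_of_ne hl]
      obtain ⟨c, hc, hc'⟩ := hi1 l hl
      rw [hc', cols_i _ _ _ _ _ _ hc]) (β := Option ι) (fun b => b.elim 1 y) (fun b => b) (by
      intro j
      rw [Function.update_self, cols_none, Fintype.sum_option]; simp)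
    rw [this, Fintype.sum_option]
    simp only [Option.elim, hW, one_mul]

/-- shift lemma -/
lemma minor_shift (p : ι) (y y' z : ι → ℝ) (δ : ℝ) (hy : ∀ i, y' i = y i + δ * z i) {k : ℕ}
    (s : Fin k → Option ι → ℤ) (σ : Fin k → Option ι) (i1 : Fin k) (hσ : σ i1 = some p)
    (hn : ∀ l, σ l ≠ none) :
    minor (cols (Lm p y' z) s) (Function.update σ i1 none)
      = minor (cols (Lm p y z) s) (Function.update σ i1 none) + δ * minor (cols (Lm p y z) s) σ := by
  have hrest : ∀ l, l ≠ i1 → ∀ j, cols (Lm p y' z) s j (Function.update σ i1 none l)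
      = cols (Lm p y z) s j (σ l) := by
    intro l hl j
    rw [Function.update_of_ne hl]
    obtain ⟨c, hc⟩ := Option.ne_none_iff_exists'.1 (hn l)
    rw [hc]
    by_cases hcp : c = p
    · subst hcp; rw [cols_p, cols_p]
    · rw [cols_i _ _ _ _ _ _ hcp, cols_i _ _ _ _ _ _ hcp]
  have := minor_row (cols (Lm p y z) s) (cols (Lm p y' z) s) σ (Function.update σ i1 none) i1 hrest
    (β := Bool) (fun b => if b then δ else 1) (fun b => if b then some p else none) (by
      intro j
      rw [Function.update_self, cols_none, Fintype.sum_bool]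
      simp only [if_true, Bool.false_eq_true, if_false]
      rw [cols_p, cols_none]
      simp only [hy, add_mul, Finset.sum_add_distrib, Finset.mul_sum]
      simp only [mul_assoc]; ring)
  rw [this, Fintype.sum_bool]
  simp only [if_true, Bool.false_eq_true, if_false]
  rw [← hσ, Function.update_eq_self]; ring

end L
end BM


set_option linter.unusedSectionVars false
set_option linter.unusedVariables false
namespace BM
section L
variable {ι : Type} [Fintype ι] [DecidableEq ι]

/-- the constant in the comparison lemma -/
noncomputable def KD (n : ℕ) (C c1 : ℝ) : ℝ := n + (1 + n * C) / c1

lemma KD_nonneg (n : ℕ) (C c1 : ℝ) (hC : 0 ≤ C) (hc1 : 0 < c1) : 0 ≤ KD n C c1 := by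
  unfold KD; positivity

lemma compare (p : ι) (w : Option ι → ℝ) (hw : ∀ c, 0 < w c) (I NN C c1 R δ : ℝ)
    (hI : 1 ≤ I) (hNN : 0 < NN) (hC : 0 ≤ C) (hc1 : 0 < c1)
    (h0p : w none * I = NN * w (some p)) (hcp : ∀ c, c ≠ p → w (some p) ≤ I * w (some c))
    (y y' z z' : ι → ℝ) (hy : ∀ i, |y' i - y i - δ * z i| ≤ C / NN) (hδ : |δ| ≤ I / NN)
    (hz : ∀ i, |z' i - z i| ≤ C / I) (hzC : ∀ i, |z i| ≤ C) (hzp : c1 ≤ |z p|)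
    (a : Option ι → ℝ) (ha : ∀ c, w c * |∑ b, Lm p y z c b * a b| < R) :
    ∀ c, w c * |∑ b, Lm p y' z' c b * a b| < (2 + C * KD (Fintype.card ι) C c1) * R := by
  have hI0 : 0 < I := by linarith
  have hR : 0 < R := lt_of_le_of_lt (mul_nonneg (hw none).le (abs_nonneg _)) (ha none)
  set D := KD (Fintype.card ι) C c1 with hD
  have hD0 : 0 ≤ D := KD_nonneg _ _ _ hC hc1
  set wp := w (some p) with hwp
  have hwp0 : 0 < wp := hw _
  have h0 : w none * |a none + ∑ i, y i * a (some i)| < R := by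
    have := ha none; rwa [Lm_none] at this
  have hp : wp * |∑ i, z i * a (some i)| < R := by
    have := ha (some p); rwa [Lm_p] at this
  have hi : ∀ c, c ≠ p → wp * |a (some c)| ≤ I * R := by
    intro c hc
    have := ha (some c); rw [Lm_i _ _ _ _ _ hc] at this
    calc wp * |a (some c)| ≤ I * w (some c) * |a (some c)| := by
          gcongr; exact hcp c hc
      _ = I * (w (some c) * |a (some c)|) := by ring
      _ ≤ _ := by gcongr
  have hap : wp * |a (some p)| ≤ (1 + Fintype.card ι * C) / c1 * (I * R) := by
    have e : z p * a (some p) = ∑ i, z i * a (some i) - ∑ i ∈ Finset.univ.erase p, z i * a (some i) := by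
      rw [← Finset.add_sum_erase _ _ (Finset.mem_univ p)]; ring
    have h1 : wp * |∑ i ∈ Finset.univ.erase p, z i * a (some i)| ≤ Fintype.card ι * C * (I * R) := by
      calc wp * |∑ i ∈ Finset.univ.erase p, z i * a (some i)|
          ≤ wp * ∑ i ∈ Finset.univ.erase p, |z i * a (some i)| := by
            gcongr; exact Finset.abs_sum_le_sum_abs _ _
        _ = ∑ i ∈ Finset.univ.erase p, |z i| * (wp * |a (some i)|) := by
            rw [Finset.mul_sum]; refine Finset.sum_congr rfl fun i _ => ?_
            rw [abs_mul]; ring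
        _ ≤ ∑ i ∈ Finset.univ.erase p, C * (I * R) := by
            refine Finset.sum_le_sum fun i hi' => ?_
            exact mul_le_mul (hzC i) (hi i (Finset.ne_of_mem_erase hi')) (by positivity) hC
        _ ≤ ∑ i : ι, C * (I * R) := Finset.sum_le_sum_of_subset_of_nonneg (Finset.subset_univ _)
            (fun _ _ _ => by positivity)
        _ = _ := by simp; ring
    have h2 : |z p| * (wp * |a (some p)|) ≤ (1 + Fintype.card ι * C) * (I * R) := by
      calc |z p| * (wp * |a (some p)|) = wp * |z p * a (some p)| := by rw [abs_mul]; ring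
        _ ≤ wp * (|∑ i, z i * a (some i)| + |∑ i ∈ Finset.univ.erase p, z i * a (some i)|) := by
            rw [e]; gcongr; exact abs_sub _ _
        _ ≤ R + Fintype.card ι * C * (I * R) := by rw [mul_add]; linarith
        _ ≤ _ := by nlinarith
    have h3 : c1 * (wp * |a (some p)|) ≤ (1 + Fintype.card ι * C) * (I * R) :=
      le_trans (by gcongr) h2
    rw [div_mul_eq_mul_div, le_div_iff₀ hc1]; linarith
  have hS : wp * ∑ i, |a (some i)| ≤ D * (I * R) := by
    rw [← Finset.add_sum_erase _ _ (Finset.mem_univ p), mul_add, Finset.mul_sum]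
    have : ∑ i ∈ Finset.univ.erase p, wp * |a (some i)| ≤ Fintype.card ι * (I * R) := by
      calc _ ≤ ∑ i ∈ Finset.univ.erase p, I * R :=
            Finset.sum_le_sum fun i hi' => hi i (Finset.ne_of_mem_erase hi')
        _ ≤ ∑ i : ι, I * R := Finset.sum_le_sum_of_subset_of_nonneg (Finset.subset_univ _)
            (fun _ _ _ => by positivity)
        _ = _ := by simp
    rw [hD]; unfold KD
    linarith
  have hsmall : ∀ (e : ι → ℝ) (E : ℝ), (∀ i, |e i| ≤ E) → 0 ≤ E →
      wp * |∑ i, e i * a (some i)| ≤ E * (D * (I * R)) := by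
    intro e E he hE
    calc wp * |∑ i, e i * a (some i)| ≤ wp * ∑ i, E * |a (some i)| := by
          gcongr
          refine (Finset.abs_sum_le_sum_abs _ _).trans (Finset.sum_le_sum fun i _ => ?_)
          rw [abs_mul]; gcongr; exact he i
      _ = E * (wp * ∑ i, |a (some i)|) := by rw [← Finset.mul_sum]; ring
      _ ≤ _ := by gcongr
  intro c
  rcases c with _ | c
  · rw [Lm_none]
    have e : a none + ∑ i, y' i * a (some i) = (a none + ∑ i, y i * a (some i))
        + δ * (∑ i, z i * a (some i)) + ∑ i, (y' i - y i - δ * z i) * a (some i) := by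
      simp only [sub_mul, Finset.sum_sub_distrib, Finset.mul_sum, mul_assoc]; ring
    have hw0 : w none = NN / I * wp := by field_simp; linarith
    have t1 : w none * |δ * (∑ i, z i * a (some i))| ≤ R := by
      rw [hw0, abs_mul]
      calc NN / I * wp * (|δ| * |∑ i, z i * a (some i)|)
          ≤ NN / I * wp * (I / NN * |∑ i, z i * a (some i)|) := by gcongr
        _ = wp * |∑ i, z i * a (some i)| := by field_simp
        _ ≤ R := hp.le
    have t2 : w none * |∑ i, (y' i - y i - δ * z i) * a (some i)| ≤ C * D * R := by
      rw [hw0, mul_assoc]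
      calc _ ≤ NN / I * (C / NN * (D * (I * R))) := by
            exact mul_le_mul_of_nonneg_left (hsmall _ _ hy (by positivity)) (by positivity)
        _ = C * D * R := by field_simp
    rw [e]
    calc _ ≤ w none * (|a none + ∑ i, y i * a (some i)| + |δ * (∑ i, z i * a (some i))|
          + |∑ i, (y' i - y i - δ * z i) * a (some i)|) := by
          have := hw none
          gcongr; exact abs_add_three _ _ _
      _ < _ := by rw [mul_add, mul_add]; linarith
  · by_cases hc : c = p
    · subst hc
      rw [Lm_p]
      have e : ∑ i, z' i * a (some i) = ∑ i, z i * a (some i) + ∑ i, (z' i - z i) * a (some i) := by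
        simp only [sub_mul, Finset.sum_sub_distrib]; ring
      have t2 := hsmall _ _ hz (by positivity)
      have e2 : C / I * (D * (I * R)) = C * D * R := by field_simp
      rw [e2] at t2
      rw [e]
      calc _ ≤ wp * (|∑ i, z i * a (some i)| + |∑ i, (z' i - z i) * a (some i)|) := by
            gcongr; exact abs_add_le _ _
        _ < _ := by rw [mul_add]; linarith
    · rw [Lm_i _ _ _ _ _ hc]
      have := ha (some c); rw [Lm_i _ _ _ _ _ hc] at this
      have : 0 ≤ C * D * R := by positivity
      linarith

/-- Plücker dichotomy. Types: (contains `none`?, contains `some p`?) -/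
lemma plucker_dich (p : ι) {k : ℕ} (u : Fin k → Option ι → ℝ) (κ κ' b : ℝ)
    (hall : ∀ σ, |minor u σ| ≤ κ)
    (h01 : ∀ σ : Fin k → Option ι, (∀ l, σ l ≠ none) → (∃ l, σ l = some p) → |minor u σ| ≤ κ')
    (hb : 0 ≤ b) (hbb : k * (κ' * κ) ≤ b * b) :
    (∀ σ : Fin k → Option ι, (∃ l, σ l = none) → (∃ l, σ l = some p) → |minor u σ| ≤ b) ∨
    (∀ σ : Fin k → Option ι, (∀ l, σ l ≠ none) → (∀ l, σ l ≠ some p) → |minor u σ| ≤ b) := by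
  by_contra hcon
  push Not at hcon
  obtain ⟨⟨σ, ⟨i0, hi0⟩, ⟨i1, hi1⟩, hσ⟩, ⟨τ, hτ0, hτ1, hτ⟩⟩ := hcon
  have hinj : Function.Injective σ := by
    by_contra h
    rw [minor_noninj _ _ h, abs_zero] at hσ; linarith
  have hne : i1 ≠ i0 := by rintro rfl; rw [hi0] at hi1; cases hi1
  have hκ : 0 ≤ κ := (abs_nonneg _).trans (hall σ)
  have := plucker u σ τ i0
  have h2 : |minor u σ * minor u τ| ≤ k * (κ' * κ) := by
    rw [this]
    refine (Finset.abs_sum_le_sum_abs _ _).trans ?_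
    calc _ ≤ ∑ j : Fin k, κ' * κ := by
          refine Finset.sum_le_sum fun j _ => ?_
          rw [abs_mul]
          have h1 : |minor u (Function.update σ i0 (τ j))| ≤ κ' := by
            apply h01
            · intro l
              by_cases hl : l = i0
              · subst hl; rw [Function.update_self]; exact hτ0 j
              · rw [Function.update_of_ne hl]
                intro h; exact hl (hinj (h.trans hi0.symm))
            · exact ⟨i1, by rw [Function.update_of_ne hne, hi1]⟩
          exact mul_le_mul h1 (hall _) (abs_nonneg _) ((abs_nonneg _).trans h1)
      _ = _ := by simp
  rw [abs_mul] at h2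
  have : b * b < |minor u σ| * |minor u τ| := mul_lt_mul'' hσ hτ hb hb
  linarith

end L

section T
/-- Derivative lemma: lower bound on the `l`-th derivative gives a subinterval where the function is
bounded below. -/
lemma deriv_lower (c : ℝ) (hc : 0 ≤ c) : ∀ (l : ℕ) (φ : ℕ → ℝ → ℝ) (a b : ℝ), a < b →
    (∀ q, ∀ t ∈ Set.Icc a b, HasDerivAt (φ q) (φ (q+1) t) t) →
    (∀ t ∈ Set.Icc a b, c ≤ |φ l t|) →
    ∃ a' b', a ≤ a' ∧ b' ≤ b ∧ b' - a' = (b - a) / 4^l ∧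
      ∀ t ∈ Set.Icc a' b', c * ((b-a)/4^l)^l ≤ |φ 0 t| := by
  intro l
  induction l with
  | zero =>
    intro φ a b hab _ h
    exact ⟨a, b, le_rfl, le_rfl, by simp, by simpa using h⟩
  | succ l ih =>
    intro φ a b hab hd h
    obtain ⟨a1, b1, ha1, hb1, hl1, hlow⟩ := ih (fun q => φ (q+1)) a b hab (fun q => hd (q+1)) h
    set S := c * ((b-a)/4^l)^l with hS
    have hS0 : 0 ≤ S := by
      have : 0 < b - a := by linarith
      positivity
    set L := (b - a)/4^l with hL
    have hL0 : 0 < L := by have : 0 < b - a := by linarith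
                           positivity
    have hsub : ∀ t, t ∈ Set.Icc a1 b1 → t ∈ Set.Icc a b := fun t ht =>
      ⟨ha1.trans ht.1, ht.2.trans hb1⟩
    have hmv : ∀ x ∈ Set.Icc a1 b1, ∀ y ∈ Set.Icc a1 b1, x < y → S * (y - x) ≤ |φ 0 y - φ 0 x| := by
      intro x hx y hy hxy
      obtain ⟨ξ, hξ, he⟩ := exists_hasDerivAt_eq_slope (φ 0) (φ 1) hxy (fun t ht =>
        (hd 0 t (hsub t ⟨hx.1.trans ht.1, ht.2.trans hy.2⟩)).continuousAt.continuousWithinAt)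
        (fun t ht => hd 0 t (hsub t ⟨hx.1.trans ht.1.le, ht.2.le.trans hy.2⟩))
      have hxy' : 0 < y - x := by linarith
      rw [eq_div_iff hxy'.ne'] at he
      rw [← he, abs_mul, abs_of_pos hxy']
      gcongr
      exact hlow ξ ⟨hx.1.trans hξ.1.le, hξ.2.le.trans hy.2⟩
    have e4 : (b - a)/4^(l+1) = L/4 := by rw [hL, pow_succ]; field_simp
    have hgoal : c * (L/4)^(l+1) ≤ S * (L/4) := by
      rw [hS, pow_succ, ← mul_assoc]
      gcongr
      linarith
    rw [e4]
    by_cases hq : ∀ t ∈ Set.Icc a1 (a1 + L/4), S * (L/4) ≤ |φ 0 t|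
    · exact ⟨a1, a1 + L/4, ha1, by linarith, by ring, fun t ht => hgoal.trans (hq t ht)⟩
    · push Not at hq
      obtain ⟨x, hx, hxs⟩ := hq
      refine ⟨b1 - L/4, b1, by linarith, hb1, by ring, fun t ht => ?_⟩
      have h1 := hmv x ⟨hx.1, by linarith [hx.2]⟩ t ⟨by linarith [ht.1], ht.2⟩ (by linarith [hx.2, ht.1])
      have h2 : S * (L/2) ≤ S * (t - x) := by gcongr; linarith [hx.2, ht.1]
      have h3 := abs_sub (φ 0 t) (φ 0 x)
      have : S * (L/2) = S * (L/4) + S * (L/4) := by ring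
      linarith

/-- Taylor polynomial -/
lemma taylor_poly : ∀ (M : ℕ) (φ : ℕ → ℝ → ℝ) (a b : ℝ) (B : ℝ) (xc : ℝ), xc ∈ Set.Icc a b → 0 ≤ B →
    (∀ q, ∀ t ∈ Set.Icc a b, HasDerivAt (φ q) (φ (q+1) t) t) →
    (∀ t ∈ Set.Icc a b, |φ (M+1) t| ≤ B) →
    ∃ P : Polynomial ℝ, P.natDegree ≤ M ∧ P.eval xc = φ 0 xc ∧
      (1 ≤ M → P.derivative.eval xc = φ 1 xc) ∧
      (∀ t ∈ Set.Icc a b, |φ 0 t - P.eval t| ≤ B * |t - xc|^(M+1)) ∧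
      (1 ≤ M → ∀ t ∈ Set.Icc a b, |φ 1 t - P.derivative.eval t| ≤ B * |t - xc|^M) := by
  have key : ∀ (ψ ψ' : ℝ → ℝ) (a b B xc : ℝ) (M : ℕ), xc ∈ Set.Icc a b → 0 ≤ B →
      (∀ t ∈ Set.Icc a b, HasDerivAt ψ (ψ' t) t) → ψ xc = 0 →
      (∀ t ∈ Set.Icc a b, |ψ' t| ≤ B * |t - xc|^M) →
      ∀ t ∈ Set.Icc a b, |ψ t| ≤ B * |t - xc|^(M+1) := by
    intro ψ ψ' a b B xc M hxc hB hd h0 hb t ht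
    have hsub : ∀ y ∈ Set.uIcc xc t, y ∈ Set.Icc a b := fun y hy => Set.uIcc_subset_Icc hxc ht hy
    have := (convex_uIcc xc t).norm_image_sub_le_of_norm_hasDerivWithin_le (f := ψ) (f' := ψ')
      (C := B * |t - xc|^M)
      (fun y hy => (hd y (hsub y hy)).hasDerivWithinAt)
      (fun y hy => by
        rw [Real.norm_eq_abs]
        refine (hb y (hsub y hy)).trans ?_
        gcongr ?_ * ?_ ^ _
        exact Set.abs_sub_left_of_mem_uIcc hy) Set.left_mem_uIcc Set.right_mem_uIcc
    rw [h0, sub_zero, Real.norm_eq_abs, Real.norm_eq_abs] at this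
    rw [pow_succ]; linarith
  intro M
  induction M with
  | zero =>
    intro φ a b B xc hxc hB hd hb
    refine ⟨Polynomial.C (φ 0 xc), by simp, by simp, by simp, ?_, by simp⟩
    refine key (fun t => φ 0 t - (Polynomial.C (φ 0 xc)).eval t) (φ 1) a b B xc 0 hxc hB ?_ (by simp) ?_
    · intro t ht; simpa using (hd 0 t ht).sub_const (φ 0 xc)
    · intro t ht; simpa using hb t ht
  | succ M ih =>
    intro φ a b B xc hxc hB hd hb
    obtain ⟨Q, hQd, hQ0, -, hQ, -⟩ := ih (fun q => φ (q+1)) a b B xc hxc hB (fun q => hd (q+1)) hb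
    -- antiderivative
    obtain ⟨P0, hP0d, hP0⟩ : ∃ P0 : Polynomial ℝ, P0.natDegree ≤ M + 1 ∧ P0.derivative = Q := by
      refine ⟨∑ i ∈ Finset.range (M+1), Polynomial.monomial (i+1) (Q.coeff i / (i+1)), ?_, ?_⟩
      · refine Polynomial.natDegree_sum_le_of_forall_le _ _ fun i hi => ?_
        refine (Polynomial.natDegree_monomial_le _).trans ?_
        have := Finset.mem_range.1 hi; omega
      · rw [Polynomial.derivative_sum]
        conv_rhs => rw [Q.as_sum_range_C_mul_X_pow' (Nat.lt_succ_of_le hQd)]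
        refine Finset.sum_congr rfl fun i _ => ?_
        rw [Polynomial.derivative_monomial, Polynomial.C_mul_X_pow_eq_monomial]
        congr 1
        push_cast; field_simp
    set P := P0 + Polynomial.C (φ 0 xc - P0.eval xc) with hP
    have hPd : P.derivative = Q := by rw [hP]; simp [hP0]
    refine ⟨P, ?_, by simp [hP], fun _ => by rw [hPd]; exact hQ0, ?_, fun _ t ht => by rw [hPd]; exact hQ t ht⟩
    · rw [hP]; refine (Polynomial.natDegree_add_le _ _).trans ?_
      simp [hP0d]
    · refine key (fun t => φ 0 t - P.eval t) (fun t => φ 1 t - Q.eval t) a b B xc (M+1) hxc hB ?_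
        (by simp [hP]) (fun t ht => hQ t ht)
      intro t ht
      have := P.hasDerivAt t
      rw [hPd] at this
      exact (hd 0 t ht).sub this

end T
end BM


set_option linter.unusedSectionVars false
set_option linter.unusedVariables false
namespace BM

lemma Dy_sub (M m i j : ℕ) (hm : m ≤ M) (hj : j < 2^(M-m)) : Dy M (i * 2^(M-m) + j) ⊆ Dy m i := by
  obtain ⟨k, rfl⟩ : ∃ k, M = m + k := ⟨M - m, by omega⟩
  rw [Nat.add_sub_cancel_left] at *
  have hj' : (j:ℝ) + 1 ≤ 2^k := by exact_mod_cast hj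
  intro x hx
  have h1 := hx.1; have h2 := hx.2
  push_cast at h1 h2
  rw [pow_add] at h1 h2
  constructor
  · refine le_trans ?_ h1
    rw [div_le_div_iff₀ (by positivity) (by positivity)]
    have : (0:ℝ) ≤ j := by positivity
    nlinarith [show (0:ℝ) < 2^m by positivity, mul_nonneg this (show (0:ℝ) ≤ 2^m by positivity)]
  · refine le_trans h2 ?_
    rw [div_le_div_iff₀ (by positivity) (by positivity)]
    have h3 := mul_le_mul_of_nonneg_left hj' (show (0:ℝ) ≤ 2^m by positivity)
    linarith

lemma Dy_unit (m i : ℕ) (hi : i < 2^m) : Dy m i ⊆ Set.Icc 0 1 := by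
  have hi' : (i:ℝ) + 1 ≤ 2^m := by exact_mod_cast hi
  intro x hx
  constructor
  · exact le_trans (by positivity) hx.1
  · refine le_trans hx.2 ?_
    rw [div_le_one (by positivity)]; exact hi'

lemma cnt_vol (E F : Set ℝ) (M m i : ℕ)
    (h : ∀ j < 2^(M-m), (Dy M (i * 2^(M-m) + j) ∩ E).Nonempty → Dy M (i * 2^(M-m) + j) ⊆ F) :
    (cnt E M m i : ℝ≥0∞) * ENNReal.ofReal (1/2^M) ≤ volume F := by
  classical
  unfold cnt
  set S := (Finset.range (2^(M-m))).filter fun j => (Dy M (i * 2^(M-m) + j) ∩ E).Nonempty with hS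
  let I : ℕ → Set ℝ := fun j => Set.Ioo (((i * 2^(M-m) + j : ℕ):ℝ)/2^M) ((((i * 2^(M-m) + j : ℕ):ℝ)+1)/2^M)
  have hvol : ∀ j, volume (I j) = ENNReal.ofReal (1/2^M) := by
    intro j; simp only [I]; rw [Real.volume_Ioo]; congr 1; ring
  have hdis : (S : Set ℕ).PairwiseDisjoint I := by
    intro a _ b _ hab
    have main : ∀ a b : ℕ, a < b → Disjoint (I a) (I b) := by
      intro a b hlt
      rw [Set.disjoint_left]
      intro x hx hy
      have h1 := hx.2.trans_le' hy.1.le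
      have h1 := hy.1.trans hx.2
      rw [div_lt_div_iff_of_pos_right (by positivity)] at h1
      have : i * 2^(M-m) + b < i * 2^(M-m) + a + 1 := by exact_mod_cast h1
      omega
    rcases lt_or_gt_of_ne hab with h | h
    · exact main a b h
    · exact (main b a h).symm
  calc (S.card : ℝ≥0∞) * ENNReal.ofReal (1/2^M) = ∑ j ∈ S, volume (I j) := by
        rw [Finset.sum_congr rfl fun j _ => hvol j]; simp
    _ = volume (⋃ j ∈ S, I j) := (measure_biUnion_finset hdis fun j _ => measurableSet_Ioo).symm
    _ ≤ volume F := by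
        refine measure_mono (Set.iUnion₂_subset fun j hj => ?_)
        rw [hS, Finset.mem_filter, Finset.mem_range] at hj
        exact Set.Ioo_subset_Icc_self.trans (h j hj.1 hj.2)

section L
variable {ι : Type} [Fintype ι] [DecidableEq ι]

/-- weight exponents -/
noncomputable def wex (r : ι → ℝ) (p : ι) (N i : ℕ) : Option ι → ℝ
  | none => N / (1 + r p)
  | some c => -(r c) * (N / (1 + r p)) + if c = p then (i:ℝ) else 0

/-- weights -/
noncomputable def wt (r : ι → ℝ) (p : ι) (N i : ℕ) (c : Option ι) : ℝ := (2:ℝ)^(wex r p N i c)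

lemma wt_pos (r : ι → ℝ) (p : ι) (N i : ℕ) (c : Option ι) : 0 < wt r p N i c := by
  unfold wt; positivity

lemma wt_0p (r : ι → ℝ) (p : ι) (N i : ℕ) (hr : 0 < r p) :
    wt r p N i none * 2^i = 2^N * wt r p N i (some p) := by
  unfold wt
  rw [← Real.rpow_natCast, ← Real.rpow_natCast, ← Real.rpow_add two_pos, ← Real.rpow_add two_pos]
  congr 1
  simp only [wex, if_true]
  field_simp; ring

lemma wt_cp (r : ι → ℝ) (p : ι) (N i : ℕ) (hr : 0 < r p) (hp : ∀ c, r c ≤ r p) (c : ι) (hc : c ≠ p) :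
    wt r p N i (some p) ≤ 2^i * wt r p N i (some c) := by
  unfold wt
  rw [← Real.rpow_natCast, ← Real.rpow_add two_pos]
  apply Real.rpow_le_rpow_of_exponent_le one_le_two
  simp only [wex, if_true, hc, if_false]
  have : 0 ≤ (N:ℝ)/(1 + r p) := by positivity
  nlinarith [hp c]

/-- the bad sets on a curve -/
def ES (g : ℕ → ℝ → ι → ℝ) (r : ι → ℝ) (p : ι) (η : ℝ) (N i : ℕ) : Set ℝ :=
  {x | x ∈ Set.Icc (0:ℝ) 1 ∧ ∃ a : Option ι → ℤ, a ≠ 0 ∧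
    ∀ c, wt r p N i c * |∑ b, Lm p (g 0 x) (g 1 x) c b * (a b : ℝ)| < (2:ℝ)^(η * i)}

/-- curve data -/
structure CD (B : ℕ → ℝ) (c1 : ℝ) (l0 : ℕ) (g : ℕ → ℝ → ι → ℝ) : Prop where
  der : ∀ l, ∀ t ∈ Set.Icc (0:ℝ) 1, ∀ i, HasDerivAt (fun t => g l t i) (g (l+1) t i) t
  bd : ∀ l, ∀ t ∈ Set.Icc (0:ℝ) 1, ∀ i, |g l t i| ≤ B l
  lo : ∀ t ∈ Set.Icc (0:ℝ) 1, ∀ i, c1 ≤ |g 1 t i|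
  nd : ∀ w : ι → ℝ, (∀ i, |w i| ≤ 1) → (∃ i, |w i| = 1) → ∃ l, 1 ≤ l ∧ l ≤ l0 ∧
    ∀ t ∈ Set.Icc (0:ℝ) 1, c1 ≤ |∑ i, w i * g l t i|

lemma taylor_one (φ : ℕ → ℝ → ℝ) (a b B : ℝ) (hB : 0 ≤ B)
    (hd : ∀ q, ∀ t ∈ Set.Icc a b, HasDerivAt (φ q) (φ (q+1) t) t)
    (hb : ∀ t ∈ Set.Icc a b, |φ 2 t| ≤ B) (x t : ℝ) (hx : x ∈ Set.Icc a b) (ht : t ∈ Set.Icc a b) :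
    |φ 0 t - φ 0 x - (t - x) * φ 1 x| ≤ B * |t - x|^2 ∧ |φ 1 t - φ 1 x| ≤ B * |t - x| := by
  obtain ⟨P, hP1, hP2, hP3, hP4, hP5⟩ := taylor_poly 1 φ a b B x hx hB hd hb
  obtain ⟨u, v, rfl⟩ := Polynomial.exists_eq_X_add_C_of_natDegree_le_one hP1
  have h3 := hP3 le_rfl
  have h4 := hP4 t ht
  have h5 := hP5 le_rfl t ht
  simp at hP2 h3 h4 h5
  constructor
  · have e : φ 0 t - φ 0 x - (t - x) * φ 1 x = φ 0 t - (u * t + v) := by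
      rw [← hP2, ← h3]; ring
    rw [e, sq_abs]; exact h4
  · rw [← h3]; exact h5

/-- polynomial forms -/
noncomputable def Hm (p : ι) (w : Option ι → ℝ) (P : ι → Polynomial ℝ) :
    Option ι → Option ι → Polynomial ℝ
  | none, none => Polynomial.C (w none)
  | none, some i => Polynomial.C (w none) * P i
  | some _, none => 0
  | some c, some i => Polynomial.C (w (some c)) *
      (if c = p then (P i).derivative else if i = c then 1 else 0)

lemma Hm_eval (p : ι) (w : Option ι → ℝ) (P : ι → Polynomial ℝ) (x : ℝ) (c a : Option ι) :
    (Hm p w P c a).eval x = w c * Lm p (fun i => (P i).eval x) (fun i => (P i).derivative.eval x) c a := by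
  rcases c with _ | c <;> rcases a with _ | a <;> simp [Hm, Lm]
  split_ifs <;> simp

lemma Hm_deg (p : ι) (w : Option ι → ℝ) (P : ι → Polynomial ℝ) (M : ℕ) (hP : ∀ i, (P i).natDegree ≤ M)
    (c a : Option ι) : (Hm p w P c a).natDegree ≤ M := by
  rcases c with _ | c <;> rcases a with _ | a <;> simp only [Hm]
  · simp
  · exact (Polynomial.natDegree_C_mul_le _ _).trans (hP a)
  · simp
  · refine (Polynomial.natDegree_C_mul_le _ _).trans ?_
    split_ifs
    · exact (Polynomial.natDegree_derivative_le _).trans ((Nat.sub_le _ _).trans (hP a))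
    · simp
    · simp

end L

theorem count_poly (n Md : ℕ) (B : ℕ → ℝ) (hB : ∀ l, 0 ≤ B l) (c1 C : ℝ) (hc1 : 0 < c1) (hC : 0 ≤ C) :
    ∃ K α : ℝ, 0 < K ∧ 0 < α ∧ α ≤ 1 ∧ ∀ (ι : Type) [Fintype ι] [DecidableEq ι],
    Fintype.card ι = n → ∀ (r : ι → ℝ) (p : ι) (l0 : ℕ) (g : ℕ → ℝ → ι → ℝ), CD B c1 l0 g →
    0 < r p → (∀ c, r c ≤ r p) → ∀ (η : ℝ) (N i m j0 : ℕ), m ≤ N - i → 2 * i ≤ N → j0 < 2^m →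
    ∀ P : ι → Polynomial ℝ, (∀ i, (P i).natDegree ≤ Md) →
    (∀ t ∈ Dy m j0, ∀ c, |g 0 t c - (P c).eval t| ≤ C / 2^N) →
    (∀ t ∈ Dy m j0, ∀ c, |g 1 t c - (P c).derivative.eval t| ≤ C / 2^i) →
    ∀ ρ : ℝ, 0 < ρ →
    (∀ k, 1 ≤ k → ∀ s : Fin k → Option ι → ℤ, LinearIndependent ℝ (cst s) → ∃ x ∈ Dy m j0,
      ρ^k ≤ psi (cols (fun c a => wt r p N i c *
        Lm p (fun i => (P i).eval x) (fun i => (P i).derivative.eval x) c a) s)) →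
    (cnt (ES g r p η N i) (N - i) m j0 : ℝ≥0∞)
      ≤ ENNReal.ofReal (K * ((2:ℝ)^(η * i) / ρ)^α) * 2^(N - i - m) := by
  obtain ⟨K0, α, hK0, hα0, hα1, hqn⟩ := qn (n+1) Md
  set C' := C + B 2 + B 1 with hC'
  have hC'0 : 0 ≤ C' := by have := hB 2; have := hB 1; positivity
  set K1 := 2 + C' * KD n C' c1 with hK1
  have hK10 : 0 < K1 := by have := KD_nonneg n C' c1 hC'0 hc1; positivity
  refine ⟨K0 * K1^α, α, by positivity, hα0, hα1, ?_⟩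
  intro ι _ _ hcard r p l0 g hg hrp hrc η N i m j0 hm hiN hj0 P hPd hP0 hP1 ρ hρ hpsi
  have hab : (j0:ℝ)/2^m < ((j0:ℝ)+1)/2^m := by gcongr; linarith
  have key := hqn (Option ι) (Option ι) (by simp [hcard]) (Hm p (wt r p N i) P) (Hm_deg _ _ _ _ hPd)
    _ _ hab ρ hρ (by
      intro k hk s hs
      obtain ⟨x, hx, h⟩ := hpsi k hk s hs
      refine ⟨x, hx, ?_⟩
      simpa only [Hm_eval] using h) (K1 * (2:ℝ)^(η * i)) (by positivity)
  set F := {x : ℝ | x ∈ Set.Icc ((j0:ℝ)/2^m) (((j0:ℝ)+1)/2^m) ∧ ∃ v : Option ι → ℤ, v ≠ 0 ∧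
    ∀ c, |∑ a, (Hm p (wt r p N i) P c a).eval x * (v a : ℝ)| < K1 * (2:ℝ)^(η * i)} with hF
  have hcv := cnt_vol (ES g r p η N i) F (N-i) m j0 (by
    intro j hj hne t ht
    obtain ⟨x, hxD, hx01, a, ha0, ha⟩ := hne
    have hsub := Dy_sub (N-i) m j0 j hm hj
    refine ⟨hsub ht, a, ha0, ?_⟩
    have ht01 := Dy_unit m j0 hj0 (hsub ht)
    have hNi : (2:ℝ)^(N-i) * 2^i = 2^N := by rw [← pow_add]; congr 1; omega
    have hdist : |t - x| ≤ 2^i / 2^N := by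
      have e : (2:ℝ)^i/2^N = 1/2^(N-i) := by rw [← hNi]; field_simp
      rw [e, abs_le]
      have e1 := hxD.1; have e2 := hxD.2; have e3 := ht.1; have e4 := ht.2
      rw [add_div] at e2 e4
      constructor <;> linarith
    have hpow : (2:ℝ)^i * 2^i ≤ 2^N := by
      rw [← pow_add]; exact pow_le_pow_right₀ one_le_two (by omega)
    have hT := fun c => taylor_one (fun l t => g l t c) 0 1 (B 2) (hB 2) (fun q t ht => hg.der q t ht c)
      (fun t ht => hg.bd 2 t ht c) x t hx01 ht01
    have hc := compare p (wt r p N i) (wt_pos r p N i) (2^i) (2^N) C' c1 ((2:ℝ)^(η * i)) (t - x)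
      (one_le_pow₀ one_le_two) (by positivity) hC'0 hc1 (wt_0p r p N i hrp)
      (wt_cp r p N i hrp hrc) (g 0 x) (fun c => (P c).eval t) (g 1 x) (fun c => (P c).derivative.eval t)
      (by
        intro c
        have h1 := hP0 t (hsub ht) c
        have h2 := (hT c).1
        have h3 : B 2 * |t - x|^2 ≤ B 2 / 2^N := by
          have := hB 2
          have h4 : |t - x|^2 ≤ (2^i/2^N)^2 := by gcongr
          have h5 : ((2:ℝ)^i/2^N)^2 ≤ 1/2^N := by
            rw [div_pow, div_le_div_iff₀ (by positivity) (by positivity)]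
            rw [pow_two, pow_two]
            have : (0:ℝ) < 2^N := by positivity
            nlinarith
          calc _ ≤ B 2 * (1/2^N) := by gcongr; exact h4.trans h5
            _ = _ := by ring
        rw [abs_sub_comm] at h1
        have e : (P c).eval t - g 0 x c - (t - x) * g 1 x c
          = ((P c).eval t - g 0 t c) + (g 0 t c - g 0 x c - (t-x) * g 1 x c) := by ring
        have h6 : 0 ≤ B 1 / 2^N := by have := hB 1; positivity
        rw [e, hC', add_div, add_div]
        refine (abs_add_le _ _).trans ?_
        linarith) hdist
      (by
        intro c
        have h1 := hP1 t (hsub ht) c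
        have h2 := (hT c).2
        have h3 : B 2 * |t - x| ≤ B 2 / 2^i := by
          have := hB 2
          have h5 : (2:ℝ)^i/2^N ≤ 1/2^i := by
            rw [div_le_div_iff₀ (by positivity) (by positivity)]; linarith
          calc _ ≤ B 2 * (1/2^i) := by gcongr; exact hdist.trans h5
            _ = _ := by ring
        rw [abs_sub_comm] at h1
        have e : (P c).derivative.eval t - g 1 x c
          = ((P c).derivative.eval t - g 1 t c) + (g 1 t c - g 1 x c) := by ring
        have h6 : 0 ≤ B 1 / 2^i := by have := hB 1; positivity
        rw [e, hC', add_div, add_div]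
        refine (abs_add_le _ _).trans ?_
        linarith)
      (by
        intro c
        refine (hg.bd 1 x hx01 c).trans ?_
        have := hB 2
        rw [hC']; linarith) (hg.lo x hx01 p) (fun b => (a b : ℝ)) ha
    intro c
    have := hc c
    rw [hcard] at this
    simp only [Hm_eval, mul_assoc]
    rwa [← Finset.mul_sum, abs_mul, abs_of_pos (wt_pos _ _ _ _ _)])
  have h1 := hcv.trans key
  have e1 : K0 * (K1 * (2:ℝ)^(η * i) / ρ)^α * (((j0:ℝ)+1)/2^m - (j0:ℝ)/2^m)
      = K0 * K1^α * ((2:ℝ)^(η * i) / ρ)^α * 2^(N - i - m) * (1/2^(N-i)) := by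
    rw [mul_div_assoc, Real.mul_rpow hK10.le (by positivity)]
    have : (2:ℝ)^(N-i) = 2^(N-i-m) * 2^m := by rw [← pow_add]; congr 1; omega
    rw [this]; field_simp; ring
  rw [e1, ENNReal.ofReal_mul (by positivity), ENNReal.ofReal_mul (by positivity)] at h1
  have h2 := (ENNReal.mul_le_mul_iff_left (c := ENNReal.ofReal (1/2^(N-i)))
    (by simp) ENNReal.ofReal_ne_top).1 h1
  refine h2.trans (le_of_eq ?_)
  congr 1
  rw [ENNReal.ofReal_pow (by norm_num)]; norm_num

end BM


set_option linter.unusedSectionVars false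
set_option linter.unusedVariables false
namespace BM

lemma cnt_mono (E E' : Set ℝ) (h : E ⊆ E') (M m i : ℕ) : cnt E M m i ≤ cnt E' M m i := by
  classical
  unfold cnt
  refine Finset.card_le_card fun j hj => ?_
  rw [Finset.mem_filter] at hj ⊢
  exact ⟨hj.1, hj.2.mono (Set.inter_subset_inter_right _ h)⟩

lemma cnt_empty (E : Set ℝ) (M m i : ℕ) (hm : m ≤ M) (h : ¬ (Dy m i ∩ E).Nonempty) : cnt E M m i = 0 := by
  classical
  unfold cnt
  rw [Finset.card_eq_zero, Finset.filter_eq_empty_iff]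
  intro j hj hne
  exact h (hne.mono (Set.inter_subset_inter_left _ (Dy_sub M m i j hm (Finset.mem_range.1 hj))))

lemma prod_rpow {C : Type*} [DecidableEq C] {k : ℕ} (e : C → ℝ) (σ : Fin k → C)
    (hσ : Function.Injective σ) :
    ∏ l, (2:ℝ)^(e (σ l)) = (2:ℝ)^(∑ c ∈ Finset.univ.image σ, e c) := by
  rw [Finset.sum_image (fun a _ b _ h => hσ h), Real.rpow_sum_of_pos two_pos]

section L
variable {ι : Type} [Fintype ι] [DecidableEq ι]

lemma Lm_inj (p : ι) (y z : ι → ℝ) (hz : z p ≠ 0) (a : Option ι → ℝ)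
    (h : ∀ c, ∑ b, Lm p y z c b * a b = 0) : a = 0 := by
  have hc : ∀ c, c ≠ p → a (some c) = 0 := by
    intro c hc
    have := h (some c); rwa [Lm_i _ _ _ _ _ hc] at this
  have hp : a (some p) = 0 := by
    have := h (some p)
    rw [Lm_p, Finset.sum_eq_single p] at this
    · exact (mul_eq_zero.1 this).resolve_left hz
    · intro c _ hcp; rw [hc c hcp, mul_zero]
    · simp
  have hall : ∀ c, a (some c) = 0 := fun c => by
    by_cases h : c = p
    · rw [h, hp]
    · exact hc c h
  have h0 := h none
  rw [Lm_none] at h0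
  funext c
  rcases c with _ | c
  · simpa [hall] using h0
  · exact hall c

lemma LI_cols (p : ι) (y z : ι → ℝ) (hz : z p ≠ 0) (w : Option ι → ℝ) (hw : ∀ c, 0 < w c) {k : ℕ}
    (s : Fin k → Option ι → ℤ) (hs : LinearIndependent ℝ (cst s)) :
    LinearIndependent ℝ (cols (fun c a => w c * Lm p y z c a) s) := by
  rw [Fintype.linearIndependent_iff] at hs ⊢
  intro d hd
  apply hs
  apply Lm_inj p y z hz
  intro c
  have := congrFun hd c
  simp only [Finset.sum_apply, Pi.smul_apply, smul_eq_mul, cols, Pi.zero_apply] at this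
  have e : ∑ j, d j * ∑ b, w c * Lm p y z c b * (s j b : ℝ)
      = w c * ∑ b, Lm p y z c b * (∑ j, d j • cst s j) b := by
    simp only [Finset.mul_sum, Finset.sum_apply, Pi.smul_apply, smul_eq_mul, cst]
    rw [Finset.sum_comm]
    refine Finset.sum_congr rfl fun b _ => Finset.sum_congr rfl fun j _ => ?_
    ring
  rw [e] at this
  exact (mul_eq_zero.1 this).resolve_left (hw c).ne'

lemma mink_ES (g : ℕ → ℝ → ι → ℝ) (r : ι → ℝ) (p : ι) (η : ℝ) (N i : ℕ) (x : ℝ)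
    (hx : x ∈ Set.Icc (0:ℝ) 1) (hz : g 1 x p ≠ 0) {k n1 : ℕ} (hk : 1 ≤ k) (hkn : k ≤ n1)
    (s : Fin k → Option ι → ℤ) (hs : LinearIndependent ℝ (cst s)) (θ : ℝ) (hθ : 0 < θ)
    (hmin : ∀ σ, |minor (cols (fun c a => wt r p N i c * Lm p (g 0 x) (g 1 x) c a) s) σ| ≤ 4 * n1 * θ^k)
    (hlt : 8 * n1^2 * θ < (2:ℝ)^(η * i)) : x ∈ ES g r p η N i := by
  obtain ⟨c, hc0, hc⟩ := minkowski_minors hk _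
    (exists_minor_ne _ (LI_cols p (g 0 x) (g 1 x) hz (wt r p N i) (wt_pos r p N i) s hs)) _ hmin
  refine ⟨hx, fun b => ∑ j, c j * s j b, ?_, ?_⟩
  · intro h0
    rw [Fintype.linearIndependent_iff] at hs
    have := hs (fun j => (c j : ℝ)) (by
      funext b
      have := congrFun h0 b
      simp only [Finset.sum_apply, Pi.smul_apply, smul_eq_mul, cst, Pi.zero_apply] at this ⊢
      exact_mod_cast this)
    exact hc0 (funext fun j => by exact_mod_cast this j)
  · intro b
    have h1 := hc b
    have e : ∑ j, (c j : ℝ) * cols (fun c a => wt r p N i c * Lm p (g 0 x) (g 1 x) c a) s j b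
        = wt r p N i b * ∑ b', Lm p (g 0 x) (g 1 x) b b' * ((∑ j, c j * s j b' : ℤ) : ℝ) := by
      push_cast
      simp only [cols, Finset.mul_sum]
      rw [Finset.sum_comm]
      refine Finset.sum_congr rfl fun b' _ => Finset.sum_congr rfl fun j _ => ?_
      ring
    rw [e, abs_mul, abs_of_pos (wt_pos _ _ _ _ _)] at h1
    refine h1.trans_lt (lt_of_le_of_lt ?_ hlt)
    have hn1 : (1:ℝ) ≤ n1 := by exact_mod_cast hk.trans hkn
    have hk' : (k:ℝ) ≤ n1 := by exact_mod_cast hkn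
    have h2 : (4 * n1 * θ^k : ℝ)^(1/(k:ℝ)) ≤ 4 * n1 * θ := by
      rw [Real.mul_rpow (by positivity) (by positivity), ← Real.rpow_natCast θ k,
        ← Real.rpow_mul hθ.le, mul_one_div_cancel (by positivity), Real.rpow_one]
      gcongr
      refine (Real.rpow_le_rpow_of_exponent_le (by linarith) (y := 1/(k:ℝ)) (z := 1) ?_).trans (by simp)
      rw [div_le_one (by positivity)]; exact_mod_cast hk
    calc 2 * (k:ℝ) * (4 * n1 * θ^k)^(1/(k:ℝ)) ≤ 2 * n1 * (4 * n1 * θ) := by gcongr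
      _ = _ := by ring

lemma sum_wex (r : ι → ℝ) (p : ι) (hsum : ∑ c, r c = 1) (N i : ℕ) : ∑ c, wex r p N i c = i := by
  rw [Fintype.sum_option]
  simp only [wex, Finset.sum_add_distrib, ← Finset.sum_mul, Finset.sum_neg_distrib, hsum]
  simp

lemma wex_some_nonpos (r : ι → ℝ) (p : ι) (hr : ∀ c, 0 < r c) (N i : ℕ) (c : ι) (hc : c ≠ p) :
    wex r p N i (some c) ≤ 0 := by
  simp only [wex, hc, if_false, add_zero]
  have := hr c; have := hr p
  have : 0 ≤ r c * (N / (1 + r p)) := by positivity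
  linarith

/-- lower bound in the second case -/
lemma case2_low (r : ι → ℝ) (p : ι) (hr : ∀ c, 0 < r c) (hsum : ∑ c, r c = 1) (N i : ℕ)
    (y z : ι → ℝ) (c1 : ℝ) (hc1 : 0 < c1) (hz : c1 ≤ |z p|) {k : ℕ} (s : Fin k → Option ι → ℤ)
    (hs : ∀ S : Fin k → Option ι, minor (cst s) S ≠ 0 → (∃ l, S l = none) ∧ ∃ l, S l = some p)
    (S : Fin k → Option ι) (hS : minor (cst s) S ≠ 0) :
    c1 * 2^i ≤ psi (cols (fun c a => wt r p N i c * Lm p y z c a) s) := by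
  refine le_trans ?_ (le_psi _ S)
  rw [minor_weight, case_two p y z s hs S hS]
  have hinj : Function.Injective S := by
    by_contra h; exact hS (minor_noninj _ _ h)
  obtain ⟨⟨l0, hl0⟩, ⟨l1, hl1⟩⟩ := hs S hS
  have hprod : (2:ℝ)^i ≤ ∏ l, wt r p N i (S l) := by
    unfold wt
    rw [prod_rpow _ _ hinj, ← Real.rpow_natCast]
    apply Real.rpow_le_rpow_of_exponent_le one_le_two
    rw [← sum_wex r p hsum N i, ← Finset.sum_add_sum_compl (Finset.univ.image S)]
    have : ∑ c ∈ (Finset.univ.image S)ᶜ, wex r p N i c ≤ 0 := by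
      refine Finset.sum_nonpos fun c hc => ?_
      rw [Finset.mem_compl, Finset.mem_image] at hc
      push Not at hc
      rcases c with _ | c
      · exact absurd hl0 (hc l0 (Finset.mem_univ _))
      · apply wex_some_nonpos r p hr
        rintro rfl
        exact absurd hl1 (hc l1 (Finset.mem_univ _))
    linarith
  have hInt : 1 ≤ |minor (cst s) S| := by
    obtain ⟨w, hw⟩ := int_minor s S
    rw [hw] at hS ⊢
    have : w ≠ 0 := by rintro rfl; simp at hS
    exact_mod_cast Int.one_le_abs this
  rw [abs_mul, abs_mul, abs_of_pos (Finset.prod_pos fun l _ => wt_pos _ _ _ _ _)]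
  calc c1 * 2^i = 2^i * (c1 * 1) := by ring
    _ ≤ _ := by
      gcongr
      exact Finset.prod_nonneg fun l _ => (wt_pos _ _ _ _ _).le

/-- ratio estimates: weights `(N, 2 * i)` versus `(N, i)` -/
lemma ratioA (r : ι → ℝ) (p : ι) (N i : ℕ) (y z : ι → ℝ) {k : ℕ} (s : Fin k → Option ι → ℤ)
    (σ : Fin k → Option ι) (hσ : Function.Injective σ) :
    ((∃ l, σ l = some p) → minor (cols (fun c a => wt r p N (2*i) c * Lm p y z c a) s) σ
      = 2^i * minor (cols (fun c a => wt r p N i c * Lm p y z c a) s) σ) ∧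
    ((∀ l, σ l ≠ some p) → minor (cols (fun c a => wt r p N (2*i) c * Lm p y z c a) s) σ
      = minor (cols (fun c a => wt r p N i c * Lm p y z c a) s) σ) := by
  have h : ∀ c, wt r p N (2*i) c = (if c = some p then 2^i else 1) * wt r p N i c := by
    intro c
    rcases c with _ | c
    · simp [wt, wex]
    · simp only [wt, wex, Option.some.injEq]
      split_ifs with hc
      · rw [← Real.rpow_natCast, ← Real.rpow_add two_pos]
        congr 1; push_cast; ring
      · simp
  simp only [minor_weight]
  simp only [h, Finset.prod_mul_distrib]
  constructor
  · rintro ⟨l, hl⟩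
    rw [Finset.prod_eq_single l]
    · rw [if_pos hl]; ring
    · intro l' _ hne
      rw [if_neg]
      intro h'; exact hne (hσ (h'.trans hl.symm))
    · simp
  · intro hne
    rw [Finset.prod_eq_one (fun l _ => if_neg (hne l)), one_mul]

/-- exponents of the ratio between weights `(N-i, i)` and `(N, i)` -/
noncomputable def eB (r : ι → ℝ) (p : ι) (i : ℕ) : Option ι → ℝ
  | none => -((i:ℝ) / (1 + r p))
  | some c => r c * ((i:ℝ) / (1 + r p))

lemma ratioB (r : ι → ℝ) (p : ι) (N i : ℕ) (hi : i ≤ N) (y z : ι → ℝ) {k : ℕ} (s : Fin k → Option ι → ℤ)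
    (σ : Fin k → Option ι) (hσ : Function.Injective σ) :
    minor (cols (fun c a => wt r p (N-i) i c * Lm p y z c a) s) σ
      = (2:ℝ)^(∑ c ∈ Finset.univ.image σ, eB r p i c) *
        minor (cols (fun c a => wt r p N i c * Lm p y z c a) s) σ := by
  have h : ∀ c, wt r p (N-i) i c = (2:ℝ)^(eB r p i c) * wt r p N i c := by
    intro c
    rcases c with _ | c
    · simp only [wt, wex, eB]
      rw [← Real.rpow_add two_pos]; congr 1
      push_cast [hi]; ring
    · simp only [wt, wex, eB]
      rw [← Real.rpow_add two_pos]; congr 1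
      push_cast [hi]; ring
  simp only [minor_weight]
  simp only [h, Finset.prod_mul_distrib]
  rw [prod_rpow _ _ hσ]; ring

lemma eB_none (r : ι → ℝ) (p : ι) (ε0 : ℝ) (hε : 0 < ε0) (hr : ∀ c, ε0 ≤ r c) (hsum : ∑ c, r c = 1)
    (i : ℕ) (T : Finset (Option ι)) (h0 : none ∈ T) (hne : T ≠ Finset.univ) :
    ∑ c ∈ T, eB r p i c ≤ -(ε0 * i / 2) := by
  have hrp : r p ≤ 1 := by
    rw [← hsum]; exact Finset.single_le_sum (f := r) (fun c _ => hε.le.trans (hr c)) (Finset.mem_univ p)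
  have hrp0 : 0 < r p := hε.trans_le (hr p)
  set t := (i:ℝ) / (1 + r p) with ht
  have ht0 : (i:ℝ)/2 ≤ t := by
    rw [ht]; gcongr; linarith
  have htot : ∑ c, eB r p i c = 0 := by
    rw [Fintype.sum_option]
    simp only [eB, ← Finset.sum_mul, hsum]; ring
  obtain ⟨c0, hc0⟩ : ∃ c0, c0 ∉ T := by
    by_contra h; push Not at h
    exact hne (Finset.eq_univ_iff_forall.2 h)
  rw [← Finset.sum_add_sum_compl T] at htot
  have hti : (0:ℝ) ≤ t := le_trans (by positivity) ht0
  have h1 : ε0 * t ≤ ∑ c ∈ Tᶜ, eB r p i c := by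
    have hnn : ∀ c ∈ Tᶜ, ε0 * t ≤ eB r p i c := by
      intro c hc
      rcases c with _ | c
      · exact absurd h0 (Finset.mem_compl.1 hc)
      · simp only [eB]; rw [← ht]; gcongr; exact hr c
    refine (hnn c0 (Finset.mem_compl.2 hc0)).trans ?_
    exact Finset.single_le_sum (f := eB r p i)
      (fun c hc => le_trans (by positivity) (hnn c hc)) (Finset.mem_compl.2 hc0)
  have : ε0 * (i/2) ≤ ε0 * t := by gcongr
  linarith

lemma eB_some (r : ι → ℝ) (p : ι) (ε0 : ℝ) (hε : 0 < ε0) (hr : ∀ c, ε0 ≤ r c) (hsum : ∑ c, r c = 1)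
    (i : ℕ) (T : Finset (Option ι)) (h0 : none ∉ T) :
    ∑ c ∈ T, eB r p i c ≤ i ∧ (some p ∉ T → ∑ c ∈ T, eB r p i c ≤ (1 - ε0) * i) := by
  have hr0 : ∀ c, 0 < r c := fun c => hε.trans_le (hr c)
  have hrp0 : 0 < r p := hr0 p
  set t := (i:ℝ) / (1 + r p) with ht
  have hti : (0:ℝ) ≤ t := by positivity
  have hti' : t ≤ i := by
    rw [ht, div_le_iff₀ (by positivity)]
    have : (0:ℝ) ≤ i := by positivity
    nlinarith
  have h1 : ∀ T' : Finset (Option ι), T' = Finset.univ.erase none → ∑ c ∈ T', eB r p i c = t := by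
    rintro T' rfl
    have := Finset.add_sum_erase Finset.univ (eB r p i) (Finset.mem_univ none)
    rw [Fintype.sum_option] at this
    have h2 : ∑ c, eB r p i (some c) = t := by simp only [eB, ← Finset.sum_mul, hsum, ht, one_mul]
    linarith
  have hnn : ∀ c ∈ Finset.univ.erase (none : Option ι), 0 ≤ eB r p i c := by
    intro c hc
    rcases c with _ | c
    · simp at hc
    · have := hr0 c; simp only [eB]; positivity
  have hsub : T ⊆ Finset.univ.erase none := fun c hc => by
    rw [Finset.mem_erase]; exact ⟨fun h => h0 (h ▸ hc), Finset.mem_univ _⟩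
  constructor
  · calc ∑ c ∈ T, eB r p i c ≤ ∑ c ∈ Finset.univ.erase none, eB r p i c :=
        Finset.sum_le_sum_of_subset_of_nonneg hsub (fun c hc _ => hnn c hc)
      _ = t := h1 _ rfl
      _ ≤ i := hti'
  · intro hp
    have hsub2 : T ⊆ (Finset.univ.erase none).erase (some p) := fun c hc => by
      rw [Finset.mem_erase]; exact ⟨fun h => hp (h ▸ hc), hsub hc⟩
    have h3 : eB r p i (some p) + ∑ c ∈ (Finset.univ.erase none).erase (some p), eB r p i c = t := by
      rw [Finset.add_sum_erase _ _ (by simp)]; exact h1 _ rfl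
    have h4 : ∑ c ∈ T, eB r p i c ≤ ∑ c ∈ (Finset.univ.erase none).erase (some p), eB r p i c :=
      Finset.sum_le_sum_of_subset_of_nonneg hsub2 (fun c hc _ => hnn c (Finset.mem_of_mem_erase hc))
    have h5 : eB r p i (some p) = r p * t := rfl
    have hrp1 : r p ≤ 1 := by
      rw [← hsum]; exact Finset.single_le_sum (f := r) (fun c _ => (hr0 c).le) (Finset.mem_univ p)
    have h6 : (1 - r p) * t ≤ (1 - ε0) * i := by
      apply mul_le_mul (by linarith [hr p]) hti' hti
      linarith [hr p]
    linarith

end L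
end BM


set_option linter.unusedSectionVars false
set_option linter.unusedVariables false
namespace BM
section L
variable {ι : Type} [Fintype ι] [DecidableEq ι]

lemma LI_card {k : ℕ} (s : Fin k → Option ι → ℤ) (hs : LinearIndependent ℝ (cst s)) :
    k ≤ Fintype.card ι + 1 := by
  have := hs.fintype_card_le_finrank
  simpa using this

/-- the weighted linear shift -/
lemma shift_bound (r : ι → ℝ) (p : ι) (hrp : 0 < r p) (N i : ℕ) (y y' z : ι → ℝ) (δ κ : ℝ)
    (hy : ∀ i, y' i = y i + δ * z i) {k : ℕ} (s : Fin k → Option ι → ℤ)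
    (h1 : ∀ σ, |minor (cols (fun c a => wt r p N i c * Lm p y z c a) s) σ| ≤ κ)
    (h2 : ∀ σ, |minor (cols (fun c a => wt r p N i c * Lm p y' z c a) s) σ| ≤ κ)
    (σ : Fin k → Option ι) (hn : ∀ l, σ l ≠ none) (hp : ∃ l, σ l = some p) :
    |δ| * 2^N / 2^i * |minor (cols (fun c a => wt r p N i c * Lm p y z c a) s) σ| ≤ 2 * κ := by
  obtain ⟨i1, hi1⟩ := hp
  have hsh := minor_shift p y y' z δ hy s σ i1 hi1 hn
  have a1 := h1 (Function.update σ i1 none)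
  have a2 := h2 (Function.update σ i1 none)
  rw [minor_weight] at a1 a2 ⊢
  set W := ∏ l, wt r p N i (Function.update σ i1 none l) with hW
  set W0 := ∏ l, wt r p N i (σ l) with hW0
  have hW0p : 0 < W0 := Finset.prod_pos fun l _ => wt_pos _ _ _ _ _
  have hWW : W = 2^N / 2^i * W0 := by
    rw [hW, hW0, ← Finset.mul_prod_erase _ _ (Finset.mem_univ i1),
      ← Finset.mul_prod_erase _ (fun l => wt r p N i (σ l)) (Finset.mem_univ i1)]
    rw [Function.update_self, hi1]
    have e : ∏ x ∈ Finset.univ.erase i1, wt r p N i (Function.update σ i1 none x)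
        = ∏ x ∈ Finset.univ.erase i1, wt r p N i (σ x) :=
      Finset.prod_congr rfl fun x hx => by rw [Function.update_of_ne (Finset.ne_of_mem_erase hx)]
    rw [e, ← mul_assoc]
    congr 1
    have := wt_0p r p N i hrp
    field_simp; linarith
  have e2 : δ * 2^N/2^i * (W0 * minor (cols (Lm p y z) s) σ)
      = W * minor (cols (Lm p y' z) s) (Function.update σ i1 none)
        - W * minor (cols (Lm p y z) s) (Function.update σ i1 none) := by
    rw [hsh, hWW]; ring
  have e3 : |δ| * 2^N / 2^i * |W0 * minor (cols (Lm p y z) s) σ|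
      = |δ * 2^N/2^i * (W0 * minor (cols (Lm p y z) s) σ)| := by
    rw [abs_mul (δ * 2^N/2^i), abs_div, abs_mul δ, abs_of_pos (show (0:ℝ) < 2^N by positivity),
      abs_of_pos (show (0:ℝ) < 2^i by positivity)]
  rw [e3, e2]
  refine (abs_sub _ _).trans ?_
  linarith

set_option maxHeartbeats 1600000 in
lemma local_psi (B : ℕ → ℝ) (c1 : ℝ) (hc1 : 0 < c1) (l0 : ℕ) (g : ℕ → ℝ → ι → ℝ) (hg : CD B c1 l0 g)
    (r : ι → ℝ) (p : ι) (ε0 : ℝ) (hε : 0 < ε0) (hε1 : ε0 ≤ 1) (hr : ∀ c, ε0 ≤ r c)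
    (hsum : ∑ c, r c = 1) (η : ℝ) (hη : η = ε0 / (16 * (Fintype.card ι + 1)))
    (N i m j0 : ℕ) (hm : m = N - 4 * i) (hiN : 16 * i ≤ N)
    (x0 : ℝ) (hx0 : x0 ∈ Dy m j0) (hx01 : x0 ∈ Set.Icc (0:ℝ) 1)
    (hx0A : x0 ∉ ES g r p η N (2*i)) (hx0B : x0 ∉ ES g r p η (N-i) i)
    (cc : ℝ) (hcc : 0 < cc) (hcc1 : cc ≤ c1) (hcc2 : cc ≤ 1)
    (hcc3 : 8 * ((Fintype.card ι + 1 : ℕ):ℝ)^2 * cc < 1)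
    (k : ℕ) (hk : 1 ≤ k) (s : Fin k → Option ι → ℤ) (hs : LinearIndependent ℝ (cst s)) :
    ∃ x ∈ Dy m j0, (cc * (2:ℝ)^(2*η*i))^k ≤ psi (cols (fun c a => wt r p N i c *
        Lm p (fun c => g 0 x0 c + (x - x0) * g 1 x0 c) (g 1 x0) c a) s) := by
  set n1 : ℕ := Fintype.card ι + 1 with hn1
  have hn1' : (n1:ℝ) = Fintype.card ι + 1 := by rw [hn1]; push_cast; ring
  have hn1p : (1:ℝ) ≤ n1 := by rw [hn1']; have : (0:ℝ) ≤ Fintype.card ι := by positivity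
                               linarith
  rw [← hn1'] at hη
  have hη0 : 0 < η := by rw [hη]; positivity
  have hr0 : ∀ c, 0 < r c := fun c => hε.trans_le (hr c)
  set ρ := cc * (2:ℝ)^(2*η*i) with hρ
  have hρ0 : 0 < ρ := by positivity
  have hkn : k ≤ n1 := LI_card s hs
  have hz : c1 ≤ |g 1 x0 p| := hg.lo x0 hx01 p
  have hz0 : g 1 x0 p ≠ 0 := by
    intro h; rw [h, abs_zero] at hz; linarith
  by_contra hcon
  push Not at hcon
  by_cases hkk : k = n1
  · -- top dimension
    obtain ⟨S, hS⟩ := exists_minor_ne _ hs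
    have hall : ∀ S : Fin k → Option ι, minor (cst s) S ≠ 0 → (∃ l, S l = none) ∧ ∃ l, S l = some p := by
      intro S hS
      have hinj : Function.Injective S := by
        by_contra h; exact hS (minor_noninj _ _ h)
      have hbij : Function.Bijective S := by
        rw [Fintype.bijective_iff_injective_and_card]
        refine ⟨hinj, ?_⟩
        simp [hkk, hn1]
      exact ⟨hbij.2 none, hbij.2 (some p)⟩
    have h1 := hcon x0 hx0
    have h2 := case2_low r p hr0 hsum N i (fun c => g 0 x0 c + (x0 - x0) * g 1 x0 c) (g 1 x0) c1 hc1 hz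
      s hall S hS
    have h3 : ρ^k ≤ c1 * 2^i := by
      rw [hρ, mul_pow, ← Real.rpow_natCast ((2:ℝ)^(2*η*i)), ← Real.rpow_mul two_pos.le]
      have a1 : cc^k ≤ c1 := by
        calc cc^k ≤ cc^1 := pow_le_pow_of_le_one hcc.le hcc2 hk
          _ ≤ c1 := by simpa using hcc1
      have a2 : (2:ℝ)^(2*η*i*k) ≤ 2^i := by
        rw [← Real.rpow_natCast 2 i]
        apply Real.rpow_le_rpow_of_exponent_le one_le_two
        have e : 2*η*k ≤ 1 := by
          rw [hkk, hη]
          have : 2 * (ε0 / (16 * n1)) * n1 = ε0 / 8 := by field_simp; ring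
          rw [this]; linarith
        calc 2*η*i*k = (2*η*k)*i := by ring
          _ ≤ 1 * i := by gcongr
          _ = i := one_mul _
      exact mul_le_mul a1 a2 (by positivity) hc1.le
    linarith
  · have hkn' : k < n1 := lt_of_le_of_ne hkn hkk
    set κ := ρ^k with hκ
    have hκ0 : 0 < κ := by positivity
    set u := cols (fun c a => wt r p N i c * Lm p (g 0 x0) (g 1 x0) c a) s with hu
    have hall : ∀ σ, |minor u σ| ≤ κ := by
      intro σ
      have := hcon x0 hx0
      simp only [sub_self, zero_mul, add_zero] at this
      exact ((le_psi u σ).trans_lt this).le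
    -- shift
    obtain ⟨x1, hx1, hδ⟩ : ∃ x1 ∈ Dy m j0, |x1 - x0| = 1/2^m/2 := by
      have hp : (0:ℝ) < 1/2^m := by positivity
      have a1 := hx0.1; have a2 := hx0.2
      rw [add_div] at a2
      by_cases h : x0 + 1/2^m/2 ≤ ((j0:ℝ)+1)/2^m
      · refine ⟨x0 + 1/2^m/2, ⟨by linarith, h⟩, ?_⟩
        rw [add_sub_cancel_left, abs_of_pos (by positivity)]
      · rw [add_div] at h
        refine ⟨x0 - 1/2^m/2, ⟨by linarith, by rw [add_div]; linarith⟩, ?_⟩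
        rw [sub_sub_cancel_left, abs_neg, abs_of_pos (by positivity)]
    have hNm : (2:ℝ)^N = 2^m * 2^(3*i) * 2^i := by
      rw [← pow_add, ← pow_add]; congr 1; omega
    have h01 : ∀ σ : Fin k → Option ι, (∀ l, σ l ≠ none) → (∃ l, σ l = some p) →
        |minor u σ| ≤ 4 * κ / 2^(3*i) := by
      intro σ h0 h1
      have := shift_bound r p (hr0 p) N i (g 0 x0) (fun c => g 0 x0 c + (x1 - x0) * g 1 x0 c) (g 1 x0)
        (x1 - x0) κ (fun _ => rfl) s hall
        (fun σ => ((le_psi _ σ).trans_lt (hcon x1 hx1)).le) σ h0 h1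
      rw [hδ, hNm] at this
      have e : (1:ℝ)/2^m/2 * (2^m * 2^(3*i) * 2^i)/2^i = 2^(3*i)/2 := by field_simp
      rw [e] at this
      rw [le_div_iff₀ (by positivity)]
      linarith
    have h2i : (1:ℝ) ≤ 2^i := one_le_pow₀ one_le_two
    have h3i : (2:ℝ)^(3*i) = 2^i * 2^i * 2^i := by rw [← pow_add, ← pow_add]; congr 1; omega
    have hk1 : (k:ℝ) ≤ n1 := by exact_mod_cast hkn
    rcases plucker_dich p u κ (4*κ/2^(3*i)) (2 * n1 * κ / 2^i) hall h01 (by positivity) (by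
      rw [h3i]
      have e1 : (k:ℝ) * (4*κ/(2^i*2^i*2^i)*κ) = (k / 2^i) * (4 * κ^2/(2^i*2^i)) := by field_simp
      have e2 : 2 * n1 * κ / 2^i * (2 * n1 * κ / 2^i) = (n1 * n1) * (4 * κ^2/(2^i*2^i)) := by
        field_simp; ring
      rw [e1, e2]
      gcongr
      calc (k:ℝ)/2^i ≤ k := div_le_self (by positivity) h2i
        _ ≤ n1 := hk1
        _ ≤ n1 * n1 := by nlinarith) with hA | hB
    · -- case (A)
      apply hx0A
      refine mink_ES g r p η N (2*i) x0 hx01 hz0 hk hkn s hs ρ hρ0 ?_ ?_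
      · intro σ
        rw [← hκ]
        by_cases hinj : Function.Injective σ
        swap
        · rw [minor_noninj _ _ hinj, abs_zero]; positivity
        obtain ⟨r1, r2⟩ := ratioA r p N i (g 0 x0) (g 1 x0) s σ hinj
        by_cases hp : ∃ l, σ l = some p
        · rw [r1 hp, abs_mul, abs_of_pos (by positivity)]
          by_cases h0 : ∃ l, σ l = none
          · calc _ ≤ 2^i * (2 * n1 * κ / 2^i) := by gcongr; exact hA σ h0 hp
              _ = 2 * n1 * κ := by field_simp
              _ ≤ _ := by gcongr; norm_num
          · push Not at h0
            calc _ ≤ 2^i * (4 * κ / 2^(3*i)) := by gcongr; exact h01 σ h0 hp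
              _ = 4 * κ / (2^i * 2^i) := by rw [h3i]; field_simp
              _ ≤ 4 * κ := div_le_self (by positivity) (by nlinarith)
              _ ≤ 4 * n1 * κ := by nlinarith
        · push Not at hp
          rw [r2 hp]
          refine (hall σ).trans ?_
          nlinarith
      · have e : (2:ℝ)^(η * ((2*i : ℕ):ℝ)) = (2:ℝ)^(2*η*i) := by congr 1; push_cast; ring
        rw [e, hρ, ← mul_assoc]
        calc _ < 1 * (2:ℝ)^(2*η*i) := by gcongr
          _ = _ := one_mul _
    · -- case (B)
      apply hx0B
      set θ := ρ * (2:ℝ)^(-(ε0 * i / (2 * n1))) with hθ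
      have hθk : κ * (2:ℝ)^(-(ε0 * i / 2)) ≤ θ^k := by
        rw [hθ, mul_pow, ← hκ, ← Real.rpow_natCast ((2:ℝ)^(-(ε0 * i / (2 * n1)))),
          ← Real.rpow_mul two_pos.le]
        gcongr
        · norm_num
        · have : ε0 * i / (2 * n1) * k ≤ ε0 * i / (2*n1) * n1 := by gcongr
          have e : ε0 * i / (2*n1) * n1 = ε0 * i / 2 := by field_simp
          linarith
      refine mink_ES g r p η (N-i) i x0 hx01 hz0 hk hkn s hs θ (by positivity) ?_ ?_
      · intro σ
        by_cases hinj : Function.Injective σ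
        swap
        · rw [minor_noninj _ _ hinj, abs_zero]; positivity
        suffices h : |minor (cols (fun c a => wt r p (N-i) i c * Lm p (g 0 x0) (g 1 x0) c a) s) σ|
            ≤ 4 * n1 * (κ * (2:ℝ)^(-(ε0 * i / 2))) by
          refine h.trans ?_; gcongr
        rw [ratioB r p N i (by omega) _ _ s σ hinj, abs_mul, abs_of_pos (by positivity)]
        by_cases h0 : ∃ l, σ l = none
        · obtain ⟨l, hl⟩ := h0
          have hb := eB_none r p ε0 hε hr hsum i (Finset.univ.image σ)
            (Finset.mem_image.2 ⟨l, Finset.mem_univ _, hl⟩) (by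
              intro h
              have h1 := Finset.card_image_of_injective Finset.univ hinj
              rw [h] at h1
              simp at h1
              omega)
          calc _ ≤ (2:ℝ)^(-(ε0 * i / 2)) * κ := by
                gcongr
                · norm_num
                · exact hall σ
            _ ≤ _ := by
                have : 0 < (2:ℝ)^(-(ε0 * i / 2)) * κ := by positivity
                nlinarith
        · push Not at h0
          obtain ⟨b1, b2⟩ := eB_some r p ε0 hε hr hsum i (Finset.univ.image σ) (by
            intro h
            obtain ⟨l, -, hl⟩ := Finset.mem_image.1 h
            exact h0 l hl)
          by_cases hp : ∃ l, σ l = some p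
          · calc _ ≤ (2:ℝ)^(i:ℝ) * (4*κ/2^(3*i)) := by
                  gcongr
                  · norm_num
                  · exact h01 σ h0 hp
              _ = 4 * (κ * (2^i * 2^i)⁻¹) := by rw [h3i, Real.rpow_natCast]; field_simp
              _ ≤ 4 * (κ * (2:ℝ)^(-(ε0 * i / 2))) := by
                  gcongr
                  rw [Real.rpow_neg two_pos.le]
                  gcongr
                  rw [← pow_add, ← Real.rpow_natCast]
                  apply Real.rpow_le_rpow_of_exponent_le one_le_two
                  push_cast
                  have : (0:ℝ) ≤ i := by positivity
                  nlinarith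
              _ ≤ _ := by
                  have : 0 < κ * (2:ℝ)^(-(ε0 * i / 2)) := by positivity
                  nlinarith
          · push Not at hp
            have b3 := b2 (by
              intro h
              obtain ⟨l, -, hl⟩ := Finset.mem_image.1 h
              exact hp l hl)
            calc _ ≤ (2:ℝ)^((1-ε0) * i) * (2 * n1 * κ / 2^i) := by
                  gcongr
                  · norm_num
                  · exact hB σ h0 hp
              _ = 2 * n1 * (κ * (2:ℝ)^(-(ε0 * i))) := by
                  rw [← Real.rpow_natCast 2 i,
                    show (1 - ε0) * (i:ℝ) = i + (-(ε0 * i)) by ring, Real.rpow_add two_pos]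
                  field_simp
              _ ≤ 4 * n1 * (κ * (2:ℝ)^(-(ε0 * i / 2))) := by
                  gcongr
                  · norm_num
                  · norm_num
                  · have : (0:ℝ) ≤ ε0 * i := by positivity
                    linarith
      · have e : θ = cc * (2:ℝ)^(2*η*i - ε0 * i / (2 * n1)) := by
          rw [hθ, hρ, mul_assoc, ← Real.rpow_add two_pos]; congr 2
        have e2 : (2*η*i - ε0 * i / (2 * n1)) ≤ η * i := by
          have : ε0 / (2 * n1) = 8 * η := by rw [hη]; field_simp; ring
          have h3 : ε0 * i / (2 * n1) = 8 * η * i := by rw [← this]; ring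
          rw [h3]
          have : 0 ≤ η * i := by positivity
          linarith
        rw [e, ← mul_assoc]
        calc 8 * (n1:ℝ)^2 * cc * (2:ℝ)^(2*η*i - ε0 * i / (2 * n1))
            < 1 * (2:ℝ)^(2*η*i - ε0 * i / (2 * n1)) := by gcongr
          _ ≤ _ := by
            rw [one_mul]
            exact Real.rpow_le_rpow_of_exponent_le one_le_two e2

end L

theorem local_count (n : ℕ) (B : ℕ → ℝ) (hB : ∀ l, 0 ≤ B l) (c1 : ℝ) (hc1 : 0 < c1)
    (ε0 : ℝ) (hε : 0 < ε0) (hε1 : ε0 ≤ 1) :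
    ∃ A σ : ℝ, 0 < A ∧ 0 < σ ∧ ∀ (ι : Type) [Fintype ι] [DecidableEq ι],
    Fintype.card ι = n → ∀ (r : ι → ℝ) (p : ι) (l0 : ℕ) (g : ℕ → ℝ → ι → ℝ), CD B c1 l0 g →
    (∀ c, ε0 ≤ r c) → ∑ c, r c = 1 → (∀ c, r c ≤ r p) → ∀ (η : ℝ), η = ε0 / (16 * (n + 1)) →
    ∀ N i j0 : ℕ, 16 * i ≤ N → j0 < 2^(N - 4 * i) →
    (cnt (ES g r p η N i \ (ES g r p η N (2*i) ∪ ES g r p η (N-i) i)) (N - i) (N - 4 * i) j0 : ℝ≥0∞)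
      ≤ ENNReal.ofReal (A * (2:ℝ)^(-(σ * i))) * 2^(3 * i) := by
  obtain ⟨K, α, hK, hα, hα1, hcount⟩ := count_poly n 1 B hB c1 (B 2) hc1 (hB 2)
  obtain ⟨cc, hcc, hcc1, hcc2, hcc3⟩ : ∃ cc : ℝ, 0 < cc ∧ cc ≤ c1 ∧ cc ≤ 1 ∧
      8 * ((n + 1 : ℕ):ℝ)^2 * cc < 1 := by
    refine ⟨min c1 (min 1 (1/(16 * ((n + 1 : ℕ):ℝ)^2))), by positivity, min_le_left _ _,
      (min_le_right _ _).trans (min_le_left _ _), ?_⟩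
    have h1 : min c1 (min 1 (1/(16 * ((n + 1 : ℕ):ℝ)^2))) ≤ 1/(16 * ((n + 1 : ℕ):ℝ)^2) :=
      (min_le_right _ _).trans (min_le_right _ _)
    calc _ ≤ 8 * ((n + 1 : ℕ):ℝ)^2 * (1/(16 * ((n + 1 : ℕ):ℝ)^2)) := by gcongr
      _ = 1/2 := by field_simp; norm_num
      _ < 1 := by norm_num
  set η0 := ε0 / (16 * ((n:ℝ) + 1)) with hη0
  have hη0p : 0 < η0 := by positivity
  refine ⟨K * (1/cc)^α, α * η0, by positivity, by positivity, ?_⟩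
  intro ι _ _ hcard r p l0 g hg hr hsum hrp η hη N i j0 hiN hj0
  by_cases hne : (Dy (N - 4*i) j0 ∩ (ES g r p η N i \ (ES g r p η N (2*i) ∪ ES g r p η (N-i) i))).Nonempty
  swap
  · rw [cnt_empty _ _ _ _ (by omega) hne]; simp
  obtain ⟨x0, hx0, ⟨hx01, -⟩, hx0n⟩ := hne
  rw [Set.mem_union, not_or] at hx0n
  have hps := fun k hk s hs => local_psi B c1 hc1 l0 g hg r p ε0 hε hε1 hr hsum η (by rw [hη, hcard])
    N i (N-4*i) j0 rfl hiN x0 hx0 hx01 hx0n.1 hx0n.2 cc hcc hcc1 hcc2 (by rw [hcard]; exact hcc3) k hk s hs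
  let P : ι → Polynomial ℝ := fun c => Polynomial.C (g 1 x0 c) * Polynomial.X
    + Polynomial.C (g 0 x0 c - g 1 x0 c * x0)
  have hPe : ∀ c t, (P c).eval t = g 0 x0 c + (t - x0) * g 1 x0 c := by
    intro c t; simp [P]; ring
  have hPe' : ∀ c t, (P c).derivative.eval t = g 1 x0 c := by
    intro c t; simp [P]
  have hdist : ∀ t ∈ Dy (N-4*i) j0, |t - x0| ≤ 1/2^(N-4*i) := by
    intro t ht
    have e1 := hx0.1; have e2 := hx0.2; have e3 := ht.1; have e4 := ht.2
    rw [add_div] at e2 e4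
    rw [abs_le]; constructor <;> linarith
  have hT := fun c t (ht : t ∈ Dy (N-4*i) j0) => taylor_one (fun l t => g l t c) 0 1 (B 2) (hB 2)
      (fun q t ht => hg.der q t ht c)
      (fun t ht => hg.bd 2 t ht c) x0 t hx01 (Dy_unit _ _ hj0 ht)
  have key := hcount ι hcard r p l0 g hg (hε.trans_le (hr p)) hrp η N i (N - 4*i) j0 (by omega) (by omega)
    hj0 P (fun c => by
      simp only [P]
      exact Polynomial.natDegree_linear_le)
    (by
      intro t ht c
      rw [hPe]
      have := (hT c t ht).1
      have e : g 0 t c - (g 0 x0 c + (t - x0) * g 1 x0 c) = g 0 t c - g 0 x0 c - (t - x0) * g 1 x0 c := by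
        ring
      rw [e]
      refine this.trans ?_
      rw [div_eq_mul_one_div]
      refine mul_le_mul_of_nonneg_left ?_ (hB 2)
      calc |t - x0|^2 ≤ (1/2^(N-4*i))^2 := by gcongr; exact hdist t ht
        _ = 1/2^((N-4*i)*2) := by rw [div_pow, one_pow, ← pow_mul]
        _ ≤ 1/2^N := by
          apply one_div_le_one_div_of_le (by positivity)
          exact pow_le_pow_right₀ one_le_two (by omega))
    (by
      intro t ht c
      rw [hPe']
      refine (hT c t ht).2.trans ?_
      rw [div_eq_mul_one_div (B 2)]
      refine mul_le_mul_of_nonneg_left ?_ (hB 2)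
      refine (hdist t ht).trans ?_
      apply one_div_le_one_div_of_le (by positivity)
      exact pow_le_pow_right₀ one_le_two (by omega))
    (cc * (2:ℝ)^(2*η*i)) (by positivity) (by
      intro k hk s hs
      obtain ⟨x, hx, h⟩ := hps k hk s hs
      refine ⟨x, hx, ?_⟩
      simpa only [hPe, hPe'] using h)
  refine (Nat.cast_le.2 (cnt_mono _ _ Set.sdiff_subset _ _ _)).trans (key.trans (le_of_eq ?_))
  congr 1
  · congr 1
    have e : (2:ℝ)^(η * i) / (cc * (2:ℝ)^(2*η*i)) = 1/cc * (2:ℝ)^(-(η * i)) := by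
      rw [show 2*η*(i:ℝ) = η*i + η*i by ring, Real.rpow_add two_pos, Real.rpow_neg two_pos.le]
      field_simp
    rw [e, Real.mul_rpow (by positivity) (by positivity), ← Real.rpow_mul two_pos.le, mul_assoc, hη]
    congr 3; ring
  · congr 1; omega

end BM


set_option linter.unusedSectionVars false
set_option linter.unusedVariables false
namespace BM

lemma sum_range_two (f : ℕ → ℕ) (a : ℕ) :
    ∑ j ∈ Finset.range (2*a), f j = ∑ j ∈ Finset.range a, (f (2*j) + f (2*j+1)) := by
  induction a with
  | zero => simp
  | succ a ih =>
    rw [Finset.sum_range_succ, ← ih, show 2*(a+1) = 2*a+1+1 by ring, Finset.sum_range_succ,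
      Finset.sum_range_succ]; ring

lemma cnt_subdiv (E : Set ℝ) (M : ℕ) : ∀ m ≤ M, ∑ j ∈ Finset.range (2^m), cnt E M m j = cnt E M 0 0 := by
  intro m
  induction m with
  | zero => intro _; simp
  | succ m ih =>
    intro hm
    rw [← ih (by omega), pow_succ, mul_comm, sum_range_two]
    exact Finset.sum_congr rfl fun j _ => cnt_split E M m j (by omega)

section L
variable {ι : Type} [Fintype ι] [DecidableEq ι]

/-- lower bound in the first case -/
lemma case1_wt (r : ι → ℝ) (p : ι) (ε0 : ℝ) (hε : 0 < ε0) (hr : ∀ c, ε0 ≤ r c)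
    (hsum : ∑ c, r c = 1) (N i : ℕ) {k : ℕ} (σ : Fin k → Option ι) (i1 : Fin k)
    (hσ : Function.Injective σ) (h0 : σ i1 = none) (h1 : ∀ l, l ≠ i1 → ∃ c, c ≠ p ∧ σ l = some c) :
    (2:ℝ)^(ε0 * N / 2) ≤ ∏ l, wt r p N i (σ l) := by
  have hr0 : ∀ c, 0 < r c := fun c => hε.trans_le (hr c)
  have hrp0 : 0 < r p := hr0 p
  have hrp1 : r p ≤ 1 := by
    rw [← hsum]; exact Finset.single_le_sum (f := r) (fun c _ => (hr0 c).le) (Finset.mem_univ p)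
  unfold wt
  rw [prod_rpow _ _ hσ]
  apply Real.rpow_le_rpow_of_exponent_le one_le_two
  have hpn : some p ∉ Finset.univ.image σ := by
    intro h
    obtain ⟨l, -, hl⟩ := Finset.mem_image.1 h
    by_cases hli : l = i1
    · rw [hli, h0] at hl; cases hl
    · obtain ⟨c, hc, hc'⟩ := h1 l hli
      rw [hc'] at hl; exact hc (Option.some.inj hl)
  have hnn : none ∈ Finset.univ.image σ := Finset.mem_image.2 ⟨i1, Finset.mem_univ _, h0⟩
  have htot := sum_wex r p hsum N i
  rw [← Finset.sum_add_sum_compl (Finset.univ.image σ)] at htot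
  have h2 : ∑ c ∈ (Finset.univ.image σ)ᶜ, wex r p N i c ≤ wex r p N i (some p) := by
    rw [← Finset.add_sum_erase _ _ (Finset.mem_compl.2 hpn)]
    have : ∑ c ∈ ((Finset.univ.image σ)ᶜ).erase (some p), wex r p N i c ≤ 0 := by
      refine Finset.sum_nonpos fun c hc => ?_
      rw [Finset.mem_erase, Finset.mem_compl] at hc
      rcases c with _ | c
      · exact absurd hnn hc.2
      · exact wex_some_nonpos r p hr0 N i c (fun h => hc.1 (by rw [h]))
    linarith
  have h3 : wex r p N i (some p) = -(r p) * (N / (1 + r p)) + i := by simp [wex]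
  have h4 : ε0 * (N/2) ≤ r p * (N / (1 + r p)) := by
    have : (N:ℝ)/2 ≤ N / (1 + r p) := by gcongr; linarith
    exact mul_le_mul (hr p) this (by positivity) hrp0.le
  linarith

lemma case1_val (B : ℕ → ℝ) (c1 : ℝ) (hc1 : 0 < c1) (l0 : ℕ) (g : ℕ → ℝ → ι → ℝ) (hg : CD B c1 l0 g)
    (m j0 : ℕ) (hj0 : j0 < 2^m) (P : ι → ℝ → ℝ) (er : ℝ)
    (hP : ∀ t ∈ Dy m j0, ∀ c, |g 0 t c - P c t| ≤ er)
    (her : Fintype.card ι * er ≤ c1 * (1/2^m/4^l0)^l0 / 2) (w0 : ℤ) (w : ι → ℤ) (hw : w0 ≠ 0 ∨ w ≠ 0) :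
    ∃ x ∈ Dy m j0, min 1 (c1 * (1/2^m/4^l0)^l0 / 2) ≤ |(w0:ℝ) + ∑ i, P i x * w i| := by
  have hab : (j0:ℝ)/2^m < ((j0:ℝ)+1)/2^m := by gcongr; linarith
  by_cases hw1 : w = 0
  · refine ⟨(j0:ℝ)/2^m, ⟨le_rfl, hab.le⟩, ?_⟩
    have h0 : w0 ≠ 0 := hw.resolve_right (fun h => h hw1)
    rw [hw1]; simp only [Pi.zero_apply, Int.cast_zero, mul_zero, Finset.sum_const_zero, add_zero]
    refine (min_le_left _ _).trans ?_
    exact_mod_cast Int.one_le_abs h0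
  · obtain ⟨i', hi'⟩ := Function.ne_iff.1 hw1
    obtain ⟨im, -, hmax⟩ := Finset.exists_max_image Finset.univ (fun i => |(w i:ℝ)|) ⟨i', Finset.mem_univ _⟩
    set nw := |(w im : ℝ)| with hnw
    have hnw1 : 1 ≤ nw := by
      refine le_trans ?_ (hmax i' (Finset.mem_univ _))
      exact_mod_cast Int.one_le_abs hi'
    have hnw0 : 0 < nw := by linarith
    obtain ⟨l, hl1, hl0, hl⟩ := hg.nd (fun i => w i / nw)
      (fun i => by rw [abs_div, abs_of_pos hnw0, div_le_one hnw0]; exact hmax i (Finset.mem_univ _))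
      ⟨im, by rw [abs_div, abs_of_pos hnw0]; exact div_self hnw0.ne'⟩
    let φ : ℕ → ℝ → ℝ := fun q t => (if q = 0 then (w0:ℝ) else 0) + ∑ i, g q t i * w i
    obtain ⟨a', b', ha', hb', hlen, hlow⟩ := deriv_lower (c1 * nw) (by positivity) l φ
      ((j0:ℝ)/2^m) (((j0:ℝ)+1)/2^m) hab
      (by
        intro q t ht
        have h1 : HasDerivAt (fun t => ∑ i, g q t i * (w i:ℝ)) (∑ i, g (q+1) t i * (w i:ℝ)) t :=
          HasDerivAt.fun_sum fun i _ => (hg.der q t (Dy_unit m j0 hj0 ht) i).mul_const _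
        have := h1.const_add (if q = 0 then (w0:ℝ) else 0)
        simpa [φ] using this)
      (by
        intro t ht
        have h1 := hl t (Dy_unit m j0 hj0 ht)
        have e : φ l t = nw * ∑ i, (w i / nw) * g l t i := by
          simp only [φ]
          rw [if_neg (by omega), zero_add, Finset.mul_sum]
          refine Finset.sum_congr rfl fun i _ => ?_
          field_simp
        rw [e, abs_mul, abs_of_pos hnw0, mul_comm]
        gcongr)
    have hlen0 : 0 < b' - a' := by
      rw [hlen]
      have : 0 < ((j0:ℝ)+1)/2^m - (j0:ℝ)/2^m := by linarith
      positivity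
    have hx : a' ∈ Dy m j0 := ⟨ha', by linarith⟩
    refine ⟨a', hx, (min_le_right _ _).trans ?_⟩
    have h1 := hlow a' ⟨le_rfl, by linarith⟩
    have e1 : ((j0:ℝ)+1)/2^m - (j0:ℝ)/2^m = 1/2^m := by ring
    rw [e1] at h1
    have h2 : (1/2^m/4^l0 : ℝ)^l0 ≤ (1/2^m/4^l)^l := by
      calc (1/2^m/4^l0 : ℝ)^l0 ≤ (1/2^m/4^l0)^l := by
            apply pow_le_pow_of_le_one (by positivity) _ hl0
            rw [div_div, div_le_one (by positivity), ← one_mul (1:ℝ)]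
            exact mul_le_mul (one_le_pow₀ one_le_two) (one_le_pow₀ (by norm_num)) (by norm_num) (by positivity)
        _ ≤ _ := by
          gcongr
          norm_num
    have h3 : |∑ i, (g 0 a' i - P i a') * (w i:ℝ)| ≤ nw * (Fintype.card ι * er) := by
      refine (Finset.abs_sum_le_sum_abs _ _).trans ?_
      calc _ ≤ ∑ i : ι, er * nw := by
            refine Finset.sum_le_sum fun i _ => ?_
            rw [abs_mul]
            have := hP a' hx i
            exact mul_le_mul this (hmax i (Finset.mem_univ _)) (abs_nonneg _) ((abs_nonneg _).trans this)
        _ = _ := by simp; ring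
    have e2 : (w0:ℝ) + ∑ i, P i a' * w i = φ 0 a' - ∑ i, (g 0 a' i - P i a') * (w i:ℝ) := by
      simp only [φ, if_true, sub_mul, Finset.sum_sub_distrib]; ring
    rw [e2]
    have h4 := abs_sub_abs_le_abs_sub (φ 0 a') (∑ i, (g 0 a' i - P i a') * (w i:ℝ))
    set Y := c1 * (1/2^m/4^l0 : ℝ)^l0 with hY
    have hY0 : 0 ≤ Y := by positivity
    have h5 : nw * Y ≤ |φ 0 a'| := by
      refine le_trans ?_ h1
      rw [hY]
      calc nw * (c1 * (1/2^m/4^l0 : ℝ)^l0) = c1 * nw * (1/2^m/4^l0 : ℝ)^l0 := by ring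
        _ ≤ _ := by gcongr
    have h6 : nw * (Fintype.card ι * er) ≤ nw * (Y/2) := by gcongr
    have h7 : Y/2 ≤ nw * (Y/2) := by nlinarith
    linarith

end L

set_option maxHeartbeats 800000 in
theorem global_count (n : ℕ) (B : ℕ → ℝ) (hB : ∀ l, 0 ≤ B l) (c1 : ℝ) (hc1 : 0 < c1) (l0 : ℕ)
    (ε0 : ℝ) (hε : 0 < ε0) (hε1 : ε0 ≤ 1) :
    ∃ (A σ : ℝ) (N0 : ℕ), 0 < A ∧ 0 < σ ∧ ∀ (ι : Type) [Fintype ι] [DecidableEq ι],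
    Fintype.card ι = n → ∀ (r : ι → ℝ) (p : ι) (g : ℕ → ℝ → ι → ℝ), CD B c1 l0 g →
    (∀ c, ε0 ≤ r c) → ∑ c, r c = 1 → (∀ c, r c ≤ r p) → ∀ (η : ℝ), η = ε0 / (16 * (n + 1)) →
    ∀ N i : ℕ, 8 * i ≤ N → N < 16 * i → N0 ≤ N →
    (cnt (ES g r p η N i) (N - i) 0 0 : ℝ≥0∞)
      ≤ ENNReal.ofReal (A * (2:ℝ)^(-(σ * N))) * 2^(N - i) := by
  obtain ⟨Q, hQ2, hQ⟩ : ∃ Q : ℕ, 2 ≤ Q ∧ (l0:ℝ)/Q ≤ ε0/4 := by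
    obtain ⟨Q, hQ⟩ := exists_nat_gt (4 * l0 / ε0)
    refine ⟨Q + 2, by omega, ?_⟩
    rw [div_lt_iff₀ hε] at hQ
    push_cast
    rw [div_le_iff₀ (by positivity)]
    nlinarith
  obtain ⟨K, α, hK, hα, hα1, hcount⟩ := count_poly n (2*Q-1) B hB c1 (B (2*Q)) hc1 (hB _)
  set c' := c1 * (1/4^l0)^l0 with hc'
  have hc'0 : 0 < c' := by positivity
  obtain ⟨N1, hN1⟩ : ∃ N1 : ℕ, ∀ N ≥ N1, n * B (2*Q) * (2:ℝ)^(-((N:ℝ)/2)) ≤ c'/2 := by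
    have h1 : Filter.Tendsto (fun N : ℕ => n * B (2*Q) * (2:ℝ)^(-((N:ℝ)/2))) Filter.atTop (nhds (n * B (2*Q) * 0)) := by
      refine Filter.Tendsto.const_mul _ ?_
      have h2 : Filter.Tendsto (fun N : ℕ => ((2:ℝ)^(-(1/2):ℝ))^N) Filter.atTop (nhds 0) :=
        tendsto_pow_atTop_nhds_zero_of_lt_one (by positivity)
          (Real.rpow_lt_one_of_one_lt_of_neg one_lt_two (by norm_num))
      refine h2.congr fun N => ?_
      rw [← Real.rpow_natCast, ← Real.rpow_mul two_pos.le]; congr 1; ring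
    rw [mul_zero] at h1
    have := h1.eventually (ge_mem_nhds (show (0:ℝ) < c'/2 by positivity))
    exact Filter.eventually_atTop.1 this
  set cc := min 1 (min (c'/2) c1) with hcc
  have hcc0 : 0 < cc := by positivity
  set η0 := ε0 / (16 * ((n:ℝ) + 1)) with hη0
  have hη0p : 0 < η0 := by positivity
  refine ⟨K * (1/cc)^α, α * (η0 / 2), max N1 Q, by positivity, by positivity, ?_⟩
  intro ι _ _ hcard r p g hg hr hsum hrp η hη N i hiN hNi hN0
  have hr0 : ∀ c, 0 < r c := fun c => hε.trans_le (hr c)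
  have hN1' := hN1 N ((le_max_left _ _).trans hN0)
  have hNQ : Q ≤ N := (le_max_right _ _).trans hN0
  set m := N / Q with hm
  have hmQ : m * Q ≤ N := Nat.div_mul_le_self N Q
  have hmQ2 : N ≤ m * (2 * Q) := by
    have h1 : 1 ≤ m := by rw [hm]; exact (Nat.one_le_div_iff (by omega)).2 hNQ
    have h2 : N < (m + 1) * Q := by rw [hm]; exact (Nat.div_lt_iff_lt_mul (by omega)).1 (Nat.lt_succ_self _)
    nlinarith
  have hmi : i ≤ m * (2*Q-1) := by
    have : m * Q ≤ m * (2*Q-1) := Nat.mul_le_mul_left _ (by omega)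
    have : m * (2*Q) = 2 * (m * Q) := by ring
    omega
  have hmN : 2 * m ≤ N := by nlinarith
  have hml : (2:ℝ)^(-(ε0 * N/4)) ≤ (1/2^m)^l0 := by
    rw [one_div, ← Real.rpow_natCast 2 m, ← Real.rpow_neg two_pos.le, ← Real.rpow_natCast _ l0,
      ← Real.rpow_mul two_pos.le]
    apply Real.rpow_le_rpow_of_exponent_le one_le_two
    have h1 : (m:ℝ) ≤ N/Q := by
      rw [le_div_iff₀ (by positivity)]; exact_mod_cast hmQ
    have h2 : (m:ℝ) * l0 ≤ ε0 * N / 4 := by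
      calc (m:ℝ) * l0 ≤ N/Q * l0 := by gcongr
        _ = N * (l0/Q) := by ring
        _ ≤ N * (ε0/4) := by gcongr
        _ = _ := by ring
    linarith
  have hkey : ∀ j0 < 2^m, (cnt (ES g r p η N i) (N - i) m j0 : ℝ≥0∞)
      ≤ ENNReal.ofReal (K * ((2:ℝ)^(η * i) / (cc * (2:ℝ)^(η * N)))^α) * 2^(N - i - m) := by
    intro j0 hj0
    have hab : (j0:ℝ)/2^m ≤ ((j0:ℝ)+1)/2^m := by gcongr; linarith
    have hxc : (j0:ℝ)/2^m ∈ Dy m j0 := ⟨le_rfl, hab⟩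
    have hT := fun c => taylor_poly (2*Q-1) (fun q t => g q t c) ((j0:ℝ)/2^m) (((j0:ℝ)+1)/2^m) (B (2*Q))
      ((j0:ℝ)/2^m) hxc (hB _) (fun q t ht => hg.der q t (Dy_unit m j0 hj0 ht) c)
      (fun t ht => by
        have := hg.bd (2*Q) t (Dy_unit m j0 hj0 ht) c
        have e : 2*Q-1+1 = 2*Q := by omega
        rw [e]; exact this)
    choose P hPd hPx hPx' hPt hPt' using hT
    have hdist : ∀ t ∈ Dy m j0, |t - (j0:ℝ)/2^m| ≤ 1/2^m := by
      intro t ht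
      have e3 := ht.1; have e4 := ht.2
      rw [add_div] at e4
      have : (0:ℝ) < 1/2^m := by positivity
      rw [abs_le]; constructor <;> linarith
    have hE0 : ∀ t ∈ Dy m j0, ∀ c, |g 0 t c - (P c).eval t| ≤ B (2*Q) / 2^N := by
      intro t ht c
      refine (hPt c t ht).trans ?_
      rw [div_eq_mul_one_div (B (2*Q))]
      refine mul_le_mul_of_nonneg_left ?_ (hB _)
      calc _ ≤ (1/2^m : ℝ)^(2*Q-1+1) := by gcongr; exact hdist t ht
        _ = 1/2^(m * (2*Q)) := by
          rw [div_pow, one_pow, ← pow_mul]; congr 3; omega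
        _ ≤ 1/2^N := by
          apply one_div_le_one_div_of_le (by positivity)
          exact pow_le_pow_right₀ one_le_two hmQ2
    refine hcount ι hcard r p l0 g hg (hr0 p) hrp η N i m j0 (by omega) (by omega) hj0 P hPd hE0 ?_
      (cc * (2:ℝ)^(η * N)) (by positivity) ?_
    · intro t ht c
      refine (hPt' c (by omega) t ht).trans ?_
      rw [div_eq_mul_one_div (B (2*Q))]
      refine mul_le_mul_of_nonneg_left ?_ (hB _)
      calc _ ≤ (1/2^m : ℝ)^(2*Q-1) := by gcongr; exact hdist t ht
        _ = 1/2^(m * (2*Q-1)) := by rw [div_pow, one_pow, ← pow_mul]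
        _ ≤ 1/2^i := by
          apply one_div_le_one_div_of_le (by positivity)
          exact pow_le_pow_right₀ one_le_two hmi
    · intro k hk s hs
      have hkn : k ≤ n + 1 := by have := LI_card s hs; omega
      have hρk : (cc * (2:ℝ)^(η * N))^k ≤ cc * (2:ℝ)^(ε0 * N / 16) := by
        rw [mul_pow, ← Real.rpow_natCast ((2:ℝ)^(η*N)), ← Real.rpow_mul two_pos.le]
        gcongr
        · calc cc^k ≤ cc^1 := pow_le_pow_of_le_one hcc0.le (min_le_left _ _) hk
            _ = cc := pow_one _
        · norm_num
        · have hk' : (k:ℝ) ≤ n + 1 := by exact_mod_cast hkn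
          calc η * N * k ≤ η * N * (n+1) := by rw [hη]; gcongr
            _ = _ := by rw [hη, hη0]; field_simp
      by_cases hcase : ∃ S : Fin k → Option ι, minor (cst s) S ≠ 0 ∧
          ¬ ((∃ l, S l = none) ∧ ∃ l, S l = some p)
      · obtain ⟨S, hS, hmiss⟩ := hcase
        obtain ⟨σ, i1, w0, w, hinj, hi1, hoff, hw, hval⟩ := case_one p hk s S hS hmiss
        have hY : c' * (2:ℝ)^(-(ε0 * N/4)) ≤ c1 * (1/2^m/4^l0)^l0 := by
          have e : c1 * (1/2^m/4^l0 : ℝ)^l0 = c' * (1/2^m)^l0 := by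
            rw [hc', mul_assoc, ← mul_pow]; congr 2; field_simp
          rw [e]; gcongr
        obtain ⟨x, hx, hxv⟩ := case1_val B c1 hc1 l0 g hg m j0 hj0 (fun c t => (P c).eval t)
          (B (2*Q) / 2^N) hE0 (by
            rw [hcard]
            have e : (1:ℝ)/2^N = (2:ℝ)^(-((N:ℝ)/2)) * (2:ℝ)^(-((N:ℝ)/2)) := by
              rw [← Real.rpow_add two_pos, show -((N:ℝ)/2) + -((N:ℝ)/2) = -(N:ℝ) by ring,
                Real.rpow_neg two_pos.le, Real.rpow_natCast]; simp
            calc (n:ℝ) * (B (2*Q) / 2^N) = n * B (2*Q) * (2:ℝ)^(-((N:ℝ)/2)) * (2:ℝ)^(-((N:ℝ)/2)) := by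
                  rw [mul_assoc, ← e]; ring
              _ ≤ c'/2 * (2:ℝ)^(-(ε0 * N/4)) := by
                  have : (0:ℝ) ≤ N := by positivity
                  exact mul_le_mul hN1' (Real.rpow_le_rpow_of_exponent_le one_le_two (by nlinarith))
                    (by positivity) (by positivity)
              _ ≤ _ := by linarith) w0 w hw
        refine ⟨x, hx, ?_⟩
        refine le_trans ?_ (le_psi _ σ)
        rw [minor_weight, hval, abs_mul, abs_of_pos (Finset.prod_pos fun l _ => wt_pos _ _ _ _ _)]
        have hwt := case1_wt r p ε0 hε hr hsum N i σ i1 hinj hi1 hoff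
        have hmin : cc * (2:ℝ)^(-(ε0 * N/4)) ≤ min 1 (c1 * (1/2^m/4^l0)^l0 / 2) := by
          apply le_min
          · have : (2:ℝ)^(-(ε0 * N/4)) ≤ 1 :=
              Real.rpow_le_one_of_one_le_of_nonpos one_le_two (by
                have : 0 ≤ ε0 * N / 4 := by positivity
                linarith)
            have h1 : cc ≤ 1 := min_le_left _ _
            calc _ ≤ (1:ℝ) * 1 := by gcongr
              _ = 1 := one_mul _
          · have h1 : cc ≤ c'/2 := (min_le_right _ _).trans (min_le_left _ _)
            calc _ ≤ c'/2 * (2:ℝ)^(-(ε0 * N/4)) := by gcongr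
              _ ≤ _ := by linarith
        calc _ ≤ cc * (2:ℝ)^(ε0 * N / 16) := hρk
          _ ≤ cc * ((2:ℝ)^(ε0 * N / 2) * (2:ℝ)^(-(ε0 * N/4))) := by
              rw [← Real.rpow_add two_pos]
              gcongr
              · norm_num
              · have : 0 ≤ ε0 * N := by positivity
                linarith
          _ = (2:ℝ)^(ε0 * N / 2) * (cc * (2:ℝ)^(-(ε0 * N/4))) := by ring
          _ ≤ _ := mul_le_mul hwt (hmin.trans hxv) (by positivity)
                (Finset.prod_nonneg fun l _ => (wt_pos _ _ _ _ _).le)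
      · push Not at hcase
        obtain ⟨S, hS⟩ := exists_minor_ne _ hs
        refine ⟨(j0:ℝ)/2^m, hxc, ?_⟩
        have h2 := case2_low r p hr0 hsum N i (fun c => (P c).eval ((j0:ℝ)/2^m))
          (fun c => (P c).derivative.eval ((j0:ℝ)/2^m)) c1 hc1 (by
            rw [hPx' p (by omega)]
            exact hg.lo _ (Dy_unit m j0 hj0 hxc) p) s (fun S hS => hcase S hS) S hS
        refine hρk.trans (le_trans ?_ h2)
        have h1 : cc ≤ c1 := (min_le_right _ _).trans (min_le_right _ _)
        rw [← Real.rpow_natCast 2 i]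
        gcongr
        · norm_num
        · have : (N:ℝ) ≤ 16 * i := by exact_mod_cast hNi.le
          have hi0 : (0:ℝ) ≤ i := by positivity
          nlinarith
  rw [← cnt_subdiv _ (N-i) m (by omega)]
  push_cast
  calc _ ≤ ∑ j ∈ Finset.range (2^m), ENNReal.ofReal (K * ((2:ℝ)^(η * i) / (cc * (2:ℝ)^(η * N)))^α)
        * 2^(N - i - m) := Finset.sum_le_sum fun j hj => hkey j (Finset.mem_range.1 hj)
    _ = ENNReal.ofReal (K * ((2:ℝ)^(η * i) / (cc * (2:ℝ)^(η * N)))^α) * 2^(N - i) := by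
        rw [Finset.sum_const, Finset.card_range, nsmul_eq_mul]
        push_cast
        have : (2:ℝ≥0∞)^(N-i) = 2^m * 2^(N-i-m) := by rw [← pow_add]; congr 1; omega
        rw [this]; ring
    _ ≤ _ := by
        gcongr ?_ * _
        apply ENNReal.ofReal_le_ofReal
        rw [mul_assoc]
        gcongr
        rw [show -(α * (η0/2) * (N:ℝ)) = (-(η0/2 * N)) * α by ring, Real.rpow_mul two_pos.le (-(η0/2 * N)) α,
          ← Real.mul_rpow (by positivity) (by positivity)]
        gcongr
        have e : (2:ℝ)^(η * i) / (cc * (2:ℝ)^(η * N)) = 1/cc * (2:ℝ)^(η * i - η * N) := by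
          rw [Real.rpow_sub two_pos]; field_simp
        rw [e]
        gcongr
        · norm_num
        · have h1 : 8 * (i:ℝ) ≤ N := by exact_mod_cast hiN
          rw [hη]
          nlinarith

end BM


set_option linter.unusedSectionVars false
set_option linter.unusedVariables false
namespace BM

variable {ι : Type} [Fintype ι] [DecidableEq ι]

/-- the dual non-approximability obtained from avoiding the sets `ES` -/
lemma dual_of_avoid (r : ι → ℝ) (p : ι) (hr : ∀ c, 0 < r c) (hrp : ∀ c, r c ≤ r p)
    (y z : ι → ℝ) (B1 : ℝ) (hB1 : 0 ≤ B1) (hz : ∀ i, |z i| ≤ B1) (η : ℝ) (hη : 0 ≤ η) (N0 i0 : ℕ)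
    (h : ∀ N, N0 ≤ N → ¬ ∃ a : Option ι → ℤ, a ≠ 0 ∧
      ∀ c, wt r p N i0 c * |∑ b, Lm p y z c b * (a b : ℝ)| < (2:ℝ)^(η * i0)) :
    ∃ δ : ℝ, 0 < δ ∧ δ ≤ 1 ∧ ∀ N, N0 ≤ N → ∀ a : Option ι → ℤ, a ≠ 0 →
      |(a none : ℝ) + ∑ i, y i * a (some i)| ≤ δ * (2:ℝ)^(-((N:ℝ)/(1 + r p))) →
      (∀ c, |(a (some c) : ℝ)| ≤ δ * (2:ℝ)^(r c * ((N:ℝ)/(1 + r p)))) → False := by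
  set D : ℝ := 1 + 2^i0 * (Fintype.card ι * B1) with hD
  have hD1 : 1 ≤ D := by rw [hD]; linarith [show 0 ≤ (2:ℝ)^i0 * (Fintype.card ι * B1) by positivity]
  refine ⟨1/(2*D), by positivity, by rw [div_le_one (by positivity)]; linarith, ?_⟩
  set δ := 1/(2*D) with hδ
  have hδ0 : 0 < δ := by positivity
  have hδ1 : δ < 1 := by rw [hδ, div_lt_one (by positivity)]; linarith
  have hone : 1 ≤ (2:ℝ)^(η * i0) := Real.one_le_rpow one_le_two (by positivity)
  intro N hN a ha h0 hc
  apply h N hN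
  refine ⟨a, ha, ?_⟩
  have hτ : 0 ≤ (N:ℝ)/(1 + r p) := by have := hr p; positivity
  set τ := (N:ℝ)/(1 + r p) with hτd
  intro c
  refine lt_of_lt_of_le ?_ hone
  rcases c with _ | c
  · rw [Lm_none]
    have e : wt r p N i0 none = (2:ℝ)^τ := rfl
    rw [e]
    calc _ ≤ (2:ℝ)^τ * (δ * (2:ℝ)^(-τ)) := by gcongr
      _ = δ := by rw [Real.rpow_neg two_pos.le]; field_simp
      _ < 1 := hδ1
  · by_cases hcp : c = p
    · subst hcp
      rw [Lm_p]
      have e : wt r c N i0 (some c) = 2^i0 * (2:ℝ)^(-(r c) * τ) := by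
        unfold wt; simp only [wex, if_true]
        rw [Real.rpow_add two_pos, Real.rpow_natCast, mul_comm]
      rw [e]
      have hs : |∑ i, z i * (a (some i) : ℝ)| ≤ ∑ i : ι, B1 * (δ * (2:ℝ)^(r c * τ)) := by
        refine (Finset.abs_sum_le_sum_abs _ _).trans (Finset.sum_le_sum fun i _ => ?_)
        rw [abs_mul]
        apply mul_le_mul (hz i) _ (abs_nonneg _) hB1
        refine (hc i).trans ?_
        apply mul_le_mul_of_nonneg_left _ hδ0.le
        apply Real.rpow_le_rpow_of_exponent_le one_le_two
        exact mul_le_mul_of_nonneg_right (hrp i) hτ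
      calc _ ≤ 2^i0 * (2:ℝ)^(-(r c) * τ) * (∑ i : ι, B1 * (δ * (2:ℝ)^(r c * τ))) := by gcongr
        _ = 2^i0 * (Fintype.card ι * B1) * δ := by
          rw [Finset.sum_const, Finset.card_univ, nsmul_eq_mul, neg_mul, Real.rpow_neg two_pos.le]
          field_simp
        _ ≤ D * δ := by gcongr; rw [hD]; linarith
        _ = 1/2 := by rw [hδ]; field_simp
        _ < 1 := by norm_num
    · rw [Lm_i _ _ _ _ _ hcp]
      have e : wt r p N i0 (some c) = (2:ℝ)^(-(r c) * τ) := by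
        unfold wt; simp only [wex, hcp, if_false, add_zero]; rfl
      rw [e]
      calc _ ≤ (2:ℝ)^(-(r c) * τ) * (δ * (2:ℝ)^(r c * τ)) := by gcongr; exact hc c
        _ = δ := by rw [neg_mul, Real.rpow_neg two_pos.le]; field_simp
        _ < 1 := hδ1

/-- transference: dual bad implies simultaneously bad -/
lemma bad_of_dual (r : ι → ℝ) (p : ι) (ε0 : ℝ) (hε : 0 < ε0) (hr : ∀ c, ε0 ≤ r c) (hsum : ∑ c, r c = 1)
    (y : ι → ℝ) (N0 : ℕ) (δ : ℝ) (hδ0 : 0 < δ) (hδ1 : δ ≤ 1)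
    (h : ∀ N, N0 ≤ N → ∀ a : Option ι → ℤ, a ≠ 0 →
      |(a none : ℝ) + ∑ i, y i * a (some i)| ≤ δ * (2:ℝ)^(-((N:ℝ)/(1 + r p))) →
      (∀ c, |(a (some c) : ℝ)| ≤ δ * (2:ℝ)^(r c * ((N:ℝ)/(1 + r p)))) → False) :
    ∃ c : ℝ, 0 < c ∧ ∀ q : ℕ, 1 ≤ q → ∀ P : ι → ℤ, ∃ i, (c / q)^(r i) ≤ |q * y i - P i| := by
  have hn1 : 1 ≤ Fintype.card ι := Fintype.card_pos_iff.2 ⟨p⟩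
  set n := Fintype.card ι with hn
  have hrp0 : 0 < r p := hε.trans_le (hr p)
  have hrp1 : 0 < 1 + r p := by linarith
  have hn1' : (1:ℝ) ≤ n := by exact_mod_cast hn1
  set K : ℝ := 2 * 2^N0 / δ^n with hK
  have hδn : δ^n ≤ 1 := pow_le_one₀ hδ0.le hδ1
  have h2N : (1:ℝ) ≤ 2^N0 := one_le_pow₀ one_le_two
  have hK1 : 1 ≤ K := by
    rw [hK, le_div_iff₀ (by positivity)]; linarith
  set c : ℝ := (1/(n*K))^(1/ε0) / K with hc
  have hc0 : 0 < c := by positivity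
  have hKc : K * c = (1/(n*K))^(1/ε0) := by rw [hc]; field_simp
  have hnK : 1/(n*K) ≤ 1 := by
    rw [div_le_one (by positivity)]; nlinarith
  have hKc1 : K * c ≤ 1 := by
    rw [hKc]; exact Real.rpow_le_one (by positivity) hnK (by positivity)
  refine ⟨c, hc0, ?_⟩
  intro q hq P
  by_contra! hcon
  have hq1 : (1:ℝ) ≤ q := by exact_mod_cast hq
  set Z : ℝ := q * 2^N0 / δ^n with hZ
  have hZ1 : 2^N0 ≤ Z := by
    rw [hZ, le_div_iff₀ (by positivity)]
    nlinarith
  have hZ0 : 0 < Z := by linarith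
  set N := ⌈(1 + r p) * Real.logb 2 Z⌉₊ with hNdef
  have hN1 : (1 + r p) * Real.logb 2 Z ≤ N := Nat.le_ceil _
  have hlog : (N0:ℝ) ≤ Real.logb 2 Z := by
    rw [Real.le_logb_iff_rpow_le one_lt_two hZ0, Real.rpow_natCast]; exact hZ1
  have hN2 : (N:ℝ) < (1 + r p) * Real.logb 2 Z + 1 := Nat.ceil_lt_add_one (by
    have : (0:ℝ) ≤ N0 := by positivity
    nlinarith)
  have hNN0 : N0 ≤ N := by
    have : (N0:ℝ) ≤ N := by
      have : (0:ℝ) ≤ N0 := by positivity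
      nlinarith
    exact_mod_cast this
  set τ := (N:ℝ)/(1 + r p) with hτ
  have hτ1 : Real.logb 2 Z ≤ τ := by rw [hτ, le_div_iff₀ hrp1]; linarith
  have hτ2 : τ ≤ Real.logb 2 Z + 1 := by rw [hτ, div_le_iff₀ hrp1]; nlinarith
  set X : ℝ := (2:ℝ)^τ with hX
  have hX0 : 0 < X := by positivity
  have hX1 : Z ≤ X := by
    rw [hX, ← Real.logb_le_iff_le_rpow one_lt_two hZ0]; exact hτ1
  have hX2 : X ≤ K * q := by
    calc X ≤ (2:ℝ)^(Real.logb 2 Z + 1) := Real.rpow_le_rpow_of_exponent_le one_le_two hτ2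
      _ = Z * 2 := by
        rw [Real.rpow_add two_pos, Real.rpow_logb two_pos (by norm_num) hZ0, Real.rpow_one]
      _ = K * q := by rw [hZ, hK]; ring
  have hXr : ∀ i, (2:ℝ)^(r i * τ) = X^(r i) := by
    intro i; rw [hX, ← Real.rpow_mul two_pos.le, mul_comm]
  -- pigeonhole
  set A : ι → ℕ := fun i => ⌊δ * X^(r i)⌋₊ with hA
  have hAle : ∀ i, (A i : ℝ) ≤ δ * X^(r i) := fun i => Nat.floor_le (by positivity)
  have hcard : q < Fintype.card (∀ i : ι, Fin (A i + 1)) := by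
    rw [Fintype.card_pi]
    simp only [Fintype.card_fin]
    have h1 : (q:ℝ) < ∏ i, ((A i : ℝ) + 1) := by
      calc (q:ℝ) ≤ δ^n * X := by
            calc (q:ℝ) ≤ q * 2^N0 := by nlinarith
              _ = δ^n * Z := by rw [hZ]; field_simp
              _ ≤ _ := by gcongr
        _ = ∏ i, (δ * X^(r i)) := by
            rw [Finset.prod_mul_distrib, Finset.prod_const, Finset.card_univ, ← hn,
              ← Real.rpow_sum_of_pos hX0, hsum, Real.rpow_one]
        _ < _ := by
            apply Finset.prod_lt_prod_of_nonempty
            · intro i _; positivity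
            · intro i _; exact Nat.lt_floor_add_one _
            · exact ⟨p, Finset.mem_univ _⟩
    exact_mod_cast h1
  have : NeZero q := ⟨by omega⟩
  obtain ⟨u, v, huv, he⟩ := Fintype.exists_ne_map_eq_of_card_lt
    (fun u : (∀ i : ι, Fin (A i + 1)) => ((∑ i, ((u i : ℕ) : ℤ) * P i : ℤ) : ZMod q))
    (by rw [ZMod.card]; exact hcard)
  rw [ZMod.intCast_eq_intCast_iff_dvd_sub] at he
  obtain ⟨k, hk⟩ := he
  set a : Option ι → ℤ := fun o => match o with
    | none => -k
    | some i => ((v i : ℕ) : ℤ) - ((u i : ℕ) : ℤ) with ha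
  have hasome : ∀ i, a (some i) = ((v i : ℕ) : ℤ) - ((u i : ℕ) : ℤ) := fun i => rfl
  have hanone : a none = -k := rfl
  have hab : ∀ i, |(a (some i) : ℝ)| ≤ δ * X^(r i) := by
    intro i
    refine le_trans ?_ (hAle i)
    rw [hasome]
    have h1 : ((v i : ℕ):ℝ) ≤ A i := by exact_mod_cast Nat.lt_succ_iff.1 (v i).2
    have h2 : ((u i : ℕ):ℝ) ≤ A i := by exact_mod_cast Nat.lt_succ_iff.1 (u i).2
    have h3 : (0:ℝ) ≤ ((v i : ℕ):ℝ) := by positivity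
    have h4 : (0:ℝ) ≤ ((u i : ℕ):ℝ) := by positivity
    push_cast
    rw [abs_le]; constructor <;> linarith
  apply h N hNN0 a
  · intro h0
    apply huv
    funext i
    have := congrFun h0 (some i)
    rw [hasome] at this
    simp only [Pi.zero_apply] at this
    apply Fin.ext
    omega
  · have hrel : (q:ℝ) * ((a none : ℝ) + ∑ i, y i * a (some i)) = ∑ i, (q * y i - P i) * a (some i) := by
      have hk' : (∑ i, (a (some i):ℝ) * P i) = q * k := by
        have : (∑ i, a (some i) * P i) = q * k := by
          rw [← hk, ← Finset.sum_sub_distrib]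
          exact Finset.sum_congr rfl fun i _ => by rw [hasome]; ring
        exact_mod_cast this
      have e : ∑ i, (q * y i - P i) * (a (some i):ℝ) = q * ∑ i, y i * a (some i) - ∑ i, (a (some i):ℝ) * P i := by
        rw [Finset.mul_sum, ← Finset.sum_sub_distrib]
        exact Finset.sum_congr rfl fun i _ => by ring
      rw [e, hk', hanone]; push_cast; ring
    have hb : |∑ i, (q * y i - P i) * (a (some i):ℝ)| ≤ δ / K := by
      calc _ ≤ ∑ i : ι, δ * (1/(n*K)) := by
            refine (Finset.abs_sum_le_sum_abs _ _).trans (Finset.sum_le_sum fun i _ => ?_)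
            rw [abs_mul]
            calc _ ≤ (c/q)^(r i) * (δ * X^(r i)) :=
                  mul_le_mul (hcon i).le (hab i) (abs_nonneg _) (by positivity)
              _ = δ * (c / q * X)^(r i) := by
                  rw [Real.mul_rpow (by positivity) hX0.le]; ring
              _ ≤ δ * (K * c)^(r i) := by
                  apply mul_le_mul_of_nonneg_left _ hδ0.le
                  apply Real.rpow_le_rpow (by positivity) _ (hε.le.trans (hr i))
                  calc c / q * X ≤ c / q * (K * q) := by gcongr
                    _ = K * c := by field_simp
              _ ≤ δ * (K * c)^ε0 := by
                  apply mul_le_mul_of_nonneg_left _ hδ0.le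
                  exact Real.rpow_le_rpow_of_exponent_ge (by positivity) hKc1 (hr i)
              _ = δ * (1/(n*K)) := by
                  rw [hKc, ← Real.rpow_mul (by positivity), one_div_mul_cancel hε.ne', Real.rpow_one]
        _ = δ / K := by
            rw [Finset.sum_const, Finset.card_univ, nsmul_eq_mul, ← hn]; field_simp
    rw [← hrel, abs_mul, abs_of_pos (by linarith : (0:ℝ) < q)] at hb
    rw [Real.rpow_neg two_pos.le]
    have hqX : δ / K / q ≤ δ * X⁻¹ := by
      rw [div_div, ← div_eq_mul_inv]; gcongr
    refine le_trans ?_ hqX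
    rw [le_div_iff₀ (by linarith)]; linarith
  · intro i; rw [hXr]; exact hab i

lemma sum_pos_sub {n : ℕ} (r : Fin n → ℝ) (hW : r ∈ Weights n) : ∑ c : {i // 0 < r i}, r c = 1 := by
  rw [← hW.1, ← Finset.sum_subtype (Finset.univ.filter fun i => 0 < r i) (by simp) r, Finset.sum_filter]
  refine Finset.sum_congr rfl fun i _ => ?_
  split_ifs with hi
  · rfl
  · exact (le_antisymm (not_lt.1 hi) (hW.2 i)).symm

/-- avoiding the sets gives membership in `BadSet` -/
theorem bad_of_avoid {n : ℕ} (r : Fin n → ℝ) (ε0 : ℝ) (hε : 0 < ε0) (hW : r ∈ Weights n)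
    (hr : ∀ i, 0 < r i → ε0 ≤ r i) (p : {i // 0 < r i}) (hrp : ∀ c, r c ≤ r p)
    (y z : {i // 0 < r i} → ℝ) (B1 : ℝ) (hB1 : 0 ≤ B1) (hz : ∀ i, |z i| ≤ B1)
    (η : ℝ) (hη : 0 ≤ η) (N0 i0 : ℕ)
    (h : ∀ N, N0 ≤ N → ¬ ∃ a : Option {i // 0 < r i} → ℤ, a ≠ 0 ∧
      ∀ c, wt (fun i : {i // 0 < r i} => r i) p N i0 c * |∑ b, Lm p y z c b * (a b : ℝ)| < (2:ℝ)^(η * i0))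
    (Y : EuclideanSpace ℝ (Fin n)) (hY : ∀ i : {i // 0 < r i}, Y i.1 = y i) : Y ∈ BadSet r := by
  obtain ⟨δ, h0, h1, h2⟩ := dual_of_avoid (fun i : {i // 0 < r i} => r i) p (fun c => c.2) (fun c => hrp c)
    y z B1 hB1 hz η hη N0 i0 h
  have hsum := sum_pos_sub r hW
  obtain ⟨c, hc, hbad⟩ := bad_of_dual (fun i : {i // 0 < r i} => r i) p ε0 hε (fun c => hr c c.2) hsum
    y N0 δ h0 h1 h2
  refine ⟨c, hc, ?_⟩
  intro q hq
  have hq0 : (0:ℝ) < q := by exact_mod_cast hq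
  by_contra! hcon
  have : ∀ i : {i // 0 < r i}, ∃ P : ℤ, |q * y i - P| < (c/q)^(r i) := by
    intro i
    have h3 := hcon i.1
    rw [badPow, if_neg i.2.ne', hY i, one_div] at h3
    have hd0 : 0 ≤ distNearestInt (q * y i) := Real.iInf_nonneg fun _ => abs_nonneg _
    have h4 : distNearestInt (q * y i) < (c/q)^(r i.1) := by
      rw [← div_eq_mul_inv] at h3
      calc distNearestInt (q * y i) = ((distNearestInt (q * y i))^((r i.1)⁻¹))^(r i.1) := by
            rw [← Real.rpow_mul hd0, inv_mul_cancel₀ i.2.ne', Real.rpow_one]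
        _ < _ := Real.rpow_lt_rpow (Real.rpow_nonneg hd0 _) h3 i.2
    exact exists_lt_of_ciInf_lt h4
  choose P hP using this
  obtain ⟨i, hi⟩ := hbad q hq P
  exact absurd (hP i) (not_lt.2 hi)

end BM


set_option linter.unusedSectionVars false
set_option linter.unusedVariables false
namespace BM

lemma wf_avoid (S : ℕ → ℕ → Set ℝ) (i0 : ℕ) (hi0 : 1 ≤ i0) (x : ℝ)
    (hloc : ∀ N i, i0 ≤ i → 16 * i ≤ N → x ∉ S N i \ (S N (2*i) ∪ S (N-i) i))
    (hglob : ∀ N i, i0 ≤ i → 8 * i ≤ N → N < 16 * i → x ∉ S N i) :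
    ∀ N i, i0 ≤ i → 8 * i ≤ N → x ∉ S N i := by
  have key : ∀ k N i, N + (N - i) ≤ k → i0 ≤ i → 8 * i ≤ N → x ∉ S N i := by
    intro k
    induction k with
    | zero => intro N i hk h1 h2; omega
    | succ k ih =>
      intro N i hk h1 h2 hx
      by_cases h3 : N < 16 * i
      · exact hglob N i h1 h2 h3 hx
      · push Not at h3
        apply hloc N i h1 h3
        refine ⟨hx, ?_⟩
        rintro (h4 | h4)
        · exact ih N (2*i) (by omega) (by omega) (by omega) h4
        · exact ih (N-i) i (by omega) h1 (by omega) h4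
  intro N i
  exact key _ N i le_rfl

/-- the two counting estimates -/
def CountHyp (A σ : ℝ) (N0 : ℕ) (B : ℕ → ℝ) (c1 : ℝ) (l0 : ℕ) (ε0 : ℝ) (n : ℕ) : Prop :=
  ∀ (ι : Type) [Fintype ι] [DecidableEq ι], Fintype.card ι ≤ n →
    ∀ (r : ι → ℝ) (p : ι) (g : ℕ → ℝ → ι → ℝ), CD B c1 l0 g → (∀ c, ε0 ≤ r c) → ∑ c, r c = 1 →
    (∀ c, r c ≤ r p) →
    (∀ N i j0 : ℕ, 16 * i ≤ N → j0 < 2^(N - 4*i) →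
      (cnt (ES g r p (ε0/(16*((Fintype.card ι:ℝ)+1))) N i \ (ES g r p (ε0/(16*((Fintype.card ι:ℝ)+1))) N (2*i) ∪
        ES g r p (ε0/(16*((Fintype.card ι:ℝ)+1))) (N-i) i)) (N-i) (N-4*i) j0 : ℝ≥0∞)
        ≤ ENNReal.ofReal (A * (2:ℝ)^(-(σ * i))) * 2^(3*i)) ∧
    (∀ N i : ℕ, 8 * i ≤ N → N < 16 * i → N0 ≤ N →
      (cnt (ES g r p (ε0/(16*((Fintype.card ι:ℝ)+1))) N i) (N-i) 0 0 : ℝ≥0∞)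
        ≤ ENNReal.ofReal (A * (2:ℝ)^(-(σ * N))) * 2^(N-i))

lemma ofReal_mono_aux (A A' σ σ' : ℝ) (hA : A ≤ A') (hA0 : 0 ≤ A) (hσ : σ' ≤ σ) (x : ℕ) :
    ENNReal.ofReal (A * (2:ℝ)^(-(σ * x))) ≤ ENNReal.ofReal (A' * (2:ℝ)^(-(σ' * x))) := by
  apply ENNReal.ofReal_le_ofReal
  apply mul_le_mul hA _ (by positivity) (hA0.trans hA)
  apply Real.rpow_le_rpow_of_exponent_le one_le_two
  have : (0:ℝ) ≤ x := by positivity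
  nlinarith

lemma counts (B : ℕ → ℝ) (hB : ∀ l, 0 ≤ B l) (c1 : ℝ) (hc1 : 0 < c1) (l0 : ℕ) (ε0 : ℝ)
    (hε : 0 < ε0) (hε1 : ε0 ≤ 1) (n : ℕ) :
    ∃ (A σ : ℝ) (N0 : ℕ), 0 < A ∧ 0 < σ ∧ CountHyp A σ N0 B c1 l0 ε0 n := by
  have hone : ∀ k : ℕ, ∃ (A σ : ℝ) (N0 : ℕ), 0 < A ∧ 0 < σ ∧
      ∀ (ι : Type) [Fintype ι] [DecidableEq ι], Fintype.card ι = k →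
    ∀ (r : ι → ℝ) (p : ι) (g : ℕ → ℝ → ι → ℝ), CD B c1 l0 g → (∀ c, ε0 ≤ r c) → ∑ c, r c = 1 →
    (∀ c, r c ≤ r p) →
    (∀ N i j0 : ℕ, 16 * i ≤ N → j0 < 2^(N - 4*i) →
      (cnt (ES g r p (ε0/(16*((Fintype.card ι:ℝ)+1))) N i \ (ES g r p (ε0/(16*((Fintype.card ι:ℝ)+1))) N (2*i) ∪
        ES g r p (ε0/(16*((Fintype.card ι:ℝ)+1))) (N-i) i)) (N-i) (N-4*i) j0 : ℝ≥0∞)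
        ≤ ENNReal.ofReal (A * (2:ℝ)^(-(σ * i))) * 2^(3*i)) ∧
    (∀ N i : ℕ, 8 * i ≤ N → N < 16 * i → N0 ≤ N →
      (cnt (ES g r p (ε0/(16*((Fintype.card ι:ℝ)+1))) N i) (N-i) 0 0 : ℝ≥0∞)
        ≤ ENNReal.ofReal (A * (2:ℝ)^(-(σ * N))) * 2^(N-i)) := by
    intro k
    obtain ⟨A1, σ1, hA1, hσ1, h1⟩ := local_count k B hB c1 hc1 ε0 hε hε1
    obtain ⟨A2, σ2, N0, hA2, hσ2, h2⟩ := global_count k B hB c1 hc1 l0 ε0 hε hε1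
    refine ⟨max A1 A2, min σ1 σ2, N0, lt_max_of_lt_left hA1, lt_min hσ1 hσ2, ?_⟩
    intro ι _ _ hcard r p g hg hr hsum hrp
    constructor
    · intro N i j0 hN hj
      refine (h1 ι hcard r p l0 g hg hr hsum hrp _ (by rw [hcard]) N i j0 hN hj).trans ?_
      gcongr ?_ * _
      exact ofReal_mono_aux _ _ _ _ (le_max_left _ _) hA1.le (min_le_left _ _) _
    · intro N i hN1 hN2 hN3
      refine (h2 ι hcard r p g hg hr hsum hrp _ (by rw [hcard]) N i hN1 hN2 hN3).trans ?_
      gcongr ?_ * _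
      exact ofReal_mono_aux _ _ _ _ (le_max_right _ _) hA2.le (min_le_right _ _) _
  induction n with
  | zero =>
    obtain ⟨A, σ, N0, hA, hσ, h⟩ := hone 0
    exact ⟨A, σ, N0, hA, hσ, fun ι _ _ hc => h ι (by omega)⟩
  | succ n ih =>
    obtain ⟨A1, σ1, N1, hA1, hσ1, h1⟩ := ih
    obtain ⟨A2, σ2, N2, hA2, hσ2, h2⟩ := hone (n+1)
    refine ⟨max A1 A2, min σ1 σ2, max N1 N2, lt_max_of_lt_left hA1, lt_min hσ1 hσ2, ?_⟩
    intro ι _ _ hcard r p g hg hr hsum hrp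
    rcases Nat.lt_or_ge n (Fintype.card ι) with hlt | hle
    · obtain ⟨h3, h4⟩ := h2 ι (by omega) r p g hg hr hsum hrp
      constructor
      · intro N i j0 hN hj
        refine (h3 N i j0 hN hj).trans ?_
        gcongr ?_ * _
        exact ofReal_mono_aux _ _ _ _ (le_max_right _ _) hA2.le (min_le_right _ _) _
      · intro N i hN1 hN2 hN3
        refine (h4 N i hN1 hN2 ((le_max_right _ _).trans hN3)).trans ?_
        gcongr ?_ * _
        exact ofReal_mono_aux _ _ _ _ (le_max_right _ _) hA2.le (min_le_right _ _) _
    · obtain ⟨h3, h4⟩ := h1 ι hle r p g hg hr hsum hrp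
      constructor
      · intro N i j0 hN hj
        refine (h3 N i j0 hN hj).trans ?_
        gcongr ?_ * _
        exact ofReal_mono_aux _ _ _ _ (le_max_left _ _) hA1.le (min_le_left _ _) _
      · intro N i hN1 hN2 hN3
        refine (h4 N i hN1 hN2 ((le_max_left _ _).trans hN3)).trans ?_
        gcongr ?_ * _
        exact ofReal_mono_aux _ _ _ _ (le_max_left _ _) hA1.le (min_le_left _ _) _

/-- restriction of curve data to a subset of the coordinates -/
lemma CD_sub {n : ℕ} (B : ℕ → ℝ) (c1 : ℝ) (l0 : ℕ) (g : ℕ → ℝ → Fin n → ℝ) (hg : CD B c1 l0 g)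
    (P : Fin n → Prop) [DecidablePred P] :
    CD B c1 l0 (fun l t (i : {i // P i}) => g l t i) where
  der := fun l t ht i => hg.der l t ht i
  bd := fun l t ht i => hg.bd l t ht i
  lo := fun t ht i => hg.lo t ht i
  nd := by
    intro w hw1 hw2
    obtain ⟨l, hl1, hl2, h⟩ := hg.nd (fun i => if h : P i then w ⟨i, h⟩ else 0)
      (by intro i; split_ifs with h; exacts [hw1 _, by simp])
      (by obtain ⟨i, hi⟩ := hw2; exact ⟨i, by simp [i.2, hi]⟩)
    refine ⟨l, hl1, hl2, fun t ht => ?_⟩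
    have e : ∑ i : {i // P i}, w i * g l t i = ∑ i, (if h : P i then w ⟨i, h⟩ else 0) * g l t i := by
      have e1 : ∀ i, (if h : P i then w ⟨i, h⟩ else 0) * g l t i =
          if P i then (if h : P i then w ⟨i, h⟩ else 0) * g l t i else 0 := by
        intro i; split_ifs <;> simp
      rw [Finset.sum_congr rfl fun i _ => e1 i, ← Finset.sum_filter,
        Finset.sum_subtype (Finset.univ.filter P) (p := P) (by simp)]
      exact Finset.sum_congr rfl fun i _ => by simp [i.2]
    rw [e]; exact h t ht

lemma tail_small (f : ℕ → ℝ≥0∞) (hf : ∑' i, f i ≠ ⊤) (κ : ℝ≥0∞) (hκ : 0 < κ) (N : ℕ) :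
    ∃ j, N ≤ j ∧ ∑' i, (if j ≤ i then f i else 0) ≤ κ := by
  have h := ENNReal.tendsto_sum_nat_add f hf
  have h2 : ∀ᶠ j in Filter.atTop, ∑' k, f (k + j) < κ := h.eventually_lt_const hκ
  obtain ⟨j, hj1, hj2⟩ := (h2.and (Filter.eventually_ge_atTop N)).exists
  refine ⟨j, hj2, ?_⟩
  have := Summable.sum_add_tsum_nat_add' (f := fun i => (if j ≤ i then f i else 0)) (k := j)
    ENNReal.summable
  rw [← this, Finset.sum_eq_zero, zero_add]
  · refine le_trans (ENNReal.tsum_le_tsum fun i => ?_) hj1.le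
    simp
  · intro i hi
    rw [Finset.mem_range] at hi
    simp [hi]

end BM


set_option linter.unusedSectionVars false
set_option linter.unusedVariables false
namespace BM

lemma avoid_all (W : Type) [Countable W] (A σ s : ℝ) (hA : 0 < A) (hσ : 0 < σ) (hs0 : 0 < s) (hs1 : s < 1)
    (hsσ : 1 - s ≤ σ/8) (N0 : ℕ) :
    ∃ (c : ℝ) (i0 : W → ℕ), 0 < c ∧ (∀ k, N0 ≤ i0 k) ∧ ∀ (EL EG : W → ℕ → ℕ → Set ℝ),
      (∀ k N i j0, i0 k ≤ i → 16 * i ≤ N → j0 < 2^(N-4*i) → (cnt (EL k N i) (N-i) (N-4*i) j0 : ℝ≥0∞) ≤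
        ENNReal.ofReal (A * (2:ℝ)^(-(σ * (i:ℕ)))) * 2^(3*i)) →
      (∀ k N i, i0 k ≤ i → 8 * i ≤ N → N < 16 * i → (cnt (EG k N i) (N-i) 0 0 : ℝ≥0∞) ≤
        ENNReal.ofReal (A * (2:ℝ)^(-(σ * (N:ℕ)))) * 2^(N-i)) →
      ∀ (V : ℕ → Set ℝ) (d : ℕ → ℝ), (∀ l, 0 < d l) → (∀ l, d l ≤ 1) →
      (∀ l, ∀ x ∈ V l, ∀ y ∈ V l, |x - y| < d l) → (∑' l, ENNReal.ofReal (d l ^ s) < ENNReal.ofReal c) →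
      ∃ x ∈ Set.Icc (0:ℝ) 1, (∀ k N i, i0 k ≤ i → 16 * i ≤ N → x ∉ EL k N i) ∧
        (∀ k N i, i0 k ≤ i → 8 * i ≤ N → N < 16 * i → x ∉ EG k N i) ∧ ∀ l, x ∉ V l := by
  classical
  -- constants
  set T : ℝ := (2:ℝ)^(1-s) with hT
  have hT1 : 1 < T := Real.one_lt_rpow one_lt_two (by linarith)
  set θ' : ℝ := 1/2 / T with hθ'
  set ν : ℝ := 1/2 - θ' with hν
  have hθ'0 : 0 < θ' := by positivity
  have hν0 : 0 < ν := by
    rw [hν, hθ', sub_pos, div_lt_iff₀ (by positivity)]; linarith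
  set Y : ℝ := (2:ℝ)^(-(σ/4)) with hY
  have hY0 : 0 < Y := by positivity
  have hY1 : Y < 1 := Real.rpow_lt_one_of_one_lt_of_neg one_lt_two (by linarith)
  set G : ℝ≥0∞ := ∑' N : ℕ, (ENNReal.ofReal Y)^N with hG
  have hGt : G ≠ ⊤ := by
    rw [hG, ENNReal.tsum_geometric]
    apply ENNReal.inv_ne_top.2
    rw [Ne, tsub_eq_zero_iff_le, not_le, ← ENNReal.ofReal_one]
    exact (ENNReal.ofReal_lt_ofReal_iff one_pos).2 hY1
  set fA : ℝ≥0∞ := ENNReal.ofReal A * (1 + G) with hfA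
  have hfAt : fA ≠ ⊤ := ENNReal.mul_ne_top ENNReal.ofReal_ne_top (ENNReal.add_ne_top.2 ⟨ENNReal.one_ne_top, hGt⟩)
  obtain ⟨κ, hκ0, hκ⟩ := ENNReal.exists_pos_sum_of_countable
    (show ENNReal.ofReal (ν/2) ≠ 0 by simpa using hν0) W
  have htail : ∀ k : W, ∃ j, N0 ≤ j ∧ ∑' i, (if j ≤ i then fA * (ENNReal.ofReal Y)^i else 0) ≤ κ k := by
    intro k
    apply tail_small
    · rw [ENNReal.tsum_mul_left]; exact ENNReal.mul_ne_top hfAt hGt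
    · exact_mod_cast hκ0 k
  choose i0 hi0 hi0s using htail
  refine ⟨ν/16, i0, by positivity, hi0, ?_⟩
  intro EL EG hEL hEG V d hd0 hd1 hV hsum
  have hM : ∀ l, ∃ M : ℕ, (1/2:ℝ)^(M+1) < d l ∧ d l ≤ (1/2)^M := fun l =>
    exists_nat_pow_near_of_lt_one (hd0 l) (hd1 l) (by norm_num) (by norm_num)
  choose Mc hMc1 hMc2 using hM
  set q : ℝ≥0∞ := ENNReal.ofReal ((2:ℝ)^(-s)) with hq
  have h2q : 2 * q = ENNReal.ofReal T := by
    rw [hq, hT, show (2:ℝ≥0∞) = ENNReal.ofReal 2 by simp, ← ENNReal.ofReal_mul (by norm_num),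
      sub_eq_add_neg, Real.rpow_add two_pos, Real.rpow_one]
  set E : (W × ℕ × ℕ) ⊕ ((W × ℕ × ℕ) ⊕ ℕ) → Set ℝ := fun α => match α with
    | .inl (k, β, i) => if i0 k ≤ i ∧ 12 * i ≤ β then EL k (β + 4*i) i else ∅
    | .inr (.inl (k, N, i)) => if i0 k ≤ i ∧ 8 * i ≤ N ∧ N < 16 * i then EG k N i else ∅
    | .inr (.inr l) => V l with hE
  set b : (W × ℕ × ℕ) ⊕ ((W × ℕ × ℕ) ⊕ ℕ) → ℕ := fun α => match α with
    | .inl (k, β, i) => β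
    | .inr (.inl (k, N, i)) => 0
    | .inr (.inr l) => 0 with hb
  set M : (W × ℕ × ℕ) ⊕ ((W × ℕ × ℕ) ⊕ ℕ) → ℕ := fun α => match α with
    | .inl (k, β, i) => β + 3 * i
    | .inr (.inl (k, N, i)) => N - i
    | .inr (.inr l) => Mc l with hM
  set ω : (W × ℕ × ℕ) ⊕ ((W × ℕ × ℕ) ⊕ ℕ) → ℝ≥0∞ := fun α => match α with
    | .inl (k, β, i) => if i0 k ≤ i then ENNReal.ofReal (A * (2:ℝ)^(-(σ * (i:ℕ)))) else 0
    | .inr (.inl (k, N, i)) => if i0 k ≤ i ∧ i ≤ N then ENNReal.ofReal (A * (2:ℝ)^(-(σ * (N:ℕ)))) else 0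
    | .inr (.inr l) => 4 * (2^(Mc l))⁻¹ with hω
  have hbM : ∀ α, b α ≤ M α := by
    rintro (⟨k, β, i⟩ | ⟨k, N, i⟩ | l)
    · exact Nat.le_add_right _ _
    · exact Nat.zero_le _
    · exact Nat.zero_le _
  have hcnt : ∀ α, ∀ i < 2^(b α), (cnt (E α) (M α) (b α) i : ℝ≥0∞) ≤ ω α * 2^(M α - b α) := by
    rintro (⟨k, β, i⟩ | ⟨k, N, i⟩ | l) j hj
    · by_cases h : i0 k ≤ i ∧ 12 * i ≤ β
      · have h1 := hEL k (β + 4*i) i j h.1 (by omega) (by rw [Nat.add_sub_cancel]; exact hj)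
        rw [Nat.add_sub_cancel, show β + 4*i - i = β + 3 * i by omega] at h1
        simp only [hE, hM, hb, hω, h.1, h, and_self, if_true, Nat.add_sub_cancel_left]
        exact h1
      · have h0 : cnt (E (.inl (k, β, i))) (M (.inl (k, β, i))) (b (.inl (k, β, i))) j = 0 :=
          cnt_empty _ _ _ _ (hbM (.inl (k, β, i))) (by simp only [hE, h, if_false, Set.inter_empty]; simp)
        rw [h0]; simp
    · by_cases h : i0 k ≤ i ∧ 8 * i ≤ N ∧ N < 16 * i
      · have h1 := hEG k N i h.1 h.2.1 h.2.2
        have hj0 : j = 0 := by simpa [hb] using hj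
        have h3 : i0 k ≤ i ∧ i ≤ N := ⟨h.1, by omega⟩
        simp only [hE, hM, hb, hω, h3, h, and_self, if_true, Nat.sub_zero, hj0]
        exact h1
      · have h0 : cnt (E (.inr (.inl (k, N, i)))) (M (.inr (.inl (k, N, i)))) (b (.inr (.inl (k, N, i)))) j = 0 :=
          cnt_empty _ _ _ _ (hbM (.inr (.inl (k, N, i)))) (by simp only [hE, h, if_false, Set.inter_empty]; simp)
        rw [h0]; simp
    · have hj0 : j = 0 := by simpa [hb] using hj
      simp only [hE, hM, hb, hω, Nat.sub_zero, hj0]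
      rw [mul_assoc, ENNReal.inv_mul_cancel (by positivity) (by finiteness), mul_one]
      have := cnt_le_three (V l) (Mc l) (by
        intro x hx y hy
        refine lt_of_lt_of_le (hV l x hx y hy) ?_
        have := hMc2 l
        rwa [one_div, inv_pow, ← one_div] at this)
      exact_mod_cast this
  have hnew : ∀ β, ∑' α, (if b α = β then ω α * (2*q)^(M α - β) else 0) ≤ ENNReal.ofReal ν := by
    intro β
    have hsplit : ∀ F : (W × ℕ × ℕ) ⊕ ((W × ℕ × ℕ) ⊕ ℕ) → ℝ≥0∞, ∑' α, F α =
        (∑' k, ∑' β, ∑' i, F (.inl (k, β, i))) + ((∑' k, ∑' N, ∑' i, F (.inr (.inl (k, N, i)))) +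
          ∑' l, F (.inr (.inr l))) := by
      intro F
      rw [Summable.tsum_sum ENNReal.summable ENNReal.summable]
      congr 1
      · rw [ENNReal.tsum_prod']
        exact tsum_congr fun k => ENNReal.tsum_prod'
      · rw [Summable.tsum_sum ENNReal.summable ENNReal.summable]
        congr 1
        rw [ENNReal.tsum_prod']
        exact tsum_congr fun k => ENNReal.tsum_prod'
    rw [hsplit, h2q]
    set Hk : W → ℝ≥0∞ := fun k => ∑' i, (if i0 k ≤ i then (ENNReal.ofReal Y)^i else 0) with hHk
    have hHkκ : ∀ k, fA * Hk k ≤ κ k := by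
      intro k
      refine le_trans (le_of_eq ?_) (hi0s k)
      rw [hHk, ← ENNReal.tsum_mul_left]
      exact tsum_congr fun i => by split_ifs <;> simp
    have hL : (∑' k, ∑' β', ∑' i, (if b (.inl (k, β', i)) = β then
        ω (.inl (k, β', i)) * (ENNReal.ofReal T)^(M (.inl (k, β', i)) - β) else 0)) ≤
        ∑' k, ENNReal.ofReal A * Hk k := by
      refine ENNReal.tsum_le_tsum fun k => ?_
      calc _ ≤ ∑' β', (if β' = β then ENNReal.ofReal A * Hk k else 0) := by
            refine ENNReal.tsum_le_tsum fun β' => ?_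
            by_cases hβ : β' = β
            · rw [if_pos hβ, hHk, ← ENNReal.tsum_mul_left]
              refine ENNReal.tsum_le_tsum fun i => ?_
              simp only [hb, hω, hM, hβ, if_true, Nat.add_sub_cancel_left]
              split_ifs with hi
              · rw [← ENNReal.ofReal_pow (by positivity), ← ENNReal.ofReal_pow (by positivity),
                  ← ENNReal.ofReal_mul (by positivity), ← ENNReal.ofReal_mul hA.le]
                apply ENNReal.ofReal_le_ofReal
                rw [mul_assoc]
                apply mul_le_mul_of_nonneg_left _ hA.le
                rw [hT, hY, ← Real.rpow_natCast, ← Real.rpow_natCast, ← Real.rpow_mul two_pos.le,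
                  ← Real.rpow_mul two_pos.le, ← Real.rpow_add two_pos]
                apply Real.rpow_le_rpow_of_exponent_le one_le_two
                push_cast
                have : (0:ℝ) ≤ i := by positivity
                nlinarith
              · simp
            · rw [if_neg hβ]
              simp [hb, hβ]
        _ = _ := by rw [tsum_ite_eq]
    have hGl : (∑' k, ∑' N, ∑' i, (if b (.inr (.inl (k, N, i))) = β then
        ω (.inr (.inl (k, N, i))) * (ENNReal.ofReal T)^(M (.inr (.inl (k, N, i))) - β) else 0)) ≤
        ∑' k, ENNReal.ofReal A * G * Hk k := by
      refine ENNReal.tsum_le_tsum fun k => ?_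
      calc _ ≤ ∑' N : ℕ, ∑' i : ℕ, (ENNReal.ofReal A * (ENNReal.ofReal Y)^N) *
              (if i0 k ≤ i then (ENNReal.ofReal Y)^i else 0) := by
            refine ENNReal.tsum_le_tsum fun N => ENNReal.tsum_le_tsum fun i => ?_
            simp only [hb, hω, hM]
            by_cases hβ : 0 = β
            · rw [if_pos hβ, ← hβ, Nat.sub_zero]
              by_cases hi : i0 k ≤ i ∧ i ≤ N
              · rw [if_pos hi, if_pos hi.1]
                rw [← ENNReal.ofReal_pow (by positivity), ← ENNReal.ofReal_pow (by positivity),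
                  ← ENNReal.ofReal_pow (by positivity),
                  ← ENNReal.ofReal_mul (by positivity), ← ENNReal.ofReal_mul hA.le,
                  ← ENNReal.ofReal_mul (by positivity)]
                apply ENNReal.ofReal_le_ofReal
                rw [mul_assoc, mul_assoc]
                apply mul_le_mul_of_nonneg_left _ hA.le
                rw [hT, hY, ← Real.rpow_natCast, ← Real.rpow_natCast, ← Real.rpow_natCast,
                  ← Real.rpow_mul two_pos.le, ← Real.rpow_mul two_pos.le, ← Real.rpow_mul two_pos.le,
                  ← Real.rpow_add two_pos, ← Real.rpow_add two_pos]
                apply Real.rpow_le_rpow_of_exponent_le one_le_two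
                have h1 : (0:ℝ) ≤ i := by positivity
                have h2 : (i:ℝ) ≤ N := by exact_mod_cast hi.2
                rw [Nat.cast_sub hi.2]
                have h3 : (1 - s) * (N - i) ≤ σ/8 * N := by
                  apply mul_le_mul hsσ (by linarith) (by linarith) (by linarith)
                nlinarith
              · rw [if_neg hi]; simp
            · rw [if_neg hβ]; exact zero_le
        _ = _ := by
            simp_rw [ENNReal.tsum_mul_left]
            rw [ENNReal.tsum_mul_right, ENNReal.tsum_mul_left]
    have hC : (∑' l, (if b (.inr (.inr l)) = β then
        ω (.inr (.inr l)) * (ENNReal.ofReal T)^(M (.inr (.inr l)) - β) else 0)) ≤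
        8 * ∑' l, ENNReal.ofReal (d l ^ s) := by
      rw [← ENNReal.tsum_mul_left]
      refine ENNReal.tsum_le_tsum fun l => ?_
      simp only [hb, hω, hM]
      by_cases hβ : 0 = β
      · rw [if_pos hβ, ← hβ, Nat.sub_zero, ← h2q, mul_pow, mul_assoc, ← mul_assoc (2^(Mc l))⁻¹,
          ENNReal.inv_mul_cancel (by positivity) (by finiteness), one_mul, hq,
          ← ENNReal.ofReal_pow (by positivity), show (4:ℝ≥0∞) = ENNReal.ofReal 4 by simp,
          show (8:ℝ≥0∞) = ENNReal.ofReal 8 by simp, ← ENNReal.ofReal_mul (by norm_num),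
          ← ENNReal.ofReal_mul (by norm_num)]
        apply ENNReal.ofReal_le_ofReal
        have h1 : ((2:ℝ)^(-s))^(Mc l) ≤ 2 * d l ^ s := by
          calc ((2:ℝ)^(-s))^(Mc l) = ((1/2:ℝ)^(Mc l))^s := by
                rw [Real.rpow_neg two_pos.le, ← Real.inv_rpow two_pos.le, one_div,
                  ← Real.rpow_natCast, ← Real.rpow_natCast, ← Real.rpow_mul (by norm_num),
                  ← Real.rpow_mul (by norm_num), mul_comm]
            _ ≤ (2 * d l)^s := by
                apply Real.rpow_le_rpow (by positivity) _ hs0.le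
                have := hMc1 l
                rw [pow_succ] at this
                linarith
            _ = 2^s * d l ^ s := Real.mul_rpow two_pos.le (hd0 l).le
            _ ≤ 2 * d l ^ s := by
                apply mul_le_mul_of_nonneg_right _ (Real.rpow_nonneg (hd0 l).le _)
                calc (2:ℝ)^s ≤ 2^(1:ℝ) := Real.rpow_le_rpow_of_exponent_le one_le_two hs1.le
                  _ = 2 := Real.rpow_one 2
        linarith
      · rw [if_neg hβ]; exact zero_le
    calc _ ≤ (∑' k, ENNReal.ofReal A * Hk k) + ((∑' k, ENNReal.ofReal A * G * Hk k) +
          8 * ∑' l, ENNReal.ofReal (d l ^ s)) := add_le_add hL (add_le_add hGl hC)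
      _ = (∑' k, fA * Hk k) + 8 * ∑' l, ENNReal.ofReal (d l ^ s) := by
          rw [← add_assoc, ← ENNReal.tsum_add]
          congr 1
          exact tsum_congr fun k => by rw [hfA]; ring
      _ ≤ ENNReal.ofReal (ν/2) + 8 * ENNReal.ofReal (ν/16) := by
          apply add_le_add
          · exact (ENNReal.tsum_le_tsum hHkκ).trans hκ.le
          · gcongr
      _ = ENNReal.ofReal ν := by
          rw [show (8:ℝ≥0∞) = ENNReal.ofReal 8 by simp, ← ENNReal.ofReal_mul (by norm_num),
            ← ENNReal.ofReal_add (by positivity) (by positivity)]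
          congr 1; ring
  obtain ⟨x, hx, hxE⟩ := dyadic_content E b M hbM ω hcnt q (ENNReal.ofReal (1/2)) (ENNReal.ofReal θ')
    (ENNReal.ofReal ν) (by rw [hq]; simpa using Real.rpow_pos_of_pos two_pos _) ENNReal.ofReal_ne_top
    (by rw [← ENNReal.ofReal_one]; exact (ENNReal.ofReal_lt_ofReal_iff one_pos).2 (by norm_num))
    (by rw [← ENNReal.ofReal_add hθ'0.le hν0.le]; apply ENNReal.ofReal_le_ofReal; rw [hν]; linarith)
    (by
      rw [h2q, ← ENNReal.ofReal_mul (by positivity)]; apply ENNReal.ofReal_le_ofReal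
      rw [hθ']; apply le_of_eq; field_simp)
    (by
      refine le_trans (le_trans (le_of_eq ?_) (hnew 0)) (ENNReal.ofReal_le_ofReal (by rw [hν]; linarith))
      exact tsum_congr fun α => by simp) hnew
  refine ⟨x, hx, ?_, ?_, ?_⟩
  · intro k N i h1 h2
    have := hxE (.inl (k, N - 4*i, i))
    have h3 : i0 k ≤ i ∧ 12 * i ≤ N - 4*i := ⟨h1, by omega⟩
    simp only [hE, h3, and_self, if_true] at this
    rwa [Nat.sub_add_cancel (by omega)] at this
  · intro k N i h1 h2 h3
    have := hxE (.inr (.inl (k, N, i)))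
    simpa only [hE, h1, h2, h3, and_self, if_true] using this
  · intro l
    exact hxE (.inr (.inr l))

end BM


set_option linter.unusedSectionVars false
set_option linter.unusedVariables false
namespace BM

lemma tau_le {n : ℕ} (r : Fin n → ℝ) (i : Fin n) (hi : 0 < r i) : tauW r ≤ r i :=
  csInf_le ⟨0, fun t ht => ht.1.le⟩ ⟨hi, i, rfl⟩

theorem curve_thm (n : ℕ) (W : Set (Fin n → ℝ)) (hWc : W.Countable) (hWs : W ⊆ Weights n) (ε0 : ℝ)
    (hε : 0 < ε0) (hε1 : ε0 ≤ 1) (hτ : ∀ r ∈ W, ε0 ≤ tauW r) (B : ℕ → ℝ) (hB : ∀ l, 0 ≤ B l)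
    (c1 : ℝ) (hc1 : 0 < c1) (l0 : ℕ) :
    ∃ s0 < (1:ℝ), ∀ s, s0 ≤ s → 0 < s → s < 1 → ∃ c : ℝ, 0 < c ∧ ∀ g : ℕ → ℝ → Fin n → ℝ, CD B c1 l0 g →
      ∀ (V : ℕ → Set ℝ) (d : ℕ → ℝ), (∀ l, 0 < d l) → (∀ l, d l ≤ 1) →
      (∀ l, ∀ x ∈ V l, ∀ y ∈ V l, |x - y| < d l) →
      (∀ t ∈ Set.Icc (0:ℝ) 1, (∀ r ∈ W, (WithLp.toLp 2 (g 0 t) : EuclideanSpace ℝ (Fin n)) ∈ BadSet r) → ∃ l, t ∈ V l) →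
      ENNReal.ofReal c ≤ ∑' l, ENNReal.ofReal (d l ^ s) := by
  obtain ⟨A, σ, N0, hA, hσ, hcount⟩ := counts B hB c1 hc1 l0 ε0 hε hε1 n
  refine ⟨1 - σ/8, by linarith, ?_⟩
  intro s hs hs0 hs1
  have : Countable W := hWc.to_subtype
  obtain ⟨c, i0, hc, hi0, hav⟩ := avoid_all W A σ s hA hσ hs0 hs1 (by linarith) (max N0 1)
  refine ⟨c, hc, ?_⟩
  intro g hg V d hd0 hd1 hV hcov
  by_contra! hlt
  have hp : ∀ r : W, ∃ p : {i // 0 < r.1 i}, ∀ c, r.1 c ≤ r.1 p := by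
    intro r
    have hW := hWs r.2
    have : ∃ i, 0 < r.1 i := by
      by_contra! hcon
      have h1 : ∑ i, r.1 i ≤ 0 := Finset.sum_nonpos fun i _ => hcon i
      rw [hW.1] at h1; linarith
    obtain ⟨j, hj⟩ := this
    have : Nonempty (Fin n) := ⟨j⟩
    obtain ⟨p, hp⟩ := Finite.exists_max r.1
    exact ⟨⟨p, hj.trans_le (hp j)⟩, hp⟩
  choose p hpm using hp
  have hrε : ∀ r : W, ∀ i, 0 < r.1 i → ε0 ≤ r.1 i := fun r i hi => (hτ r.1 r.2).trans (tau_le _ _ hi)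
  have hct := fun r : W => hcount {i // 0 < r.1 i} (by
      simpa using Fintype.card_subtype_le (fun i => 0 < r.1 i)) (fun i => r.1 i) (p r)
    (fun l t i => g l t i) (CD_sub B c1 l0 g hg _) (fun i => hrε r i i.2) (sum_pos_sub r.1 (hWs r.2))
    (fun i => hpm r i)
  set S : W → ℕ → ℕ → Set ℝ := fun r N i => ES (fun l t (i : {i // 0 < r.1 i}) => g l t i)
    (fun i => r.1 i) (p r) (ε0/(16*((Fintype.card {i // 0 < r.1 i}:ℝ)+1))) N i with hS
  obtain ⟨x, hx, h1, h2, h3⟩ := hav (fun r N i => S r N i \ (S r N (2*i) ∪ S r (N-i) i)) S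
    (fun r N i j0 _ h4 h5 => (hct r).1 N i j0 h4 h5)
    (fun r N i h4 h5 h6 => (hct r).2 N i h5 h6 (by
      have := (le_max_left N0 1).trans (hi0 r)
      have := (le_max_right N0 1).trans (hi0 r)
      omega)) V d hd0 hd1 hV hlt
  obtain ⟨l, hl⟩ := hcov x hx (by
    intro r hr
    have hwf := wf_avoid (S ⟨r, hr⟩) (i0 ⟨r, hr⟩) ((le_max_right _ _).trans (hi0 _)) x
      (h1 ⟨r, hr⟩) (h2 ⟨r, hr⟩)
    apply bad_of_avoid r ε0 hε (hWs hr) (hrε ⟨r, hr⟩) (p ⟨r, hr⟩) (hpm ⟨r, hr⟩) (fun i => g 0 x i)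
      (fun i => g 1 x i) (B 1) (hB 1) (fun i => hg.bd 1 x hx i)
      (ε0/(16*((Fintype.card {i // 0 < r i}:ℝ)+1))) (by positivity) (8 * i0 ⟨r, hr⟩) (i0 ⟨r, hr⟩)
    · intro N hN hcon
      exact hwf N _ le_rfl hN ⟨hx, hcon⟩
    · intro i; rfl)
  exact h3 l hl

end BM


set_option linter.unusedSectionVars false
set_option linter.unusedVariables false
namespace BM

lemma eu_norm_le {m : ℕ} (x : EuclideanSpace ℝ (Fin m)) : ‖x‖ ≤ ∑ i, |x i| := by
  rw [EuclideanSpace.norm_eq]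
  apply Real.sqrt_le_iff.2 ⟨Finset.sum_nonneg fun i _ => abs_nonneg _, ?_⟩
  have := Finset.sum_sq_le_sq_sum_of_nonneg (s := Finset.univ) (f := fun i => |x i|)
    (fun i _ => abs_nonneg _)
  simpa using this

lemma span_top {m n : ℕ} (f : EuclideanSpace ℝ (Fin m) → EuclideanSpace ℝ (Fin n))
    (B : Set (EuclideanSpace ℝ (Fin m))) (hnd : NondegOn f B) :
    Submodule.span ℝ ((fun x => ((1:ℝ), f x)) '' B) = ⊤ := by
  by_contra hne
  obtain ⟨φ, hφ, hk⟩ := Submodule.exists_le_ker_of_lt_top _ (lt_top_iff_ne_top.2 hne)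
  apply hφ
  have hform : ∀ (c : ℝ) (y : EuclideanSpace ℝ (Fin n)),
      φ (c, y) = c * φ (1, 0) + ∑ i, φ (0, EuclideanSpace.single i 1) * y i := by
    intro c y
    have e1 : ((c, y) : ℝ × EuclideanSpace ℝ (Fin n)) =
        c • ((1:ℝ), (0 : EuclideanSpace ℝ (Fin n))) +
          ∑ i, (y i) • ((0:ℝ), (EuclideanSpace.single i (1:ℝ) : EuclideanSpace ℝ (Fin n))) := by
      have h2 : y = ∑ i, (y i) • (EuclideanSpace.single i (1:ℝ) : EuclideanSpace ℝ (Fin n)) := by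
        have := (EuclideanSpace.basisFun (Fin n) ℝ).sum_repr y
        simpa using this.symm
      apply Prod.ext
      · simp [Prod.fst_sum]
      · simp only [Prod.snd_add, Prod.smul_snd, Prod.snd_sum, smul_zero, zero_add]
        exact h2
    rw [e1, map_add, map_smul, map_sum]
    congr 1
    exact Finset.sum_congr rfl fun i _ => by rw [map_smul, smul_eq_mul, mul_comm]
  have := hnd (φ (1, 0)) (fun i => φ (0, EuclideanSpace.single i 1)) (by
    intro x hx
    have h := hk (Submodule.subset_span ⟨x, hx, rfl⟩)
    rw [LinearMap.mem_ker, hform, one_mul] at h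
    exact h)
  apply LinearMap.ext
  rintro ⟨c, y⟩
  rw [hform, this.1]
  simp [this.2]

lemma exists_curve {m n : ℕ} (f : EuclideanSpace ℝ (Fin m) → EuclideanSpace ℝ (Fin n))
    (x₀ : EuclideanSpace ℝ (Fin m)) (ρ : ℝ) (hρ : 0 < ρ)
    (hf : ContinuousOn f (Metric.ball x₀ ρ)) (hnd : NondegOn f (Metric.ball x₀ ρ)) :
    ∃ q : Fin m → Polynomial ℝ,
      (∀ t ∈ Set.Icc (0:ℝ) 1, (WithLp.toLp 2 (fun j => (q j).eval t) : EuclideanSpace ℝ (Fin m))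
        ∈ Metric.ball x₀ ρ) ∧
      ∀ (c : ℝ) (a : Fin n → ℝ), (∀ t ∈ Set.Icc (0:ℝ) 1, c + ∑ i, a i *
        f (WithLp.toLp 2 (fun j => (q j).eval t)) i = 0) → c = 0 ∧ ∀ i, a i = 0 := by
  set B := Metric.ball x₀ ρ with hB
  have hBo : IsOpen B := Metric.isOpen_ball
  set v : EuclideanSpace ℝ (Fin m) → ℝ × EuclideanSpace ℝ (Fin n) := fun x => (1, f x) with hv
  have hsp := span_top f B hnd
  have hfr : Module.finrank ℝ (Submodule.span ℝ (v '' B)) = n + 1 := by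
    rw [hsp, finrank_top]
    simp [Module.finrank_prod, add_comm]
  have hp : ∃ p0 : Fin (n+1) → ℝ × EuclideanSpace ℝ (Fin n), (∀ i, p0 i ∈ v '' B) ∧
      LinearIndependent ℝ p0 := by
    rw [← hfr]
    obtain ⟨p0, hp0, hp0s, hp0i⟩ := Submodule.exists_fun_fin_finrank_span_eq ℝ (v '' B)
    exact ⟨p0, hp0, hp0i⟩
  obtain ⟨p0, hp0, hp0i⟩ := hp
  choose p hpB hpv using hp0
  have hpc : IsPathConnected B := (convex_ball x₀ ρ).isPathConnected ⟨x₀, Metric.mem_ball_self hρ⟩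
  obtain ⟨γ, t, hγB, hγt⟩ := hpc.exists_path_through_family' p hpB
  have hK : IsCompact (Set.range γ) := isCompact_range γ.continuous
  obtain ⟨δ1, hδ1, hth⟩ := hK.exists_thickening_subset_open hBo (by rintro _ ⟨s, rfl⟩; exact hγB s)
  have hnb : {F : Fin (n+1) → ℝ × EuclideanSpace ℝ (Fin n) | LinearIndependent ℝ F} ∈
      nhds (fun k => v (p k)) := by
    apply isOpen_setOfPred_linearIndependent.mem_nhds
    have : (fun k => v (p k)) = p0 := funext hpv
    rw [this]; exact hp0i
  have hca : ContinuousAt (fun (x : Fin (n+1) → EuclideanSpace ℝ (Fin m)) k => v (x k)) p := by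
    apply continuousAt_pi.2
    intro k
    have h1 : ContinuousAt v (p k) :=
      continuousAt_const.prodMk (hf.continuousAt (hBo.mem_nhds (hpB k)))
    exact ContinuousAt.comp (f := fun x : Fin (n+1) → EuclideanSpace ℝ (Fin m) => x k) h1
      (continuousAt_apply k p)
  obtain ⟨δ2, hδ2, hb⟩ := Metric.mem_nhds_iff.1 (hca hnb)
  set δ := min δ1 δ2 with hδ
  have hδ0 : 0 < δ := lt_min hδ1 hδ2
  have hext : Continuous γ.extend := γ.continuous_extend
  have happ : ∀ j : Fin m, ∃ q : Polynomial ℝ, ∀ s ∈ Set.Icc (0:ℝ) 1,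
      |q.eval s - γ.extend s j| < δ / (m + 1) := by
    intro j
    apply exists_polynomial_near_of_continuousOn 0 1 (fun s => γ.extend s j)
    · have : Continuous (fun s => γ.extend s j) := by fun_prop
      exact this.continuousOn
    · positivity
  choose q hq using happ
  have hclose : ∀ s ∈ Set.Icc (0:ℝ) 1,
      dist (WithLp.toLp 2 (fun j => (q j).eval s) : EuclideanSpace ℝ (Fin m)) (γ.extend s) < δ := by
    intro s hs
    rw [dist_eq_norm]
    refine (eu_norm_le _).trans_lt ?_
    have h1 : ∑ i, |((WithLp.toLp 2 (fun j => (q j).eval s) : EuclideanSpace ℝ (Fin m))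
        - γ.extend s) i| ≤ ∑ i : Fin m, δ / (m+1) :=
      Finset.sum_le_sum fun i _ => (hq i s hs).le
    refine h1.trans_lt ?_
    rw [Finset.sum_const, Finset.card_univ, Fintype.card_fin, nsmul_eq_mul, mul_div_assoc',
      div_lt_iff₀ (by positivity)]
    nlinarith
  refine ⟨q, ?_, ?_⟩
  · intro s hs
    apply hth
    rw [Metric.mem_thickening_iff]
    refine ⟨γ.extend s, ?_, (hclose s hs).trans_le (min_le_left _ _)⟩
    rw [← γ.extend_range]; exact ⟨s, rfl⟩
  · intro c a hca
    set x : Fin (n+1) → EuclideanSpace ℝ (Fin m) :=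
      fun k => WithLp.toLp 2 (fun j => (q j).eval (t k : ℝ)) with hx
    have hli : LinearIndependent ℝ (fun k => v (x k)) := by
      apply hb
      rw [Metric.mem_ball, dist_pi_lt_iff hδ2]
      intro k
      have h1 := hclose (t k) (t k).2
      rw [γ.extend_apply (t k).2] at h1
      have h2 : γ ⟨(t k : ℝ), (t k).2⟩ = p k := hγt k
      rw [h2] at h1
      exact h1.trans_le (min_le_right _ _)
    have hspan : Submodule.span ℝ (Set.range fun k => v (x k)) = ⊤ := by
      apply hli.span_eq_top_of_card_eq_finrank
      simp [Module.finrank_prod, add_comm]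
    set φ : ℝ × EuclideanSpace ℝ (Fin n) →ₗ[ℝ] ℝ :=
      { toFun := fun z => c * z.1 + ∑ i, a i * z.2 i
        map_add' := by intro y z; simp [mul_add, Finset.sum_add_distrib]; ring
        map_smul' := by
          intro r y
          simp only [Prod.smul_fst, Prod.smul_snd, PiLp.smul_apply, smul_eq_mul, RingHom.id_apply,
            mul_add, Finset.mul_sum]
          congr 1
          · ring
          · exact Finset.sum_congr rfl fun i _ => by ring } with hφ
    have hz : ∀ z, φ z = 0 := by
      intro z
      have hz : z ∈ Submodule.span ℝ (Set.range fun k => v (x k)) := hspan ▸ Submodule.mem_top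
      have hle : Submodule.span ℝ (Set.range fun k => v (x k)) ≤ LinearMap.ker φ := by
        rw [Submodule.span_le]
        rintro _ ⟨k, rfl⟩
        have := hca (t k) (t k).2
        show c * 1 + ∑ i, a i * f (x k) i = 0
        rw [mul_one]; exact this
      exact hle hz
    refine ⟨?_, fun i => ?_⟩
    · have h := hz (1, 0)
      simpa [hφ] using h
    · have h : c * 0 + ∑ k, a k * (EuclideanSpace.single i (1:ℝ) : EuclideanSpace ℝ (Fin n)) k = 0 :=
        hz (0, EuclideanSpace.single i 1)
      simpa using h

end BM


set_option linter.unusedSectionVars false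
set_option linter.unusedVariables false
namespace BM

lemma const_of_derivs (h : ℝ → ℝ) (ha : AnalyticOnNhd ℝ h (Set.Icc 0 1)) (t0 : ℝ)
    (ht0 : t0 ∈ Set.Icc (0:ℝ) 1) (hz : ∀ l, 1 ≤ l → iteratedDeriv l h t0 = 0) :
    ∀ t ∈ Set.Icc (0:ℝ) 1, h t = h t0 := by
  set k : ℝ → ℝ := fun t => -h t0 + h t with hk
  have hka : AnalyticOnNhd ℝ k (Set.Icc 0 1) := fun t ht => analyticAt_const.add (ha t ht)
  have hkz : ∀ l, iteratedDeriv l k t0 = 0 := by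
    intro l
    rcases Nat.eq_zero_or_pos l with rfl | hl
    · simp [hk]
    · rw [hk, iteratedDeriv_const_add hl]; exact hz l hl
  have h1 := (hka t0 ht0).hasFPowerSeriesAt
  have h2 : (FormalMultilinearSeries.ofScalars ℝ (fun n ↦ iteratedDeriv n k t0 / n.factorial)
      : FormalMultilinearSeries ℝ ℝ ℝ) = 0 := by
    apply FormalMultilinearSeries.ext
    intro l
    simp [FormalMultilinearSeries.ofScalars, hkz]
  rw [h2] at h1
  have h3 := hka.eqOn_zero_of_preconnected_of_eventuallyEq_zero isPreconnected_Icc ht0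
    h1.eventually_eq_zero
  intro t ht
  have := h3 ht
  simp only [hk, Pi.zero_apply] at this
  linarith

lemma exists_t0 {n : ℕ} (F : Fin n → ℝ → ℝ) (ha : ∀ i, AnalyticOnNhd ℝ (F i) (Set.Icc 0 1))
    (hnd : ∀ (c : ℝ) (a : Fin n → ℝ), (∀ t ∈ Set.Icc (0:ℝ) 1, c + ∑ i, a i * F i t = 0) →
      c = 0 ∧ ∀ i, a i = 0) :
    ∃ t0 ∈ Set.Icc (0:ℝ) 1, (∀ i, deriv (F i) t0 ≠ 0) ∧
      ∀ w : Fin n → ℝ, w ≠ 0 → ∃ l, 1 ≤ l ∧ ∑ i, w i * iteratedDeriv l (F i) t0 ≠ 0 := by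
  have hmain : ∀ t0 ∈ Set.Icc (0:ℝ) 1, ∀ w : Fin n → ℝ, w ≠ 0 →
      ∃ l, 1 ≤ l ∧ ∑ i, w i * iteratedDeriv l (F i) t0 ≠ 0 := by
    intro t0 ht0 w hw
    by_contra hcon
    push Not at hcon
    apply hw
    set h : ℝ → ℝ := fun t => ∑ i, w i * F i t with hh
    have han : AnalyticOnNhd ℝ h (Set.Icc 0 1) := fun t ht =>
      Finset.analyticAt_fun_sum _ fun i _ => analyticAt_const.mul (ha i t ht)
    have hc := const_of_derivs h han t0 ht0 (by
      intro l hl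
      rw [hh, iteratedDeriv_fun_sum (fun i _ => contDiffAt_const.mul (ha i t0 ht0).contDiffAt)]
      rw [← hcon l hl]
      refine Finset.sum_congr rfl fun i _ => ?_
      exact iteratedDeriv_const_mul (w i) (ha i t0 ht0).contDiffAt)
    funext i
    exact (hnd (-h t0) w (fun t ht => by have := hc t ht; simp only [hh] at this ⊢; linarith)).2 i
  have hev : ∀ i, ∀ᶠ t in nhdsWithin (1/2:ℝ) {1/2}ᶜ, deriv (F i) t ≠ 0 := by
    intro i
    have hhalf : (1/2:ℝ) ∈ Set.Icc (0:ℝ) 1 := by norm_num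
    rcases (ha i (1/2) hhalf).deriv.eventually_eq_zero_or_eventually_ne_zero with h | h
    · exfalso
      obtain ⟨l, hl, hl2⟩ := hmain (1/2) hhalf (Pi.single i 1) (by simp)
      apply hl2
      obtain ⟨l', rfl⟩ : ∃ l', l = l' + 1 := ⟨l-1, by omega⟩
      have h0 : iteratedDeriv (l'+1) (F i) (1/2) = 0 := by
        rw [iteratedDeriv_succ']
        have h2 : deriv (F i) =ᶠ[nhds (1/2)] (fun _ => (0:ℝ)) := h
        rw [h2.iteratedDeriv_eq l']
        simp
      rw [Finset.sum_eq_single i]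
      · rw [h0, mul_zero]
      · intro b _ hb; simp [hb]
      · simp
    · exact h
  have hev2 : ∀ᶠ t in nhdsWithin (1/2:ℝ) {1/2}ᶜ, ∀ i, deriv (F i) t ≠ 0 :=
    Filter.eventually_all.2 hev
  have hev3 : ∀ᶠ t in nhdsWithin (1/2:ℝ) {1/2}ᶜ, t ∈ Set.Icc (0:ℝ) 1 :=
    nhdsWithin_le_nhds (Icc_mem_nhds (by norm_num) (by norm_num))
  obtain ⟨t0, h1, h2⟩ := (hev2.and hev3).exists
  exact ⟨t0, h2, h1, hmain t0 h2⟩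

end BM


set_option linter.unusedSectionVars false
set_option linter.unusedVariables false
namespace BM

lemma finite_pos_lb {n : ℕ} (a : Fin n → ℝ) (ha : ∀ i, 0 < a i) : ∃ c : ℝ, 0 < c ∧ ∀ i, c ≤ a i := by
  rcases isEmpty_or_nonempty (Fin n) with h | h
  · exact ⟨1, one_pos, fun i => h.elim i⟩
  · obtain ⟨i, hi⟩ := Finite.exists_min a
    exact ⟨a i, ha i, hi⟩

/-- iterated `t`-derivatives of a function on `(Fin m → ℝ) × ℝ` -/
noncomputable def DT {m : ℕ} (h : (Fin m → ℝ) × ℝ → ℝ) : ℕ → (Fin m → ℝ) × ℝ → ℝ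
  | 0 => h
  | l+1 => fun z => fderiv ℝ (DT h l) z (0, 1)

lemma DT_analytic {m : ℕ} (h : (Fin m → ℝ) × ℝ → ℝ) (O : Set ((Fin m → ℝ) × ℝ))
    (hO : AnalyticOnNhd ℝ h O) (l : ℕ) : AnalyticOnNhd ℝ (DT h l) O := by
  induction l with
  | zero => exact hO
  | succ l ih =>
    intro z hz
    exact (ContinuousLinearMap.analyticAt
      (ContinuousLinearMap.apply ℝ ℝ ((0, 1) : (Fin m → ℝ) × ℝ)) _).comp (ih.fderiv z hz)

lemma DT_deriv {m : ℕ} (h : (Fin m → ℝ) × ℝ → ℝ) (O : Set ((Fin m → ℝ) × ℝ))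
    (hO : AnalyticOnNhd ℝ h O) (l : ℕ) (u : Fin m → ℝ) (t : ℝ) (hz : (u, t) ∈ O) :
    HasDerivAt (fun s => DT h l (u, s)) (DT h (l+1) (u, t)) t := by
  have h1 := (DT_analytic h O hO l (u, t) hz).differentiableAt.hasFDerivAt
  have h2 : HasDerivAt (fun s : ℝ => ((u, s) : (Fin m → ℝ) × ℝ)) (0, 1) t :=
    (hasDerivAt_const t u).prodMk (hasDerivAt_id t)
  exact h1.comp_hasDerivAt t h2

lemma DT_iter {m : ℕ} (h : (Fin m → ℝ) × ℝ → ℝ) (O : Set ((Fin m → ℝ) × ℝ)) (hOo : IsOpen O)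
    (hO : AnalyticOnNhd ℝ h O) (l : ℕ) (u : Fin m → ℝ) : ∀ t, (u, t) ∈ O →
    DT h l (u, t) = iteratedDeriv l (fun s => h (u, s)) t := by
  induction l with
  | zero => intro t ht; simp [DT]
  | succ l ih =>
    intro t ht
    rw [iteratedDeriv_succ, ← (DT_deriv h O hO l u t ht).deriv]
    apply Filter.EventuallyEq.deriv_eq
    have : {s : ℝ | (u, s) ∈ O} ∈ nhds t := (hOo.preimage (by fun_prop)).mem_nhds ht
    filter_upwards [this] with s hs using ih s hs

lemma nd_compact {n m : ℕ} (D : ℕ → Fin n → (Fin m → ℝ) × ℝ → ℝ) (z0 : (Fin m → ℝ) × ℝ)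
    (hc : ∀ l i, ContinuousAt (D l i) z0)
    (hnd : ∀ w : Fin n → ℝ, w ≠ 0 → ∃ l, 1 ≤ l ∧ ∑ i, w i * D l i z0 ≠ 0) :
    ∃ l0 : ℕ, ∃ c1 : ℝ, 0 < c1 ∧ ∃ U ∈ nhds z0, ∀ w : Fin n → ℝ, ‖w‖ = 1 → ∃ l, 1 ≤ l ∧ l ≤ l0 ∧
      ∀ z ∈ U, c1 ≤ |∑ i, w i * D l i z| := by
  have hcpt : IsCompact (Metric.sphere (0 : Fin n → ℝ) 1) := isCompact_sphere _ _
  have key := hcpt.induction_on (p := fun S => ∃ l0 : ℕ, ∃ c1 : ℝ, 0 < c1 ∧ ∃ U ∈ nhds z0,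
      ∀ w ∈ S, ∃ l, 1 ≤ l ∧ l ≤ l0 ∧ ∀ z ∈ U, c1 ≤ |∑ i, w i * D l i z|)
    ⟨0, 1, one_pos, Set.univ, Filter.univ_mem, fun w hw => hw.elim⟩
    (by
      rintro s t hst ⟨l0, c1, h1, U, hU, h⟩
      exact ⟨l0, c1, h1, U, hU, fun w hw => h w (hst hw)⟩)
    (by
      rintro s t ⟨l0, c1, h1, U, hU, h⟩ ⟨l0', c1', h1', U', hU', h'⟩
      refine ⟨max l0 l0', min c1 c1', lt_min h1 h1', U ∩ U', Filter.inter_mem hU hU', ?_⟩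
      rintro w (hw | hw)
      · obtain ⟨l, a, b, c⟩ := h w hw
        exact ⟨l, a, b.trans (le_max_left _ _), fun z hz => (min_le_left _ _).trans (c z hz.1)⟩
      · obtain ⟨l, a, b, c⟩ := h' w hw
        exact ⟨l, a, b.trans (le_max_right _ _), fun z hz => (min_le_right _ _).trans (c z hz.2)⟩)
    (by
      intro w0 hw0
      have hw : w0 ≠ 0 := by
        rintro rfl
        simp at hw0
      obtain ⟨l, hl, hne⟩ := hnd w0 hw
      have hca : ContinuousAt (fun p : (Fin n → ℝ) × ((Fin m → ℝ) × ℝ) =>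
          |∑ i, p.1 i * D l i p.2|) (w0, z0) := by
        apply ContinuousAt.abs
        apply tendsto_finset_sum
        intro i _
        apply ContinuousAt.mul
        · fun_prop
        · exact ContinuousAt.comp (f := Prod.snd) (hc l i) continuousAt_snd
      have hpos : 0 < |∑ i, w0 i * D l i z0| := abs_pos.2 hne
      have hev := hca.eventually (lt_mem_nhds (half_lt_self hpos))
      obtain ⟨T, hT, U, hU, hTU⟩ := mem_nhds_prod_iff.1 hev
      refine ⟨T, mem_nhdsWithin_of_mem_nhds hT, l, _, half_pos hpos, U, hU, ?_⟩
      intro w hw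
      exact ⟨l, hl, le_rfl, fun z hz => (hTU (Set.mk_mem_prod hw hz) : _ < _).le⟩)
  obtain ⟨l0, c1, h1, U, hU, h⟩ := key
  exact ⟨l0, c1, h1, U, hU, fun w hw => h w (by simpa using hw)⟩

lemma family {m n : ℕ} (H : (Fin m → ℝ) × ℝ → EuclideanSpace ℝ (Fin n))
    (O : Set ((Fin m → ℝ) × ℝ)) (hOo : IsOpen O) (hH : AnalyticOnNhd ℝ H O) (u0 : Fin m → ℝ) (t0 : ℝ)
    (hz : (u0, t0) ∈ O) (h1 : ∀ i, deriv (fun t => H (u0, t) i) t0 ≠ 0)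
    (hnd : ∀ w : Fin n → ℝ, w ≠ 0 →
      ∃ l, 1 ≤ l ∧ ∑ i, w i * iteratedDeriv l (fun t => H (u0, t) i) t0 ≠ 0)
    (N : Set ((Fin m → ℝ) × ℝ)) (hN : N ∈ nhds (u0, t0)) :
    ∃ η : ℝ, 0 < η ∧ η ≤ 1 ∧ ∃ B : ℕ → ℝ, (∀ l, 0 ≤ B l) ∧ ∃ c1 : ℝ, 0 < c1 ∧ ∃ l0 : ℕ,
      ∃ G : (Fin m → ℝ) → ℕ → ℝ → Fin n → ℝ, ∀ u ∈ Metric.closedBall u0 η,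
        CD B c1 l0 (G u) ∧ ∀ t ∈ Set.Icc (0:ℝ) 1,
          G u 0 t = (H (u, t0 + η * t)).ofLp ∧ (u, t0 + η * t) ∈ N := by
  set D : ℕ → Fin n → (Fin m → ℝ) × ℝ → ℝ := fun l i => DT (fun z => H z i) l with hD
  have hHi : ∀ i, AnalyticOnNhd ℝ (fun z => H z i) O := fun i z hz =>
    (ContinuousLinearMap.analyticAt (EuclideanSpace.proj (𝕜 := ℝ) i) _).comp (hH z hz)
  have hDan : ∀ l i, AnalyticOnNhd ℝ (D l i) O := fun l i => DT_analytic _ O (hHi i) l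
  obtain ⟨l0, c1, hc1, U, hU, hUw⟩ := nd_compact D (u0, t0)
    (fun l i => (hDan l i _ hz).continuousAt) (by
      intro w hw
      obtain ⟨l, hl, hl2⟩ := hnd w hw
      refine ⟨l, hl, ?_⟩
      have e : ∀ i, D l i (u0, t0) = iteratedDeriv l (fun t => H (u0, t) i) t0 :=
        fun i => DT_iter _ O hOo (hHi i) l u0 t0 hz
      simp only [e]; exact hl2)
  have hD1 : ∀ i, 0 < |D 1 i (u0, t0)| / 2 := by
    intro i
    have e : D 1 i (u0, t0) = iteratedDeriv 1 (fun t => H (u0, t) i) t0 :=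
      DT_iter _ O hOo (hHi i) 1 u0 t0 hz
    rw [e, iteratedDeriv_one]
    have := abs_pos.2 (h1 i)
    linarith
  obtain ⟨c2, hc2, hc2l⟩ := finite_pos_lb _ hD1
  have hev : ∀ᶠ z in nhds (u0, t0), ∀ i, c2 ≤ |D 1 i z| := by
    rw [Filter.eventually_all]
    intro i
    have hpos : |D 1 i (u0, t0)| / 2 < |D 1 i (u0, t0)| := by have := hD1 i; linarith
    filter_upwards [((hDan 1 i _ hz).continuousAt.abs).eventually (lt_mem_nhds hpos)] with z hz
    exact (hc2l i).trans hz.le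
  have hall : O ∩ N ∩ (U ∩ {z | ∀ i, c2 ≤ |D 1 i z|}) ∈ nhds (u0, t0) :=
    Filter.inter_mem (Filter.inter_mem (hOo.mem_nhds hz) hN) (Filter.inter_mem hU hev)
  obtain ⟨η', hη', hsub'⟩ := Metric.nhds_basis_closedBall.mem_iff.1 hall
  set η := min η' 1 with hη
  have hη0 : 0 < η := lt_min hη' one_pos
  have hη1 : η ≤ 1 := min_le_right _ _
  have hsub := (Metric.closedBall_subset_closedBall (min_le_left η' 1)).trans hsub'
  have hbd : ∀ l i, ∃ C, ∀ z ∈ Metric.closedBall (u0, t0) η, ‖D l i z‖ ≤ C := fun l i =>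
    (isCompact_closedBall (u0, t0) η).exists_bound_of_continuousOn
      ((hDan l i).continuousOn.mono fun z hz => (hsub hz).1.1)
  choose C hC using hbd
  have hmem : ∀ u ∈ Metric.closedBall u0 η, ∀ t ∈ Set.Icc (0:ℝ) 1,
      (u, t0 + η * t) ∈ Metric.closedBall (u0, t0) η := by
    intro u hu t ht
    rw [Metric.mem_closedBall, Prod.dist_eq]
    apply max_le hu
    simp only [Real.dist_eq, add_sub_cancel_left]
    rw [abs_of_nonneg (mul_nonneg hη0.le ht.1)]
    nlinarith [ht.2]
  refine ⟨η, hη0, hη1, fun l => ∑ i, |C l i|, fun l => Finset.sum_nonneg fun i _ => abs_nonneg _,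
    min (η * c2) (η ^ l0 * c1), by positivity, l0,
    fun u l t i => η ^ l * D l i (u, t0 + η * t), ?_⟩
  intro u hu
  refine ⟨⟨?_, ?_, ?_, ?_⟩, ?_⟩
  · intro l t ht i
    have hO' := (hsub (hmem u hu t ht)).1.1
    have h2 := DT_deriv (fun z => H z i) O (hHi i) l u (t0 + η * t) hO'
    have h3 : HasDerivAt (fun s : ℝ => t0 + η * s) η t := by
      simpa using ((hasDerivAt_id t).const_mul η).const_add t0
    have h4 := (HasDerivAt.comp t h2 h3).const_mul (η ^ l)
    have e : η ^ (l+1) * D (l+1) i (u, t0 + η * t) =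
      η ^ l * (DT (fun z => H z i) (l+1) (u, t0 + η * t) * η) := by
      simp only [hD]; ring
    show HasDerivAt _ (η ^ (l+1) * D (l+1) i (u, t0 + η * t)) t
    rw [e]
    exact h4
  · intro l t ht i
    have h2 := hC l i _ (hmem u hu t ht)
    rw [Real.norm_eq_abs] at h2
    show |η ^ l * D l i (u, t0 + η * t)| ≤ _
    rw [abs_mul, abs_of_nonneg (pow_nonneg hη0.le l)]
    have h3 : η ^ l ≤ 1 := pow_le_one₀ hη0.le hη1
    have h4 : |C l i| ≤ ∑ i, |C l i| :=
      Finset.single_le_sum (f := fun i => |C l i|) (fun i _ => abs_nonneg _) (Finset.mem_univ i)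
    calc η ^ l * |D l i (u, t0 + η * t)| ≤ 1 * |D l i (u, t0 + η * t)| := by gcongr
      _ ≤ _ := by rw [one_mul]; exact h2.trans ((le_abs_self _).trans h4)
  · intro t ht i
    have h2 := (hsub (hmem u hu t ht)).2.2 i
    show _ ≤ |η ^ 1 * D 1 i (u, t0 + η * t)|
    rw [abs_mul, pow_one, abs_of_pos hη0]
    exact (min_le_left _ _).trans (mul_le_mul_of_nonneg_left h2 hη0.le)
  · rintro w hw ⟨j, hj⟩
    have hn : ‖w‖ = 1 := by
      apply le_antisymm
      · rw [pi_norm_le_iff_of_nonneg zero_le_one]; exact hw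
      · rw [← hj]; exact norm_le_pi_norm w j
    obtain ⟨l, hl1, hl2, hl3⟩ := hUw w hn
    refine ⟨l, hl1, hl2, fun t ht => ?_⟩
    have h2 := hl3 _ (hsub (hmem u hu t ht)).2.1
    have e : ∑ i, w i * (η ^ l * D l i (u, t0 + η * t)) =
        η ^ l * ∑ i, w i * D l i (u, t0 + η * t) := by
      rw [Finset.mul_sum]; exact Finset.sum_congr rfl fun i _ => by ring
    show _ ≤ |∑ i, w i * (η ^ l * D l i (u, t0 + η * t))|
    rw [e, abs_mul, abs_of_nonneg (pow_nonneg hη0.le l)]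
    refine (min_le_right _ _).trans ?_
    exact mul_le_mul (pow_le_pow_of_le_one hη0.le hη1 hl2) h2 hc1.le (by positivity)
  · intro t ht
    refine ⟨?_, (hsub (hmem u hu t ht)).1.2⟩
    funext i
    simp [hD, DT]

end BM


set_option linter.unusedSectionVars false
set_option linter.unusedVariables false
namespace BM

lemma tiny (s c : ℝ) (hs : 0 < s) (hc : 0 < c) : ∃ κ : ℕ → ℝ, (∀ l, 0 < κ l ∧ κ l ≤ 1) ∧
    ∑' l, ENNReal.ofReal (κ l ^ s) ≤ ENNReal.ofReal c := by
  obtain ⟨ε, hε, hsum⟩ := ENNReal.exists_pos_sum_of_countable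
    (ENNReal.ofReal_pos.2 hc).ne' ℕ
  have hp : ∀ l, (0:ℝ) < min (ε l : ℝ) 1 := fun l => lt_min (by exact_mod_cast hε l) one_pos
  refine ⟨fun l => (min (ε l : ℝ) 1) ^ (1/s), fun l => ⟨Real.rpow_pos_of_pos (hp l) _,
    Real.rpow_le_one (hp l).le (min_le_right _ _) (by positivity)⟩, ?_⟩
  refine (ENNReal.tsum_le_tsum fun l => ?_).trans hsum.le
  rw [← Real.rpow_mul (hp l).le, one_div_mul_cancel hs.ne', Real.rpow_one]
  refine (ENNReal.ofReal_le_ofReal (min_le_left _ _)).trans ?_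
  simp

lemma choose_D (S η a κ : ℝ) (hS : 0 < S) (hη : 0 < η) (ha : 0 ≤ a) (haη : a ≤ η/2) (hκ : 0 < κ) :
    ∃ D, a < D ∧ D ≤ η ∧ D ^ S ≤ a ^ S + κ := by
  have h1 : ContinuousAt (fun x : ℝ => x ^ S) a := Real.continuousAt_rpow_const a S (Or.inr hS.le)
  have h2 : ∀ᶠ x in nhds a, x ^ S < a ^ S + κ := h1.eventually (gt_mem_nhds (by linarith))
  have h3 : ∀ᶠ x in nhds a, x < η := gt_mem_nhds (by linarith)
  have h4 : ∀ᶠ x in nhdsWithin a (Set.Ioi a), a < x := self_mem_nhdsWithin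
  obtain ⟨D, ⟨hD1, hD2⟩, hD3⟩ := (((h2.and h3).filter_mono nhdsWithin_le_nhds).and h4).exists
  exact ⟨D, hD3, hD2.le, hD1.le⟩

lemma good_cover {X : Type*} [MetricSpace X] (A : Set X) (S η K : ℝ)
    (hS : 0 < S) (hη : 0 < η) (hK : 0 < K) (hdim : dimH A < ENNReal.ofReal S) :
    ∃ (T : ℕ → Set X) (D : ℕ → ℝ), A ⊆ ⋃ l, T l ∧ (∀ l, 0 < D l ∧ D l ≤ η) ∧
      (∀ l, ∀ x ∈ T l, ∀ y ∈ T l, dist x y < D l) ∧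
      ∑' l, ENNReal.ofReal (D l ^ S) < ENNReal.ofReal K := by
  borelize X
  have hz : Measure.hausdorffMeasure S A = 0 := by
    have := hausdorffMeasure_of_dimH_lt (s := A) (d := S.toNNReal) hdim
    rwa [Real.coe_toNNReal _ hS.le] at this
  rw [Measure.hausdorffMeasure_apply] at hz
  have h1 := iSup_eq_zero.1 hz (ENNReal.ofReal (η/2))
  have h2 := iSup_eq_zero.1 h1 (ENNReal.ofReal_pos.2 (by positivity))
  have h3 : (⨅ (t : ℕ → Set X), ⨅ (_ : A ⊆ ⋃ n, t n),
      ⨅ (_ : ∀ n, Metric.ediam (t n) ≤ ENNReal.ofReal (η/2)),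
      ∑' (n : ℕ), ⨆ (_ : (t n).Nonempty), Metric.ediam (t n) ^ S) < ENNReal.ofReal (K/2) := by
    rw [h2]; exact ENNReal.ofReal_pos.2 (by positivity)
  simp only [iInf_lt_iff] at h3
  obtain ⟨T, hcov, hdiam, hsum⟩ := h3
  obtain ⟨κ, hκ, hκs⟩ := tiny 1 (K/2) one_pos (by positivity)
  have hfin : ∀ l, Metric.ediam (T l) ≠ ⊤ := fun l => ((hdiam l).trans_lt ENNReal.ofReal_lt_top).ne
  have hDex : ∀ l, ∃ D, (Metric.ediam (T l)).toReal < D ∧ D ≤ η ∧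
      D ^ S ≤ (Metric.ediam (T l)).toReal ^ S + κ l := fun l =>
    choose_D S η _ (κ l) hS hη ENNReal.toReal_nonneg
      (ENNReal.toReal_le_of_le_ofReal (by positivity) (hdiam l)) (hκ l).1
  choose D hD1 hD2 hD3 using hDex
  refine ⟨T, D, hcov, fun l => ⟨ENNReal.toReal_nonneg.trans_lt (hD1 l), hD2 l⟩, ?_, ?_⟩
  · intro l x hx y hy
    refine lt_of_le_of_lt ?_ (hD1 l)
    rw [dist_edist]
    exact ENNReal.toReal_mono (hfin l) (Metric.edist_le_ediam_of_mem hx hy)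
  · have hle : ∀ l, ENNReal.ofReal (D l ^ S) ≤
        (⨆ (_ : (T l).Nonempty), Metric.ediam (T l) ^ S) + ENNReal.ofReal (κ l ^ (1:ℝ)) := by
      intro l
      refine (ENNReal.ofReal_le_ofReal (hD3 l)).trans ?_
      rw [ENNReal.ofReal_add (by positivity) (hκ l).1.le, Real.rpow_one]
      refine add_le_add ?_ le_rfl
      rw [← ENNReal.ofReal_rpow_of_nonneg ENNReal.toReal_nonneg hS.le, ENNReal.ofReal_toReal (hfin l)]
      rcases Set.eq_empty_or_nonempty (T l) with h | h
      · rw [h]; simp [hS]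
      · exact le_iSup (fun _ : (T l).Nonempty => Metric.ediam (T l) ^ S) h
    refine (ENNReal.tsum_le_tsum hle).trans_lt ?_
    rw [ENNReal.tsum_add]
    have e : ENNReal.ofReal K = ENNReal.ofReal (K/2) + ENNReal.ofReal (K/2) := by
      rw [← ENNReal.ofReal_add (by positivity) (by positivity)]; congr 1; ring
    rw [e]
    exact ENNReal.add_lt_add_of_lt_of_le (hκs.trans_lt ENNReal.ofReal_lt_top).ne hsum hκs

lemma fubini {m : ℕ} (u0 : Fin m → ℝ) (η t0 s c : ℝ) (hη : 0 < η) (hη1 : η ≤ 1) (hs : 0 < s)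
    (hc : 0 < c) (X : Set ((Fin m → ℝ) × ℝ))
    (hslice : ∀ u ∈ Metric.closedBall u0 η, ∀ (V : ℕ → Set ℝ) (d : ℕ → ℝ), (∀ l, 0 < d l) →
      (∀ l, d l ≤ 1) → (∀ l, ∀ x ∈ V l, ∀ y ∈ V l, |x - y| < d l) →
      (∀ t ∈ Set.Icc (0:ℝ) 1, (u, t0 + η * t) ∈ X → ∃ l, t ∈ V l) →
      ENNReal.ofReal c ≤ ∑' l, ENNReal.ofReal (d l ^ s)) :
    ENNReal.ofReal (m + s) ≤ dimH X := by
  by_contra hlt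
  rw [not_le] at hlt
  have hS : 0 < (m:ℝ) + s := by positivity
  set K := c / 2 * η ^ ((m:ℝ) + s) with hK
  have hK0 : 0 < K := by positivity
  obtain ⟨T, D, hcov, hD, hdist, hsum⟩ := good_cover X (m + s) η K hS hη hK0 hlt
  obtain ⟨κ, hκ, hκs⟩ := tiny s (c/2) hs (by positivity)
  have hub : ∀ l, ∃ ul : Fin m → ℝ, ∀ z ∈ T l, z.1 ∈ Metric.closedBall ul (D l) := by
    intro l
    rcases Set.eq_empty_or_nonempty (T l) with h | ⟨z0, hz0⟩
    · exact ⟨0, fun z hz => by rw [h] at hz; exact hz.elim⟩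
    · refine ⟨z0.1, fun z hz => ?_⟩
      rw [Metric.mem_closedBall]
      exact (le_max_left _ _).trans ((Prod.dist_eq (x := z) (y := z0)).symm.le.trans (hdist l z hz z0 hz0).le)
  choose ul hul using hub
  set d : ℕ → ℝ := fun l => D l / η with hd
  have hd0 : ∀ l, 0 < d l := fun l => div_pos (hD l).1 hη
  have hpt : ∀ u ∈ Metric.closedBall u0 η, ENNReal.ofReal (c/2) ≤ ∑' l,
      (Metric.closedBall (ul l) (D l)).indicator (fun _ => ENNReal.ofReal (d l ^ s)) u := by
    intro u hu
    classical
    have h1 := hslice u hu (fun l => {t | (u, t0 + η * t) ∈ T l})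
      (fun l => if u ∈ Metric.closedBall (ul l) (D l) then d l else κ l)
      (fun l => by
        by_cases h : u ∈ Metric.closedBall (ul l) (D l)
        · simp only [if_pos h]; exact hd0 l
        · simp only [if_neg h]; exact (hκ l).1)
      (fun l => by
        by_cases h : u ∈ Metric.closedBall (ul l) (D l)
        · simp only [if_pos h]; exact (div_le_one hη).2 (hD l).2
        · simp only [if_neg h]; exact (hκ l).2)
      (fun l x hx y hy => by
        have h : u ∈ Metric.closedBall (ul l) (D l) := hul l _ hx
        simp only [if_pos h]
        have h2 := hdist l _ hx _ hy
        rw [Prod.dist_eq] at h2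
        have h3 := (le_max_right _ _).trans_lt h2
        rw [Real.dist_eq] at h3
        have e : t0 + η * x - (t0 + η * y) = η * (x - y) := by ring
        simp only [e, abs_mul, abs_of_pos hη] at h3
        rw [hd, lt_div_iff₀ hη]; linarith)
      (fun t ht hX => by
        obtain ⟨l, hl⟩ := Set.mem_iUnion.1 (hcov hX)
        exact ⟨l, hl⟩)
    have h2 : ∑' l, ENNReal.ofReal ((if u ∈ Metric.closedBall (ul l) (D l) then d l else κ l) ^ s) ≤
        (∑' l, (Metric.closedBall (ul l) (D l)).indicator (fun _ => ENNReal.ofReal (d l ^ s)) u)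
          + ENNReal.ofReal (c/2) := by
      refine le_trans ?_ (add_le_add_right hκs _)
      rw [← ENNReal.tsum_add]
      refine ENNReal.tsum_le_tsum fun l => ?_
      by_cases h : u ∈ Metric.closedBall (ul l) (D l)
      · rw [if_pos h, Set.indicator_of_mem h]; exact le_self_add
      · rw [if_neg h]; exact le_add_self
    have h3 := h1.trans h2
    have e : ENNReal.ofReal c = ENNReal.ofReal (c/2) + ENNReal.ofReal (c/2) := by
      rw [← ENNReal.ofReal_add (by positivity) (by positivity)]; congr 1; ring
    rw [e] at h3
    exact (ENNReal.add_le_add_iff_right ENNReal.ofReal_ne_top).1 h3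
  have hInt : ENNReal.ofReal (c/2) * volume (Metric.closedBall u0 η) ≤
      ∑' l, ENNReal.ofReal (d l ^ s) * volume (Metric.closedBall (ul l) (D l)) := by
    rw [← lintegral_indicator_const Metric.isClosed_closedBall.measurableSet]
    simp_rw [← lintegral_indicator_const (μ := (volume : Measure (Fin m → ℝ)))
      (Metric.isClosed_closedBall (x := ul _) (ε := D _)).measurableSet]
    rw [← lintegral_tsum (fun l =>
      (measurable_const.indicator Metric.isClosed_closedBall.measurableSet).aemeasurable)]
    apply lintegral_mono
    intro u
    by_cases hu : u ∈ Metric.closedBall u0 η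
    · rw [Set.indicator_of_mem hu]; exact hpt u hu
    · rw [Set.indicator_of_notMem hu]; exact zero_le
  have hvol : ∀ l, ENNReal.ofReal (d l ^ s) * volume (Metric.closedBall (ul l) (D l)) =
      ENNReal.ofReal (2 ^ m * η ^ (-s)) * ENNReal.ofReal (D l ^ ((m:ℝ) + s)) := by
    intro l
    rw [Real.volume_pi_closedBall _ (hD l).1.le, Fintype.card_fin,
      ← ENNReal.ofReal_mul (by have := hd0 l; positivity), ← ENNReal.ofReal_mul (by positivity)]
    congr 1
    rw [hd, Real.div_rpow (hD l).1.le hη.le, Real.rpow_add (hD l).1, Real.rpow_natCast,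
      Real.rpow_neg hη.le, mul_pow]
    field_simp
  simp_rw [hvol] at hInt
  rw [ENNReal.tsum_mul_left, Real.volume_pi_closedBall _ hη.le, Fintype.card_fin,
      ← ENNReal.ofReal_mul (by positivity)] at hInt
  have hpos : 0 < (2:ℝ) ^ m * η ^ (-s) := by positivity
  have hlt2 : ENNReal.ofReal (2 ^ m * η ^ (-s)) * ∑' l, ENNReal.ofReal (D l ^ ((m:ℝ) + s)) <
      ENNReal.ofReal (2 ^ m * η ^ (-s)) * ENNReal.ofReal K :=
    ENNReal.mul_lt_mul_right (ENNReal.ofReal_pos.2 hpos).ne' ENNReal.ofReal_ne_top hsum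
  have hfin := hInt.trans_lt hlt2
  rw [← ENNReal.ofReal_mul (by positivity)] at hfin
  have e : c / 2 * (2 * η) ^ m = 2 ^ m * η ^ (-s) * K := by
    rw [hK, Real.rpow_add hη, Real.rpow_natCast, Real.rpow_neg hη.le, mul_pow]
    field_simp
  rw [e] at hfin
  exact lt_irrefl _ hfin

end BM


set_option linter.unusedSectionVars false
set_option linter.unusedVariables false
namespace BM

lemma anti_nhd {E F : Type*} [NormedAddCommGroup E] [NormedSpace ℝ E] [NormedAddCommGroup F]
    [NormedSpace ℝ F] [FiniteDimensional ℝ E] (H : E → F) (z0 : E) (A : E →L[ℝ] F)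
    (hA : Function.Injective A) (hH : HasStrictFDerivAt H A z0) :
    ∃ N ∈ nhds z0, ∃ K : NNReal, AntilipschitzWith K (N.restrict H) := by
  obtain ⟨K, hK0, hK⟩ := (LinearMap.injective_iff_antilipschitz (A : E →ₗ[ℝ] F)).1 hA
  have hK0' : (0:ℝ) < K := hK0
  have h1 := hH.isLittleO.bound (show (0:ℝ) < 1/(2*K) by positivity)
  rw [nhds_prod_eq] at h1
  obtain ⟨N, hN, hNN⟩ := Filter.mem_prod_self_iff.1 h1
  refine ⟨N, hN, 2*K, AntilipschitzWith.of_le_mul_dist ?_⟩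
  rintro ⟨x, hx⟩ ⟨y, hy⟩
  have h2 : ‖H x - H y - A (x - y)‖ ≤ 1 / (2 * (K:ℝ)) * ‖x - y‖ := hNN (Set.mk_mem_prod hx hy)
  have h3 := hK.le_mul_dist x y
  rw [dist_eq_norm, dist_eq_norm, ContinuousLinearMap.coe_coe, ← map_sub] at h3
  have h4 : ‖A (x - y)‖ ≤ ‖H x - H y‖ + ‖H x - H y - A (x - y)‖ := by
    have : A (x - y) = (H x - H y) - (H x - H y - A (x - y)) := by abel
    calc ‖A (x - y)‖ = ‖(H x - H y) - (H x - H y - A (x - y))‖ := by rw [← this]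
      _ ≤ _ := norm_sub_le _ _
  have h5 : (K:ℝ) * (1/(2*K) * ‖x - y‖) = ‖x - y‖/2 := by field_simp
  show dist x y ≤ ((2*K : NNReal) : ℝ) * dist (H x) (H y)
  rw [dist_eq_norm, dist_eq_norm]
  push_cast
  have h6 : (K:ℝ) * ‖A (x - y)‖ ≤ K * (‖H x - H y‖ + 1/(2*K) * ‖x - y‖) :=
    mul_le_mul_of_nonneg_left (h4.trans (by linarith)) hK0'.le
  nlinarith

lemma dim_anti {E F : Type*} [MetricSpace E] [MetricSpace F] (H : E → F) (N X : Set E)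
    (hX : X ⊆ N) (K : NNReal) (hK : AntilipschitzWith K (N.restrict H)) :
    dimH X ≤ dimH (H '' X) := by
  have h1 := hK.le_dimH_image (((↑) : N → E) ⁻¹' X)
  have h2 : ((↑) : N → E) '' (((↑) : N → E) ⁻¹' X) = X := by
    rw [Subtype.image_preimage_coe]; exact Set.inter_eq_right.2 hX
  have h3 : dimH (((↑) : N → E) ⁻¹' X) = dimH X := by
    rw [← (isometry_subtype_coe (s := N)).dimH_image, h2]
  have h4 : N.restrict H '' (((↑) : N → E) ⁻¹' X) = H '' X := by
    have : N.restrict H = H ∘ ((↑) : N → E) := rfl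
    rw [this, Set.image_comp, h2]
  rw [h3, h4] at h1
  exact h1

/-- the coordinate map of the foliation by curves -/
noncomputable def Phi {m : ℕ} (q : Fin (m+1) → Polynomial ℝ) (j : Fin (m+1))
    (z : (Fin m → ℝ) × ℝ) : EuclideanSpace ℝ (Fin (m+1)) :=
  WithLp.toLp 2 (fun k => (q k).eval z.2 + (Fin.insertNth j (0:ℝ) z.1 : Fin (m+1) → ℝ) k)

lemma Phi_analytic {m : ℕ} (q : Fin (m+1) → Polynomial ℝ) (j : Fin (m+1)) (z : (Fin m → ℝ) × ℝ) :
    AnalyticAt ℝ (Phi q j) z := by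
  have h1 : AnalyticAt ℝ (fun z : (Fin m → ℝ) × ℝ => (fun k => (q k).eval z.2 +
      (Fin.insertNth j (0:ℝ) z.1 : Fin (m+1) → ℝ) k : Fin (m+1) → ℝ)) z := by
    rw [analyticAt_pi_iff]
    intro k
    have hp : AnalyticAt ℝ (fun z : (Fin m → ℝ) × ℝ => (q k).eval z.2) z := by
      have : AnalyticAt ℝ (fun z : (Fin m → ℝ) × ℝ => Polynomial.aeval z.2 (q k)) z :=
        AnalyticAt.aeval_polynomial analyticAt_snd (q k)
      simpa using this
    apply hp.add
    rcases Fin.eq_self_or_eq_succAbove j k with rfl | ⟨k', rfl⟩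
    · simp only [Fin.insertNth_apply_same]; exact analyticAt_const
    · simp only [Fin.insertNth_apply_succAbove]
      exact (ContinuousLinearMap.analyticAt
        (ContinuousLinearMap.proj (R := ℝ) (φ := fun _ : Fin m => ℝ) k') _).comp analyticAt_fst
  exact (ContinuousLinearEquiv.analyticAt
    (PiLp.continuousLinearEquiv 2 ℝ (fun _ : Fin (m+1) => ℝ)).symm _).comp h1

lemma Phi_zero {m : ℕ} (q : Fin (m+1) → Polynomial ℝ) (j : Fin (m+1)) (t : ℝ) :
    Phi q j (0, t) = WithLp.toLp 2 (fun k => (q k).eval t) := by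
  unfold Phi
  congr 1
  funext k
  rcases Fin.eq_self_or_eq_succAbove j k with rfl | ⟨k', rfl⟩ <;> simp

lemma Phi_inj {m : ℕ} (q : Fin (m+1) → Polynomial ℝ) (j : Fin (m+1)) (z : (Fin m → ℝ) × ℝ)
    (hj : (q j).derivative.eval z.2 ≠ 0) : Function.Injective (fderiv ℝ (Phi q j) z) := by
  rw [injective_iff_map_eq_zero]
  rintro ⟨u, t⟩ hz
  have hd := (Phi_analytic q j z).differentiableAt.hasFDerivAt
  have hc : ∀ k, HasFDerivAt (fun z => Phi q j z k)
      ((EuclideanSpace.proj (𝕜 := ℝ) k).comp (fderiv ℝ (Phi q j) z)) z := fun k =>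
    (EuclideanSpace.proj k : EuclideanSpace ℝ (Fin (m+1)) →L[ℝ] ℝ).hasFDerivAt.comp z hd
  have hc0 : ∀ k, ((EuclideanSpace.proj (𝕜 := ℝ) k).comp (fderiv ℝ (Phi q j) z)) (u, t) = 0 := by
    intro k
    rw [ContinuousLinearMap.comp_apply, hz, map_zero]
  have hp : ∀ k, HasFDerivAt (fun z : (Fin m → ℝ) × ℝ => (q k).eval z.2)
      ((q k).derivative.eval z.2 • ContinuousLinearMap.snd ℝ (Fin m → ℝ) ℝ) z := fun k =>
    ((q k).hasDerivAt z.2).comp_hasFDerivAt z hasFDerivAt_snd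
  have ht : t = 0 := by
    have h1 : HasFDerivAt (fun z => Phi q j z j)
        ((q j).derivative.eval z.2 • ContinuousLinearMap.snd ℝ (Fin m → ℝ) ℝ) z := by
      have e : (fun z => Phi q j z j) = fun z : (Fin m → ℝ) × ℝ => (q j).eval z.2 := by
        funext z; simp [Phi]
      rw [e]; exact hp j
    have h2 := hc0 j
    rw [(hc j).unique h1] at h2
    simpa [hj] using h2
  have hu : u = 0 := by
    funext k
    have h1 : HasFDerivAt (fun z => Phi q j z (j.succAbove k))
        ((q (j.succAbove k)).derivative.eval z.2 • ContinuousLinearMap.snd ℝ (Fin m → ℝ) ℝ +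
          (ContinuousLinearMap.proj (R := ℝ) (φ := fun _ : Fin m => ℝ) k).comp
            (ContinuousLinearMap.fst ℝ (Fin m → ℝ) ℝ)) z := by
      have e : (fun z => Phi q j z (j.succAbove k)) =
          fun z : (Fin m → ℝ) × ℝ => (q (j.succAbove k)).eval z.2 + z.1 k := by
        funext z; simp [Phi]
      rw [e]
      exact (hp _).add (ContinuousLinearMap.hasFDerivAt
        ((ContinuousLinearMap.proj (R := ℝ) (φ := fun _ : Fin m => ℝ) k).comp
            (ContinuousLinearMap.fst ℝ (Fin m → ℝ) ℝ)))
    have h2 := hc0 (j.succAbove k)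
    rw [(hc _).unique h1] at h2
    simpa [ht] using h2
  rw [ht, hu]; rfl

theorem lower {m n : ℕ} (hn : 0 < n) (x₀ : EuclideanSpace ℝ (Fin (m+1))) (ρ : ℝ) (hρ : 0 < ρ)
    (f : EuclideanSpace ℝ (Fin (m+1)) → EuclideanSpace ℝ (Fin n))
    (hanal : AnalyticOnNhd ℝ f (Metric.ball x₀ ρ)) (hnd : NondegOn f (Metric.ball x₀ ρ))
    (himm : ∀ x ∈ Metric.ball x₀ ρ, Function.Injective (fderiv ℝ f x))
    (W : Set (Fin n → ℝ)) (hWcnt : W.Countable) (hWsub : W ⊆ Weights n)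
    (ε0 : ℝ) (hε : 0 < ε0) (hε1 : ε0 ≤ 1) (hτ : ∀ r ∈ W, ε0 ≤ tauW r) :
    ((m+1 : ℕ) : ℝ≥0∞) ≤ dimH ((⋂ r ∈ W, BadSet r) ∩ f '' Metric.ball x₀ ρ) := by
  set B := Metric.ball x₀ ρ with hBdef
  have hBo : IsOpen B := Metric.isOpen_ball
  obtain ⟨q, hqB, hqnd⟩ := exists_curve f x₀ ρ hρ hanal.continuousOn hnd
  have hji : ∀ i, AnalyticOnNhd ℝ (fun x => f x i) B := fun i x hx =>
    (ContinuousLinearMap.analyticAt (EuclideanSpace.proj (𝕜 := ℝ) i) _).comp (hanal x hx)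
  have hline : ∀ t : ℝ, AnalyticAt ℝ (fun t : ℝ => ((0, t) : (Fin m → ℝ) × ℝ)) t := fun t =>
    analyticAt_const.prod analyticAt_id
  have hγan : ∀ t : ℝ, AnalyticAt ℝ (fun t => (WithLp.toLp 2 (fun k => (q k).eval t) :
      EuclideanSpace ℝ (Fin (m+1)))) t := by
    intro t
    have := (Phi_analytic q 0 (0, t)).comp_of_eq (hline t) rfl
    refine this.congr (Filter.Eventually.of_forall fun s => ?_)
    exact Phi_zero q 0 s
  obtain ⟨t0, ht0, hd0, hw0⟩ := exists_t0 (fun i t => f (WithLp.toLp 2 (fun k => (q k).eval t)) i)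
    (fun i t ht => (hji i _ (hqB t ht)).comp_of_eq (hγan t) rfl) hqnd
  obtain ⟨j, hj⟩ : ∃ j, (q j).derivative.eval t0 ≠ 0 := by
    by_contra hcon
    push Not at hcon
    apply hd0 ⟨0, hn⟩
    have h1 : HasDerivAt (fun t => (WithLp.toLp 2 (fun k => (q k).eval t) :
      EuclideanSpace ℝ (Fin (m+1)))) 0 t0 := by
      have h0 : HasDerivAt (fun t => (fun k => (q k).eval t : Fin (m+1) → ℝ)) 0 t0 := by
        rw [hasDerivAt_pi]
        intro k
        have := (q k).hasDerivAt t0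
        rw [hcon k] at this
        exact this
      have h2 := ((PiLp.continuousLinearEquiv 2 ℝ (fun _ : Fin (m+1) => ℝ)).symm.hasFDerivAt
        (x := fun k => (q k).eval t0)).comp_hasDerivAt t0 h0
      rw [map_zero] at h2
      exact h2
    have h2 := (hji ⟨0, hn⟩ _ (hqB t0 ht0)).differentiableAt.hasFDerivAt
    have h3 := h2.comp_hasDerivAt t0 h1
    rw [map_zero] at h3
    exact h3.deriv
  set H : (Fin m → ℝ) × ℝ → EuclideanSpace ℝ (Fin n) := fun z => f (Phi q j z) with hH
  have hΦc : Continuous (Phi q j) :=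
    continuous_iff_continuousAt.2 fun z => (Phi_analytic q j z).continuousAt
  set O : Set ((Fin m → ℝ) × ℝ) := Phi q j ⁻¹' B with hO
  have hOo : IsOpen O := hBo.preimage hΦc
  have hHan : AnalyticOnNhd ℝ H O := fun z hz =>
    (hanal _ hz).comp_of_eq (Phi_analytic q j z) rfl
  have hz0 : ((0, t0) : (Fin m → ℝ) × ℝ) ∈ O := by
    show Phi q j (0, t0) ∈ B
    rw [Phi_zero]; exact hqB t0 ht0
  have hHinj : Function.Injective (fderiv ℝ H (0, t0)) := by
    have e : fderiv ℝ H (0, t0) = (fderiv ℝ f (Phi q j (0, t0))).comp (fderiv ℝ (Phi q j) (0, t0)) :=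
      fderiv_comp _ (hanal _ hz0).differentiableAt (Phi_analytic q j _).differentiableAt
    rw [e, ContinuousLinearMap.coe_comp]
    exact (himm _ hz0).comp (Phi_inj q j _ hj)
  obtain ⟨N, hN, K, hK⟩ := anti_nhd H (0, t0) _ hHinj (hHan _ hz0).hasStrictFDerivAt
  have hH0 : ∀ i, (fun t => H (0, t) i) = fun t => f (WithLp.toLp 2 (fun k => (q k).eval t)) i := by
    intro i; funext t; simp only [hH, Phi_zero]
  obtain ⟨η, hη0, hη1, Bd, hBd, c1, hc1, l0, G, hG⟩ := family H O hOo hHan 0 t0 hz0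
    (fun i => by rw [hH0]; exact hd0 i)
    (fun w hw => by simp only [hH0]; exact hw0 w hw) (N ∩ O) (Filter.inter_mem hN (hOo.mem_nhds hz0))
  set X : Set ((Fin m → ℝ) × ℝ) := {z | z ∈ N ∧ z ∈ O ∧ ∀ r ∈ W, H z ∈ BadSet r} with hX
  have hXdim : ((m+1 : ℕ) : ℝ≥0∞) ≤ dimH X := by
    obtain ⟨s0, hs0, hcurve⟩ := curve_thm n W hWcnt hWsub ε0 hε hε1 hτ Bd hBd c1 hc1 l0
    have hev : ∀ s, max s0 0 < s → s < 1 → ENNReal.ofReal (m + s) ≤ dimH X := by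
      intro s hs hs1
      have hs00 := (le_max_right s0 0).trans_lt hs
      obtain ⟨c, hc, hcc⟩ := hcurve s ((le_max_left s0 0).trans hs.le) hs00 hs1
      apply fubini 0 η t0 s c hη0 hη1 hs00 hc X
      intro u hu V d hd hd1 hV hcov
      apply hcc (G u) (hG u hu).1 V d hd hd1 hV
      intro t ht hbad
      apply hcov t ht
      obtain ⟨e, hNO⟩ := (hG u hu).2 t ht
      refine ⟨hNO.1, hNO.2, fun r hr => ?_⟩
      have := hbad r hr
      rw [e] at this
      exact this
    have hlim : Filter.Tendsto (fun s : ℝ => ENNReal.ofReal (m + s)) (nhdsWithin 1 (Set.Iio 1))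
        (nhds (ENNReal.ofReal (m + 1))) := by
      have : Continuous (fun s : ℝ => ENNReal.ofReal (m + s)) :=
        ENNReal.continuous_ofReal.comp (by fun_prop)
      exact (this.tendsto 1).mono_left nhdsWithin_le_nhds
    have e : ((m+1 : ℕ) : ℝ≥0∞) = ENNReal.ofReal (m + 1) := by
      rw [← ENNReal.ofReal_natCast]; push_cast; rfl
    rw [e]
    refine le_of_tendsto hlim ?_
    filter_upwards [Ioo_mem_nhdsLT (max_lt hs0 one_pos)] with s hs
    exact hev s hs.1 hs.2
  refine hXdim.trans ((dim_anti H N X (fun z hz => hz.1) K hK).trans (dimH_mono ?_))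
  rintro _ ⟨z, ⟨hzN, hzO, hzW⟩, rfl⟩
  exact ⟨Set.mem_iInter₂.2 hzW, Phi q j z, hzO, rfl⟩

end BM

theorem stmt1 (m n : ℕ) (hm : 1 ≤ m) (hmn : m ≤ n)
    (x₀ : EuclideanSpace ℝ (Fin m)) (ρ : ℝ) (hρ : 0 < ρ)
    (B : Set (EuclideanSpace ℝ (Fin m))) (hB : B = Metric.ball x₀ ρ)
    (f : EuclideanSpace ℝ (Fin m) → EuclideanSpace ℝ (Fin n))
    (hanal : AnalyticOnNhd ℝ f B) (hnd : NondegOn f B)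
    (himm : ∀ x ∈ B, Function.Injective (fderiv ℝ f x))
    (M : Set (EuclideanSpace ℝ (Fin n))) (hM : M = f '' B)
    (W : Set (Fin n → ℝ)) (hWcnt : W.Countable) (hWsub : W ⊆ Weights n)
    (hτ : ∃ ε > 0, ∀ r ∈ W, ε ≤ tauW r) :
    dimH ((⋂ r ∈ W, BadSet r) ∩ M) = dimH M ∧ dimH M = (m : ℝ≥0∞) := by
  obtain ⟨m, rfl⟩ : ∃ m', m = m' + 1 := ⟨m - 1, by omega⟩
  obtain ⟨ε, hε, hτ⟩ := hτ
  subst hB hM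
  have hlow := BM.lower (by omega) x₀ ρ hρ f hanal hnd himm W hWcnt hWsub (min ε 1)
    (lt_min hε one_pos) (min_le_right _ _) (fun r hr => (min_le_left _ _).trans (hτ r hr))
  have hup : dimH (f '' Metric.ball x₀ ρ) ≤ ((m+1 : ℕ) : ℝ≥0∞) := by
    have h1 : ContDiffOn ℝ 1 f (Metric.ball x₀ ρ) :=
      fun x hx => (hanal x hx).contDiffAt.contDiffWithinAt
    refine (h1.dimH_image_le (convex_ball x₀ ρ) subset_rfl).trans ?_
    refine (dimH_mono (Set.subset_univ _)).trans ?_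
    rw [Real.dimH_univ_eq_finrank]
    simp
  have hmid : dimH ((⋂ r ∈ W, BadSet r) ∩ f '' Metric.ball x₀ ρ) ≤ dimH (f '' Metric.ball x₀ ρ) :=
    dimH_mono Set.inter_subset_right
  exact ⟨le_antisymm hmid (hup.trans hlow), le_antisymm hup (hlow.trans hmid)⟩
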